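/- Let k ≥ 1 be a natural number and let F(X) = ∏_{i=1}^k (a_i X + b_i) with a_i nonzero integers and b_i integers, such that F is admissible and Δ(F) ≠ 0. Let L : c_1x_1 + c_2x_2 + c_3x_3 = 0 be a translation invariant linear equation in s = 3 variables with nonzero integer coefficients. Then for every ε > 0 there exist a constant c(F,L,ε) > 0 and a natural number N(F,L,ε) such that for every N ≥ N(F,L,ε), every subset A ⊆ S_F(N, N^{1/(4k+1)}) with |A| ≥ c(F,L,ε)·(log log N)^{-(1-ε)}·|S_F(N, N^{1/(4k+1)})| contains a non-trivial solution of L, i.e. there exist x_1, x_2, x_3 ∈ A with c_1x_1 + c_2x_2 + c_3x_3 = 0 and x_i ≠ x_j for some i, j. -/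

import Mathlib

/-- The primorial of a real number `z`: the product of all primes `p ≤ z`. -/
noncomputable def primor (z : ℝ) : ℕ :=
  ∏ p ∈ (Finset.range (⌊z⌋₊ + 1)).filter Nat.Prime, p

/-- `S_F(N, z)`: the set of natural numbers `n ≤ N` with `gcd(F(n), P(z)) = 1`. -/
noncomputable def SFset (F : ℤ → ℤ) (N : ℕ) (z : ℝ) : Finset ℕ :=
  (Finset.Icc 1 N).filter (fun n => Int.gcd (F n) (primor z) = 1)

open Finset
set_option linter.all false




section KM
variable {G : Type*} [AddCommGroup G] [Fintype G] [DecidableEq G]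

/-- correlation -/
def corr (f g : G → ℝ) (t : G) : ℝ := ∑ x, f x * g (x + t)
/-- convolution -/
def cnv (f g : G → ℝ) (t : G) : ℝ := ∑ x, f x * g (t - x)
/-- real indicator -/
def ind (X : Finset G) (x : G) : ℝ := if x ∈ X then 1 else 0

lemma km_powers {ι : Type*} (Z : Finset ι) (φ : ι → G → ℝ) (p : ℕ) :
    ∑ x : Fin p → G, (∑ z ∈ Z, ∏ i, φ z (x i)) ^ 2
      = ∑ z ∈ Z, ∑ z' ∈ Z, (∑ x, φ z x * φ z' x) ^ p := by
  simp_rw [Fintype.sum_pow, sq, Finset.sum_mul_sum, Finset.prod_mul_distrib]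
  rw [Finset.sum_comm]
  refine Finset.sum_congr rfl fun z _ => ?_
  rw [Finset.sum_comm]

lemma corr_shift (f : G → ℝ) (a b : G) :
    ∑ x, f (x + a) * f (x + b) = corr f f (b - a) := by
  unfold corr
  rw [← Equiv.sum_comp (Equiv.addRight a) (fun x => f x * f (x + (b - a)))]
  refine Finset.sum_congr rfl fun x _ => ?_
  simp

lemma corr_neg (f : G → ℝ) (t : G) : corr f f (-t) = corr f f t := by
  rw [← sub_zero t, neg_sub, ← corr_shift, ← corr_shift]
  exact Finset.sum_congr rfl fun x _ => mul_comm _ _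

lemma km_corr_pow (f : G → ℝ) (W : Finset G) (p : ℕ) :
    ∑ x : Fin p → G, (∑ z ∈ W, ∏ i, f (x i + z)) ^ 2
      = ∑ z ∈ W, ∑ z' ∈ W, (corr f f (z - z')) ^ p := by
  rw [km_powers W (fun z x => f (x + z)) p, Finset.sum_comm]
  simp_rw [corr_shift]

lemma km_corr_nonneg (f : G → ℝ) (W : Finset G) (p : ℕ) :
    0 ≤ ∑ z ∈ W, ∑ z' ∈ W, (corr f f (z - z')) ^ p := by
  rw [← km_corr_pow]; positivity

lemma km_decouple (f g : G → ℝ) (Z₁ Z₂ : Finset G) (p : ℕ) :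
    (∑ z₁ ∈ Z₁, ∑ z₂ ∈ Z₂, (cnv f g (z₁ + z₂)) ^ p) ^ 2
      ≤ (∑ z ∈ Z₁, ∑ z' ∈ Z₁, (corr f f (z - z')) ^ p)
        * (∑ z ∈ Z₂, ∑ z' ∈ Z₂, (corr g g (z - z')) ^ p) := by
  have h1 : ∑ z₁ ∈ Z₁, ∑ z₂ ∈ Z₂, (cnv f g (z₁ + z₂)) ^ p
      = ∑ x : Fin p → G, (∑ z ∈ Z₁, ∏ i, f (- x i + z)) * (∑ z ∈ Z₂, ∏ i, g (x i + z)) := by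
    have h2 : ∀ z₁ z₂ : G, cnv f g (z₁ + z₂) = ∑ x, f (-x + z₁) * g (x + z₂) := by
      intro z₁ z₂
      unfold cnv
      rw [← Equiv.sum_comp (Equiv.subLeft z₁) (fun x => f x * g (z₁ + z₂ - x))]
      refine Finset.sum_congr rfl fun x _ => ?_
      simp only [Equiv.subLeft_apply]
      congr 2 <;> abel
    simp_rw [h2, Fintype.sum_pow, Finset.sum_mul_sum, Finset.prod_mul_distrib]
    symm
    rw [Finset.sum_comm]
    refine Finset.sum_congr rfl fun z _ => ?_
    rw [Finset.sum_comm]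
  rw [h1]
  refine (Finset.sum_mul_sq_le_sq_mul_sq _ _ _).trans (le_of_eq ?_)
  rw [km_corr_pow g]
  congr 1
  rw [← km_corr_pow f]
  rw [← Equiv.sum_comp (Equiv.neg (Fin p → G)) (fun x : Fin p → G => (∑ z ∈ Z₁, ∏ i, f (x i + z)) ^ 2)]
  rfl

lemma corr_ind (X Y : Finset G) (t : G) :
    corr (ind X) (ind Y) t = ((X.filter (fun x => x + t ∈ Y)).card : ℝ) := by
  unfold corr ind
  simp only [mul_ite, mul_one, mul_zero]
  rw [Finset.card_filter]
  push_cast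
  rw [← Finset.sum_filter_add_sum_filter_not Finset.univ (fun x => x ∈ X)]
  simp only [Finset.filter_mem_eq_inter, Finset.univ_inter]
  rw [Finset.sum_eq_zero (s := Finset.univ.filter (fun x => x ∉ X)), add_zero]
  · exact Finset.sum_congr rfl fun x hx => by simp [hx]
  · intro x hx
    simp at hx
    simp [hx]

end KM
section KM
variable {G : Type*} [AddCommGroup G] [Fintype G] [DecidableEq G]

lemma pow_le_choose_mul (p c : ℕ) (hc : 1 ≤ c) : c ^ p ≤ (c * p).choose p := by
  induction p with
  | zero => simp
  | succ p ih =>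
    have h1 : (c * (p+1)).choose (p+1) * (p+1) = (c*(p+1)) * (c * (p+1) - 1).choose p := by
      have hpos : 1 ≤ c * (p+1) := Nat.mul_pos hc (Nat.succ_pos _)
      obtain ⟨n, hn⟩ : ∃ n, c * (p+1) = n + 1 := ⟨c*(p+1)-1, by omega⟩
      rw [hn, Nat.add_sub_cancel]
      exact (Nat.add_one_mul_choose_eq n p).symm
    have h2 : (c * p).choose p ≤ (c * (p+1) - 1).choose p := by
      apply Nat.choose_le_choose
      rw [Nat.mul_succ]; omega
    have h3 : c ^ (p+1) * (p+1) ≤ (c * (p+1)).choose (p+1) * (p+1) := by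
      rw [h1, pow_succ]
      calc c ^ p * c * (p+1) = (c * (p+1)) * c^p := by ring
        _ ≤ _ := Nat.mul_le_mul_left _ (ih.trans h2)
    exact Nat.le_of_mul_le_mul_right h3 (Nat.succ_pos _)

lemma corr_expand (X D : Finset G) (α : ℝ) (t : G) :
    corr (fun x => ind X x - α * ind D x) (fun x => ind X x - α * ind D x) t
      = corr (ind X) (ind X) t - α * corr (ind X) (ind D) t - α * corr (ind D) (ind X) t
        + α^2 * corr (ind D) (ind D) t := by
  unfold corr
  simp only [Finset.mul_sum, ← Finset.sum_sub_distrib, ← Finset.sum_add_distrib]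
  exact Finset.sum_congr rfl fun x _ => by ring

lemma corr_comm (f g : G → ℝ) (t : G) : corr f g t = corr g f (-t) := by
  unfold corr
  rw [← Equiv.sum_comp (Equiv.addRight t) (fun x => g x * f (x + -t))]
  refine Finset.sum_congr rfl fun x _ => ?_
  simp [mul_comm]

lemma corr_ind_le (X Y : Finset G) (t : G) : corr (ind X) (ind Y) t ≤ X.card := by
  rw [corr_ind]; exact_mod_cast Finset.card_filter_le _ _

lemma corr_ind_ge (X D : Finset G) (hX : X ⊆ D) (t : G) (e : ℝ)
    (h : ((D.filter (fun x => x + t ∉ D)).card : ℝ) ≤ e) :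
    (X.card : ℝ) - e ≤ corr (ind X) (ind D) t := by
  rw [corr_ind]
  have h1 := Finset.card_filter_add_card_filter_not (s := X) (fun x => x + t ∈ D)
  have h2 : (X.filter (fun x => ¬ (x + t ∈ D))).card ≤ (D.filter (fun x => x + t ∉ D)).card :=
    Finset.card_le_card (Finset.filter_subset_filter _ hX)
  have h3 : ((X.filter (fun x => x + t ∈ D)).card : ℝ) + ((X.filter (fun x => ¬ (x + t ∈ D))).card : ℝ)
    = X.card := by exact_mod_cast h1
  have h4 : ((X.filter (fun x => ¬ (x + t ∈ D))).card : ℝ) ≤ (D.filter (fun x => x + t ∉ D)).card := by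
    exact_mod_cast h2
  linarith

lemma km_pw_aux (M u c η' : ℝ) (q : ℕ) (hM0 : 0 < M) (hu0 : 0 ≤ u) (hη'0 : 0 ≤ η') (hqe : Even q)
    (hqη : q * η' ≤ 1 / 2) (b1 : M + c ≤ u + η' * M) (b2' : u - η' * M ≤ M + c) :
    (M + c) ^ q ≤ 2 * u ^ q + 2 * M ^ q := by
  have hn := mul_nonneg hη'0 hM0.le
  have b2 : -(u + η' * M) ≤ M + c := by linarith
  have b3 : (M + c) ^ q ≤ (u + η' * M) ^ q := by
    rw [← hqe.pow_abs]
    exact pow_le_pow_left₀ (abs_nonneg _) (abs_le.2 ⟨b2, b1⟩) _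
  have b4 : (1 + η') ^ q ≤ 2 := by
    have h6 : (1 + η') ^ q ≤ Real.exp (q * η') := by
      rw [Real.exp_nat_mul]
      exact pow_le_pow_left₀ (by linarith) (by linarith [Real.add_one_le_exp η']) _
    have h7 : Real.exp (q * η') ≤ Real.exp (1/2) := Real.exp_le_exp.2 hqη
    have h8 : Real.exp (1/2) ≤ 2 := by
      have : Real.exp (1/2) ^ 2 = Real.exp 1 := by rw [← Real.exp_nat_mul]; norm_num
      nlinarith [Real.exp_one_lt_d9, Real.exp_pos (1/2)]
    linarith
  have hMq : 0 < M ^ q := pow_pos hM0 q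
  have huq : 0 ≤ u ^ q := pow_nonneg hu0 q
  refine b3.trans ?_
  rcases le_total M u with hc | hc
  · have := mul_le_mul_of_nonneg_left hc hη'0
    calc (u + η' * M) ^ q ≤ ((1 + η') * u) ^ q :=
          pow_le_pow_left₀ (by linarith) (by linarith) _
      _ = (1 + η') ^ q * u ^ q := mul_pow _ _ _
      _ ≤ 2 * u ^ q := mul_le_mul_of_nonneg_right b4 huq
      _ ≤ _ := by linarith
  · calc (u + η' * M) ^ q ≤ ((1 + η') * M) ^ q :=
          pow_le_pow_left₀ (by linarith) (by linarith) _
      _ = (1 + η') ^ q * M ^ q := mul_pow _ _ _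
      _ ≤ 2 * M ^ q := mul_le_mul_of_nonneg_right b4 hMq.le
      _ ≤ _ := by linarith

lemma km_mom_aux (f : G → ℝ) (W : Finset G) (M : ℝ) (hM0 : 0 < M) (p q : ℕ) (hq : q = 64 * p)
    (h : (M / 8) ^ p * (W.card : ℝ) ^ 2 ≤ ∑ w ∈ W, ∑ w' ∈ W, (corr f f (w - w')) ^ p) :
    8 ^ p * M ^ q * (W.card : ℝ) ^ 2 ≤ ∑ w ∈ W, ∑ w' ∈ W, (M + corr f f (w - w')) ^ q := by
  have hqp : p ≤ q := by omega
  have hexp : ∑ w ∈ W, ∑ w' ∈ W, (M + corr f f (w - w')) ^ q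
      = ∑ r ∈ range (q + 1), M ^ r * (q.choose r) *
          ∑ w ∈ W, ∑ w' ∈ W, (corr f f (w - w')) ^ (q - r) := by
    simp_rw [add_pow, Finset.mul_sum]
    symm
    rw [Finset.sum_comm]
    refine Finset.sum_congr rfl fun w _ => ?_
    rw [Finset.sum_comm]
    refine Finset.sum_congr rfl fun w' _ => ?_
    refine Finset.sum_congr rfl fun r _ => ?_
    ring
  rw [hexp]
  have hterm := Finset.single_le_sum (s := range (q+1))
    (f := fun r => M ^ r * (q.choose r) * ∑ w ∈ W, ∑ w' ∈ W, (corr f f (w - w')) ^ (q - r))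
    (fun r _ => mul_nonneg (by positivity) (km_corr_nonneg f W _))
    (Finset.mem_range.2 (show q - p < q + 1 by omega))
  refine le_trans ?_ hterm
  rw [Nat.sub_sub_self hqp, Nat.choose_symm hqp]
  have hch : (64:ℝ) ^ p ≤ (q.choose p : ℝ) := by
    rw [hq]; exact_mod_cast pow_le_choose_mul p 64 (by norm_num)
  have hMM : M ^ q = M ^ (q - p) * M ^ p := by rw [← pow_add]; congr 1; omega
  have h64 : (64:ℝ)^p = 8^p * 8^p := by rw [← mul_pow]; norm_num
  have h8 : (8:ℝ)^p ≠ 0 := by positivity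
  calc 8 ^ p * M ^ q * (W.card : ℝ) ^ 2 = M ^ (q - p) * 64 ^ p * ((M / 8) ^ p * (W.card : ℝ) ^ 2) := by
        rw [hMM, div_pow, h64]; field_simp
    _ ≤ _ := by
        apply mul_le_mul _ h (by positivity) (by positivity)
        exact mul_le_mul_of_nonneg_left hch (by positivity)

lemma km_pt_aux (M α η η' x d u c1 c2 cD : ℝ) (hα0 : 0 < α) (hx0 : 0 < x) (hxd : x ≤ d)
    (hη : 0 ≤ η) (hη' : 2 * η * d ≤ η' * x) (hαD : α * d = x) (hM : M = α * x)
    (i1 : x - η * d ≤ c1) (i2 : x - η * d ≤ c2) (i3 : d - η * d ≤ cD) (i4 : cD ≤ d)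
    (i5 : c1 ≤ x) (i6 : c2 ≤ x) :
    M + (u - α * c1 - α * c2 + α^2 * cD) ≤ u + η' * M ∧
    u - η' * M ≤ M + (u - α * c1 - α * c2 + α^2 * cD) := by
  have t1 : α ^ 2 * d = M := by rw [hM, ← hαD]; ring
  have hk := mul_le_mul_of_nonneg_left hη' hα0.le
  have hk2 : α * (η' * x) = η' * M := by rw [hM]; ring
  have hk3 : 0 ≤ α * (η * d) := by
    have : 0 ≤ d := by linarith
    positivity
  constructor
  · have k1 := mul_le_mul_of_nonneg_left i1 hα0.le
    have k2 := mul_le_mul_of_nonneg_left i2 hα0.le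
    have k4 := mul_le_mul_of_nonneg_left i4 (sq_nonneg α)
    have e : α * (x - η * d) = M - α * (η * d) := by rw [hM]; ring
    have e2 : α * (2 * η * d) = 2 * (α * (η * d)) := by ring
    linarith
  · have k1 := mul_le_mul_of_nonneg_left i5 hα0.le
    have k2 := mul_le_mul_of_nonneg_left i6 hα0.le
    have k4 := mul_le_mul_of_nonneg_left i3 (sq_nonneg α)
    have e : α^2 * (d - η * d) = M - η * (α * x) := by rw [← hαD] at hM ⊢; rw [hM]; ring
    have e3 : η * (α * x) ≤ α * (η * d) := by
      have := mul_le_mul_of_nonneg_left hxd (mul_nonneg hα0.le hη)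
      linarith [mul_comm α η, show η * (α * x) = α * η * x by ring, show α * (η * d) = α * η * d by ring]
    have e2 : α * (2 * η * d) = 2 * (α * (η * d)) := by ring
    linarith

lemma km_unbalance (X D W : Finset G) (hX : X ⊆ D) (hXne : X.Nonempty) (η η' : ℝ) (p q : ℕ)
    (hinv : ∀ w ∈ W, ∀ w' ∈ W, ((D.filter (fun x => x + (w - w') ∉ D)).card : ℝ) ≤ η * D.card)
    (hη : 0 ≤ η) (hη' : 2 * η * D.card ≤ η' * X.card) (hq : q = 64 * p) (hp : 2 ≤ p) (hpe : Even p)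
    (hqη : q * η' ≤ 1 / 2) (M α : ℝ) (hα : α = (X.card : ℝ) / D.card) (hM : M = α * X.card)
    (h : (M / 8) ^ p * (W.card : ℝ) ^ 2 ≤ ∑ w ∈ W, ∑ w' ∈ W,
      (corr (fun x => ind X x - α * ind D x) (fun x => ind X x - α * ind D x) (w - w')) ^ p) :
    4 ^ p * M ^ q * (W.card : ℝ) ^ 2 ≤ ∑ w ∈ W, ∑ w' ∈ W, (corr (ind X) (ind X) (w - w')) ^ q := by
  have hx0 : (0:ℝ) < X.card := by exact_mod_cast hXne.card_pos
  have hd0 : (0:ℝ) < D.card := by exact_mod_cast (hXne.mono hX).card_pos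
  have hxd : (X.card : ℝ) ≤ D.card := by exact_mod_cast Finset.card_le_card hX
  have hα0 : 0 < α := by rw [hα]; positivity
  have hM0 : 0 < M := by rw [hM]; positivity
  have hαD : α * D.card = X.card := by rw [hα]; field_simp
  have hη'0 : 0 ≤ η' := by
    by_contra hc
    push Not at hc
    have := mul_neg_of_neg_of_pos hc hx0
    have := mul_nonneg hη hd0.le
    linarith
  have hqe : Even q := by rw [hq]; exact hpe.mul_left _
  have hmom := km_mom_aux _ W M hM0 p q hq h
  have hpt : ∀ w ∈ W, ∀ w' ∈ W, (M + corr (fun x => ind X x - α * ind D x) (fun x => ind X x - α * ind D x) (w - w')) ^ q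
      ≤ 2 * (corr (ind X) (ind X) (w - w')) ^ q + 2 * M ^ q := by
    intro w hw w' hw'
    have hu0 : 0 ≤ corr (ind X) (ind X) (w - w') := by rw [corr_ind]; positivity
    have i1 := corr_ind_ge X D hX _ _ (hinv w hw w' hw')
    have i2 := corr_ind_ge X D hX _ _ (hinv w' hw' w hw)
    have i3 := corr_ind_ge D D (le_refl _) _ _ (hinv w hw w' hw')
    have i4 := corr_ind_le D D (w - w')
    have i5 := corr_ind_le X D (w - w')
    have i6 := corr_ind_le X D (w' - w)
    have e2 : corr (ind D) (ind X) (w - w') = corr (ind X) (ind D) (w' - w) := by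
      rw [corr_comm, neg_sub]
    rw [corr_expand X D α (w - w'), e2]
    obtain ⟨b1, b2⟩ := km_pt_aux M α η η' X.card D.card (corr (ind X) (ind X) (w - w')) _ _ _
      hα0 hx0 hxd hη hη' hαD hM i1 i2 i3 i4 i5 i6
    exact km_pw_aux M _ _ η' q hM0 hu0 hη'0 hqe hqη b1 b2
  have hsum : ∑ w ∈ W, ∑ w' ∈ W, (M + corr (fun x => ind X x - α * ind D x) (fun x => ind X x - α * ind D x) (w - w')) ^ q
      ≤ 2 * ∑ w ∈ W, ∑ w' ∈ W, (corr (ind X) (ind X) (w - w')) ^ q + 2 * M ^ q * (W.card : ℝ) ^ 2 := by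
    refine (Finset.sum_le_sum fun w hw => Finset.sum_le_sum fun w' hw' => hpt w hw w' hw').trans (le_of_eq ?_)
    simp only [Finset.sum_add_distrib, Finset.sum_const, nsmul_eq_mul, Finset.mul_sum]
    ring
  have h8 : (2:ℝ) * 4 ^ p + 2 ≤ 8 ^ p := by
    have h9 : (4:ℝ) ≤ 2 ^ p := by
      calc (4:ℝ) = 2 ^ 2 := by norm_num
        _ ≤ 2 ^ p := pow_le_pow_right₀ (by norm_num) hp
    have h10 : (1:ℝ) ≤ 4 ^ p := one_le_pow₀ (by norm_num)
    have : (8:ℝ) ^ p = 2 ^ p * 4 ^ p := by rw [← mul_pow]; norm_num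
    have h11 := mul_le_mul_of_nonneg_right h9 (by linarith : (0:ℝ) ≤ 4^p)
    linarith
  have hnn : 0 ≤ M ^ q * (W.card : ℝ) ^ 2 := by positivity
  have h12 := mul_le_mul_of_nonneg_right h8 hnn
  have e1 : (2 * 4 ^ p + 2) * (M ^ q * (W.card : ℝ) ^ 2) = 2 * (4 ^ p * M ^ q * (W.card : ℝ) ^ 2) + 2 * M ^ q * (W.card : ℝ) ^ 2 := by ring
  have e2 : 8 ^ p * (M ^ q * (W.card : ℝ) ^ 2) = 8 ^ p * M ^ q * (W.card : ℝ) ^ 2 := by ring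
  linarith

end KM
section KM
variable {G : Type*} [AddCommGroup G] [Fintype G] [DecidableEq G]

lemma km_sum_pairs (W : Finset G) (q : ℕ) (g : G → ℝ) (b : G → G → ℝ) :
    ∑ x : Fin q → G, ∑ w ∈ W, ∑ w' ∈ W, (∏ i, g (x i + w)) * (∏ i, g (x i + w')) * b w w'
      = ∑ w ∈ W, ∑ w' ∈ W, (corr g g (w' - w)) ^ q * b w w' := by
  rw [Finset.sum_comm]
  refine Finset.sum_congr rfl fun w _ => ?_
  rw [Finset.sum_comm]
  refine Finset.sum_congr rfl fun w' _ => ?_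
  rw [← Finset.sum_mul, ← corr_shift, Fintype.sum_pow]
  simp_rw [Finset.prod_mul_distrib]

lemma prod_ind (X : Finset G) (q : ℕ) (x : Fin q → G) (w : G) :
    ∏ i, ind X (x i + w) = if (∀ i, x i + w ∈ X) then 1 else 0 := by
  unfold ind
  split_ifs with h
  · exact Finset.prod_eq_one fun i _ => by simp [h i]
  · push Not at h
    obtain ⟨i, hi⟩ := h
    exact Finset.prod_eq_zero (Finset.mem_univ i) (by simp [hi])

lemma sum_ind (X : Finset G) (w : G) : ∑ x, ind X (x + w) = X.card := by
  have := Equiv.sum_comp (Equiv.addRight w) (fun x => ind X x)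
  simp only [Equiv.coe_addRight] at this
  rw [this]; simp [ind]

lemma km_sift (X W : Finset G) (p q : ℕ) (M α : ℝ) (hq : q = 64 * p) (hp : 12 ≤ p)
    (hα : 0 < α) (hM : M = α * X.card) (hXne : X.Nonempty) (hW : W.Nonempty)
    (h : 4 ^ p * M ^ q * (W.card : ℝ) ^ 2 ≤ ∑ w ∈ W, ∑ w' ∈ W, (corr (ind X) (ind X) (w - w')) ^ q) :
    ∃ V ⊆ W, α ^ q * W.card ≤ V.card ∧
      (((V ×ˢ V).filter (fun v => corr (ind X) (ind X) (v.1 - v.2) < 1.01 * M)).card : ℝ)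
        ≤ 1 / 2000 * (V.card : ℝ) ^ 2 := by
  classical
  by_contra hcon
  push Not at hcon
  have hx0 : (0:ℝ) < X.card := by exact_mod_cast hXne.card_pos
  have hw0 : (0:ℝ) < W.card := by exact_mod_cast hW.card_pos
  have hM0 : 0 < M := by rw [hM]; positivity
  set V : (Fin q → G) → Finset G := fun x => W.filter (fun w => ∀ i, x i + w ∈ X) with hV
  set bd : G → G → ℝ := fun v v' => if corr (ind X) (ind X) (v - v') < 1.01 * M then 1 else 0 with hbd
  have hVcard : ∀ x, ((V x).card : ℝ) = ∑ w ∈ W, ∏ i, ind X (x i + w) := by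
    intro x
    simp_rw [prod_ind]
    rw [hV]; simp
  have hbad : ∀ x, ((((V x) ×ˢ (V x)).filter (fun v => corr (ind X) (ind X) (v.1 - v.2) < 1.01 * M)).card : ℝ)
      = ∑ w ∈ W, ∑ w' ∈ W, (∏ i, ind X (x i + w)) * (∏ i, ind X (x i + w')) * bd w w' := by
    intro x
    rw [Finset.card_filter, Finset.sum_product]
    push_cast
    rw [hV, Finset.sum_filter]
    refine Finset.sum_congr rfl fun w _ => ?_
    rw [prod_ind]
    by_cases hc : ∀ i, x i + w ∈ X
    · rw [if_pos hc, if_pos hc, Finset.sum_filter]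
      refine Finset.sum_congr rfl fun w' _ => ?_
      rw [prod_ind]
      by_cases hc' : ∀ i, x i + w' ∈ X
      · rw [if_pos hc', if_pos hc']; simp [hbd]
      · rw [if_neg hc', if_neg hc']; simp
    · rw [if_neg hc, if_neg hc]; simp
  have key : ∀ x, 1/2000 * (((V x).card : ℝ)^2 - α ^ q * W.card * (V x).card) ≤
      ((((V x) ×ˢ (V x)).filter (fun v => corr (ind X) (ind X) (v.1 - v.2) < 1.01 * M)).card : ℝ) := by
    intro x
    by_cases hc : α ^ q * W.card ≤ (V x).card
    · have h1 := hcon (V x) (Finset.filter_subset _ _) hc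
      have : 0 ≤ α ^ q * W.card * (V x).card := by positivity
      linarith
    · push Not at hc
      have h1 : ((V x).card : ℝ)^2 ≤ α ^ q * W.card * (V x).card := by
        rw [sq]; exact mul_le_mul_of_nonneg_right hc.le (by positivity)
      have : (0:ℝ) ≤ ((((V x) ×ˢ (V x)).filter (fun v => corr (ind X) (ind X) (v.1 - v.2) < 1.01 * M)).card : ℝ) := by positivity
      linarith
  have hs := Finset.sum_le_sum fun x (_ : x ∈ (Finset.univ : Finset (Fin q → G))) => key x
  have s1 : ∑ x, ((V x).card : ℝ)^2 = ∑ w ∈ W, ∑ w' ∈ W, (corr (ind X) (ind X) (w - w')) ^ q := by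
    simp_rw [hVcard]; exact km_corr_pow _ _ _
  have s2 : ∑ x, ((V x).card : ℝ) = W.card * (X.card:ℝ) ^ q := by
    simp_rw [hVcard]
    rw [Finset.sum_comm]
    have : ∀ w ∈ W, ∑ x : Fin q → G, ∏ i, ind X (x i + w) = (X.card : ℝ)^q := by
      intro w _
      rw [← sum_ind X w, Fintype.sum_pow]
    rw [Finset.sum_congr rfl this]; simp
  have s3 : ∑ x, ((((V x) ×ˢ (V x)).filter (fun v => corr (ind X) (ind X) (v.1 - v.2) < 1.01 * M)).card : ℝ)
      ≤ (1.01 * M) ^ q * (W.card : ℝ)^2 := by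
    simp_rw [hbad]
    rw [km_sum_pairs]
    have : ∀ w ∈ W, ∀ w' ∈ W, (corr (ind X) (ind X) (w' - w)) ^ q * bd w w' ≤ (1.01 * M) ^ q := by
      intro w _ w' _
      simp only [hbd]
      rw [← corr_neg, neg_sub]
      split_ifs with hc
      · rw [mul_one]
        exact pow_le_pow_left₀ (by rw [corr_ind]; positivity) hc.le _
      · rw [mul_zero]; positivity
    refine (Finset.sum_le_sum fun w hw => Finset.sum_le_sum fun w' hw' => this w hw w' hw').trans (le_of_eq ?_)
    simp; ring
  rw [← Finset.mul_sum, Finset.sum_sub_distrib, ← Finset.mul_sum, s1, s2] at hs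
  have hMq : M ^ q = α ^ q * (X.card:ℝ)^q := by rw [hM, mul_pow]
  have e1 : α ^ q * W.card * (W.card * (X.card:ℝ) ^ q) = M ^ q * (W.card:ℝ)^2 := by rw [hMq]; ring
  rw [e1] at hs
  have hP : 0 < M ^ q * (W.card:ℝ)^2 := by positivity
  have h2 : (1.01:ℝ) ^ q ≤ 2 ^ p := by
    rw [hq, pow_mul]
    exact pow_le_pow_left₀ (by norm_num) (by norm_num) _
  have h3 : (4096:ℝ) ≤ 2 ^ p := by
    calc (4096:ℝ) = 2 ^ 12 := by norm_num
      _ ≤ _ := pow_le_pow_right₀ (by norm_num) hp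
  have h4 : (4:ℝ)^p = 2^p * 2^p := by rw [← mul_pow]; norm_num
  have h5 : (2:ℝ)^p < 1/2000 * (4^p - 1) := by
    rw [h4]
    have := mul_le_mul_of_nonneg_right h3 (by positivity : (0:ℝ) ≤ 2^p)
    linarith
  have h6 : (1.01 * M) ^ q * (W.card : ℝ)^2 = 1.01 ^ q * (M ^ q * (W.card:ℝ)^2) := by rw [mul_pow]; ring
  have h7 := mul_le_mul_of_nonneg_right h2 hP.le
  have h8 := mul_lt_mul_of_pos_right h5 hP
  have h9 : 4 ^ p * (M ^ q * (W.card : ℝ) ^ 2) = 4 ^ p * M ^ q * (W.card : ℝ) ^ 2 := by ring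
  linarith

end KM
section KM
variable {G : Type*} [AddCommGroup G] [Fintype G] [DecidableEq G]

lemma km_localize (V W' WW : Finset G) (hV : V.Nonempty) (hW' : W'.Nonempty) (θ δ : ℝ) (hδ : 0 < δ)
    (hWW : ∀ v ∈ V, ∀ w ∈ W', v - w ∈ WW) (hθ : θ * WW.card ≤ 2 * V.card)
    (P : G → G → Prop) [DecidableRel P]
    (hbad : (((V ×ˢ V).filter (fun v => P v.1 v.2)).card : ℝ) ≤ δ * (V.card : ℝ) ^ 2) :
    ∃ y, ∃ V2 ⊆ V, (∀ v ∈ V2, v - y ∈ W') ∧ θ / 4 * W'.card ≤ V2.card ∧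
      (((V ×ˢ V2).filter (fun v => P v.1 v.2)).card : ℝ) ≤ 2 * δ * (V.card * V2.card) := by
  classical
  by_contra hcon
  push Not at hcon
  have hv0 : (0:ℝ) < V.card := by exact_mod_cast hV.card_pos
  have hw0 : (0:ℝ) < W'.card := by exact_mod_cast hW'.card_pos
  set V2 : G → Finset G := fun y => V.filter (fun v => v - y ∈ W') with hV2
  have hcnt : ∀ v ∈ V, ((WW.filter (fun y => v - y ∈ W')).card : ℝ) = W'.card := by
    intro v hv
    congr 1
    refine Finset.card_bij' (fun y _ => v - y) (fun w _ => v - w) ?_ ?_ ?_ ?_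
    · intro y hy; exact (Finset.mem_filter.1 hy).2
    · intro w hw
      exact Finset.mem_filter.2 ⟨hWW v hv w hw, by simpa using hw⟩
    · intro y _; simp
    · intro y _; simp
  have s1 : ∑ y ∈ WW, ((V2 y).card : ℝ) = W'.card * V.card := by
    simp only [hV2, Finset.card_filter]
    push_cast
    rw [Finset.sum_comm]
    have : ∀ v ∈ V, ∑ y ∈ WW, (if v - y ∈ W' then (1:ℝ) else 0) = W'.card := by
      intro v hv
      rw [← hcnt v hv, Finset.card_filter]; push_cast; rfl
    rw [Finset.sum_congr rfl this]; simp [mul_comm]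
  have s2 : ∑ y ∈ WW, (((V ×ˢ (V2 y)).filter (fun v => P v.1 v.2)).card : ℝ)
      = W'.card * (((V ×ˢ V).filter (fun v => P v.1 v.2)).card : ℝ) := by
    have e1 : ∀ y, (((V ×ˢ (V2 y)).filter (fun v => P v.1 v.2)).card : ℝ)
        = ∑ v ∈ V, ∑ v' ∈ V, (if v' - y ∈ W' then (1:ℝ) else 0) * (if P v v' then 1 else 0) := by
      intro y
      rw [Finset.card_filter, Finset.sum_product]
      push_cast
      refine Finset.sum_congr rfl fun v _ => ?_
      simp only [hV2, Finset.sum_filter]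
      refine Finset.sum_congr rfl fun v' _ => ?_
      split_ifs <;> simp
    simp_rw [e1]
    rw [Finset.sum_comm, Finset.card_filter, Finset.sum_product]
    push_cast
    rw [Finset.mul_sum]
    refine Finset.sum_congr rfl fun v _ => ?_
    rw [Finset.sum_comm, Finset.mul_sum]
    refine Finset.sum_congr rfl fun v' hv' => ?_
    rw [← Finset.sum_mul]
    congr 1
    rw [← hcnt v' hv', Finset.card_filter]; push_cast; rfl
  have key : ∀ y ∈ WW, 2 * δ * V.card * ((V2 y).card - θ / 4 * W'.card)
      < (((V ×ˢ (V2 y)).filter (fun v => P v.1 v.2)).card : ℝ) := by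
    intro y _
    by_cases hc : θ / 4 * W'.card ≤ (V2 y).card
    · have h1 := hcon y (V2 y) (Finset.filter_subset _ _) (fun v hv => (Finset.mem_filter.1 hv).2) hc
      have h2 : θ < 0 ∨ 0 ≤ θ := lt_or_ge _ _
      rcases h2 with h2 | h2
      · exfalso
        have h3 := hcon 0 ∅ (Finset.empty_subset _) (by simp) (by
          simp only [Finset.card_empty, Nat.cast_zero]
          exact mul_nonpos_of_nonpos_of_nonneg (by linarith) hw0.le)
        simp at h3
      · have : 0 ≤ 2 * δ * V.card * (θ / 4 * W'.card) := by positivity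
        rw [mul_sub]; linarith [mul_assoc (2*δ) (V.card:ℝ) ((V2 y).card:ℝ)]
    · push Not at hc
      have h1 : 2 * δ * V.card * ((V2 y).card - θ / 4 * W'.card) < 0 :=
        mul_neg_of_pos_of_neg (by positivity) (by linarith)
      have h2 : (0:ℝ) ≤ (((V ×ˢ (V2 y)).filter (fun v => P v.1 v.2)).card : ℝ) := by positivity
      linarith
  have hWWne : WW.Nonempty := by
    obtain ⟨v, hv⟩ := hV
    obtain ⟨w, hw⟩ := hW'
    exact ⟨_, hWW v hv w hw⟩
  have hs := Finset.sum_lt_sum_of_nonempty hWWne key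
  rw [s2, ← Finset.mul_sum, Finset.sum_sub_distrib, s1] at hs
  simp only [Finset.sum_const, nsmul_eq_mul] at hs
  have h3 := mul_le_mul_of_nonneg_left hbad hw0.le
  have h4 : (WW.card : ℝ) * (θ / 4 * W'.card) ≤ V.card * W'.card / 2 := by
    have := mul_le_mul_of_nonneg_right hθ hw0.le
    linarith
  have h5 := mul_le_mul_of_nonneg_left h4 (by positivity : 0 ≤ 2 * δ * V.card)
  have e1 : 2 * δ * V.card * (W'.card * V.card - WW.card * (θ / 4 * W'.card))
    = 2 * (W'.card * (δ * (V.card:ℝ)^2)) - 2 * δ * V.card * (WW.card * (θ / 4 * W'.card)) := by ring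
  have e2 : 2 * δ * V.card * (V.card * W'.card / 2) = W'.card * (δ * (V.card:ℝ)^2) := by ring
  rw [e1] at hs
  rw [e2] at h5
  linarith

lemma exp_le_cosh_add (t y : ℝ) (hy : |y| ≤ 1) : Real.exp (t * y) ≤ Real.cosh t + y * Real.sinh t := by
  have h := convexOn_exp.2 (Set.mem_univ t) (Set.mem_univ (-t))
    (show 0 ≤ (1 + y) / 2 by linarith [neg_le_of_abs_le hy])
    (show 0 ≤ (1 - y) / 2 by linarith [le_of_abs_le hy]) (by ring)
  simp only [smul_eq_mul] at h
  rw [Real.cosh_eq, Real.sinh_eq]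
  have e : (1 + y) / 2 * t + (1 - y) / 2 * -t = t * y := by ring
  rw [e] at h
  linarith

lemma chernoff_one (V : Finset G) (m : ℕ) (Y : G → ℝ) (hY : ∀ v ∈ V, |Y v| ≤ 1)
    (h0 : ∑ v ∈ V, Y v = 0) (δ : ℝ) (hδ : 0 < δ) :
    (((Fintype.piFinset (fun _ : Fin m => V)).filter (fun a => m * δ < ∑ i, Y (a i))).card : ℝ)
      ≤ Real.exp (-(m * δ ^ 2 / 2)) * (V.card : ℝ) ^ m := by
  have h1 : ∑ v ∈ V, Real.exp (δ * Y v) ≤ V.card * Real.exp (δ ^ 2 / 2) := by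
    calc ∑ v ∈ V, Real.exp (δ * Y v) ≤ ∑ v ∈ V, (Real.cosh δ + Y v * Real.sinh δ) :=
          Finset.sum_le_sum fun v hv => exp_le_cosh_add _ _ (hY v hv)
      _ = V.card * Real.cosh δ := by
          rw [Finset.sum_add_distrib, ← Finset.sum_mul, h0]; simp
      _ ≤ _ := mul_le_mul_of_nonneg_left (Real.cosh_le_exp_half_sq δ) (by positivity)
  have h2 : ∑ a ∈ Fintype.piFinset (fun _ : Fin m => V), Real.exp (δ * ∑ i, Y (a i))
      = (∑ v ∈ V, Real.exp (δ * Y v)) ^ m := by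
    have := Finset.prod_univ_sum (fun _ : Fin m => V) (fun _ v => Real.exp (δ * Y v))
    simp only [Finset.prod_const, Finset.card_univ, Fintype.card_fin] at this
    rw [this]
    refine Finset.sum_congr rfl fun a _ => ?_
    rw [← Real.exp_sum, Finset.mul_sum]
  have h3 : (((Fintype.piFinset (fun _ : Fin m => V)).filter (fun a => m * δ < ∑ i, Y (a i))).card : ℝ)
      * Real.exp (m * δ ^ 2) ≤ (V.card * Real.exp (δ ^ 2 / 2)) ^ m := by
    refine le_trans ?_ (pow_le_pow_left₀ (Finset.sum_nonneg fun _ _ => (Real.exp_pos _).le) h1 m)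
    rw [← h2, ← nsmul_eq_mul]
    have hA := Finset.sum_le_sum_of_subset_of_nonneg (f := fun a : Fin m → G => Real.exp (δ * ∑ i, Y (a i)))
      (Finset.filter_subset (fun a => m * δ < ∑ i, Y (a i)) (Fintype.piFinset (fun _ : Fin m => V)))
      (fun _ _ _ => (Real.exp_pos _).le)
    refine le_trans ?_ hA
    apply Finset.card_nsmul_le_sum
    intro a ha
    apply Real.exp_le_exp.2
    have := (Finset.mem_filter.1 ha).2
    have := mul_le_mul_of_nonneg_left this.le hδ.le
    linarith
  rw [mul_pow, ← Real.exp_nat_mul] at h3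
  have h4 := mul_le_mul_of_nonneg_right h3 (Real.exp_pos (-(m * δ^2))).le
  rw [mul_assoc, ← Real.exp_add, mul_assoc, ← Real.exp_add] at h4
  have e1 : (m:ℝ) * δ ^ 2 + -(m * δ^2) = 0 := by ring
  have e2 : (m:ℝ) * (δ ^ 2/2) + -(m * δ^2) = -(m * δ ^ 2 / 2) := by ring
  rw [e1, e2, Real.exp_zero, mul_one] at h4
  linarith

lemma chernoff_two (V : Finset G) (m : ℕ) (Y : G → ℝ) (hY : ∀ v ∈ V, |Y v| ≤ 1)
    (h0 : ∑ v ∈ V, Y v = 0) (δ : ℝ) (hδ : 0 < δ) :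
    (((Fintype.piFinset (fun _ : Fin m => V)).filter (fun a => m * δ < |∑ i, Y (a i)|)).card : ℝ)
      ≤ 2 * Real.exp (-(m * δ ^ 2 / 2)) * (V.card : ℝ) ^ m := by
  have h1 := chernoff_one V m Y hY h0 δ hδ
  have h2 := chernoff_one V m (fun v => - Y v) (by simpa using hY) (by simpa using h0) δ hδ
  have h3 : (((Fintype.piFinset (fun _ : Fin m => V)).filter (fun a => m * δ < |∑ i, Y (a i)|)).card)
      ≤ ((Fintype.piFinset (fun _ : Fin m => V)).filter (fun a => m * δ < ∑ i, Y (a i))).card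
       + ((Fintype.piFinset (fun _ : Fin m => V)).filter (fun a => m * δ < ∑ i, - Y (a i))).card := by
    refine (Finset.card_le_card ?_).trans (Finset.card_union_le _ _)
    intro a ha
    rw [Finset.mem_filter] at ha
    rw [Finset.mem_union, Finset.mem_filter, Finset.mem_filter, Finset.sum_neg_distrib]
    rcases lt_abs.1 ha.2 with h | h
    · exact Or.inl ⟨ha.1, h⟩
    · exact Or.inr ⟨ha.1, h⟩
  have h4 : (((Fintype.piFinset (fun _ : Fin m => V)).filter (fun a => m * δ < |∑ i, Y (a i)|)).card : ℝ)
      ≤ ((Fintype.piFinset (fun _ : Fin m => V)).filter (fun a => m * δ < ∑ i, Y (a i))).card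
       + ((Fintype.piFinset (fun _ : Fin m => V)).filter (fun a => m * δ < ∑ i, - Y (a i))).card := by
    exact_mod_cast h3
  linarith
end KM
section KM
variable {G : Type*} [AddCommGroup G] [Fintype G] [DecidableEq G]

/-- averaged count -/
noncomputable def Psi (V1 V2 S : Finset G) (s : G) : ℝ :=
  (∑ v ∈ V1, (∑ v' ∈ V2, ind S (v + s - v')) / V2.card) / V1.card

lemma ind_nonneg (X : Finset G) (x : G) : 0 ≤ ind X x := by unfold ind; split_ifs <;> norm_num
lemma ind_le_one (X : Finset G) (x : G) : ind X x ≤ 1 := by unfold ind; split_ifs <;> norm_num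

lemma avg_ind_mem (V S : Finset G) (z : G) :
    0 ≤ (∑ v ∈ V, ind S (z - v)) / V.card ∧ (∑ v ∈ V, ind S (z - v)) / V.card ≤ 1 := by
  constructor
  · exact div_nonneg (Finset.sum_nonneg fun _ _ => ind_nonneg _ _) (by positivity)
  · apply div_le_one_of_le₀ _ (by positivity)
    calc _ ≤ ∑ v ∈ V, (1:ℝ) := Finset.sum_le_sum fun _ _ => ind_le_one _ _
      _ = _ := by simp

lemma cs_pt (V2 S : Finset G) (hV2 : V2.Nonempty) (m : ℕ) (hm : 0 < m) (δ : ℝ) (hδ : 0 < δ) (z : G) :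
    (((Fintype.piFinset (fun _ : Fin m => V2)).filter (fun a =>
      δ < |(∑ i, ind S (z - a i)) / m - (∑ v ∈ V2, ind S (z - v)) / V2.card|)).card : ℝ)
      ≤ 2 * Real.exp (-(m * δ ^ 2 / 2)) * (V2.card : ℝ) ^ m := by
  set g := (∑ v ∈ V2, ind S (z - v)) / V2.card with hg
  have hv0 : (0:ℝ) < V2.card := by exact_mod_cast hV2.card_pos
  have hm0 : (0:ℝ) < m := by exact_mod_cast hm
  obtain ⟨g0, g1⟩ := avg_ind_mem V2 S z
  refine le_trans ?_ (chernoff_two V2 m (fun v => ind S (z - v) - g) ?_ ?_ δ hδ)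
  · apply Nat.cast_le.2
    apply Finset.card_le_card
    intro a ha
    rw [Finset.mem_filter] at ha ⊢
    refine ⟨ha.1, ?_⟩
    have e : (∑ i, ind S (z - a i)) / m - g = (∑ i, (ind S (z - a i) - g)) / m := by
      rw [Finset.sum_sub_distrib]; simp; field_simp
    rw [e, abs_div, Nat.abs_cast, lt_div_iff₀ hm0] at ha
    linarith [ha.2]
  · intro v _
    have := ind_nonneg S (z - v)
    have := ind_le_one S (z - v)
    rw [abs_le]; constructor <;> linarith
  · rw [Finset.sum_sub_distrib, hg]; simp; field_simp; simp

lemma km_cs_good (V2 S Q : Finset G) (hV2 : V2.Nonempty) (m : ℕ) (hm : 0 < m) (δ v1 : ℝ) (hδ : 0 < δ)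
    (hv1 : 0 < v1) (hQ : 4 * Real.exp (-(m * δ ^ 2 / 2)) * Q.card ≤ δ * v1) :
    ∃ Lg ⊆ Fintype.piFinset (fun _ : Fin m => V2), (1/2 : ℝ) * (V2.card : ℝ) ^ m ≤ Lg.card ∧
      ∀ a ∈ Lg, ((Q.filter (fun z =>
        δ < |(∑ i, ind S (z - a i)) / m - (∑ v ∈ V2, ind S (z - v)) / V2.card|)).card : ℝ) ≤ δ * v1 := by
  classical
  set bd : (Fin m → G) → G → Prop := fun a z =>
    δ < |(∑ i, ind S (z - a i)) / m - (∑ v ∈ V2, ind S (z - v)) / V2.card| with hbd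
  set PP := Fintype.piFinset (fun _ : Fin m => V2) with hPP
  refine ⟨PP.filter (fun a => ((Q.filter (bd a)).card : ℝ) ≤ δ * v1), Finset.filter_subset _ _, ?_,
    fun a ha => (Finset.mem_filter.1 ha).2⟩
  have hc : (PP.card : ℝ) = (V2.card : ℝ) ^ m := by rw [hPP, Fintype.card_piFinset]; simp
  have h1 : ∑ a ∈ PP, ((Q.filter (bd a)).card : ℝ) ≤ Q.card * (2 * Real.exp (-(m * δ ^ 2 / 2)) * (V2.card : ℝ) ^ m) := by
    have e : ∑ a ∈ PP, ((Q.filter (bd a)).card : ℝ) = ∑ z ∈ Q, ((PP.filter (fun a => bd a z)).card : ℝ) := by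
      simp only [Finset.card_filter]; push_cast
      rw [Finset.sum_comm]
    rw [e, ← nsmul_eq_mul]
    apply Finset.sum_le_card_nsmul
    intro z _
    exact cs_pt V2 S hV2 m hm δ hδ z
  have h2 : ((PP.filter (fun a => ¬ ((Q.filter (bd a)).card : ℝ) ≤ δ * v1)).card : ℝ) * (δ * v1)
      ≤ ∑ a ∈ PP, ((Q.filter (bd a)).card : ℝ) := by
    refine le_trans ?_ (Finset.sum_le_sum_of_subset_of_nonneg (Finset.filter_subset (fun a => ¬ ((Q.filter (bd a)).card : ℝ) ≤ δ * v1) PP) (fun _ _ _ => by positivity))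
    rw [← nsmul_eq_mul]
    apply Finset.card_nsmul_le_sum
    intro a ha
    exact (not_le.1 (Finset.mem_filter.1 ha).2).le
  have h3 := Finset.card_filter_add_card_filter_not (s := PP) (fun a => ((Q.filter (bd a)).card : ℝ) ≤ δ * v1)
  have h3' : ((PP.filter (fun a => ((Q.filter (bd a)).card : ℝ) ≤ δ * v1)).card : ℝ) +
    ((PP.filter (fun a => ¬ ((Q.filter (bd a)).card : ℝ) ≤ δ * v1)).card : ℝ) = (V2.card : ℝ) ^ m := by
    rw [← hc]; exact_mod_cast h3
  have hdv : 0 < δ * v1 := by positivity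
  have h4 : ((PP.filter (fun a => ¬ ((Q.filter (bd a)).card : ℝ) ≤ δ * v1)).card : ℝ) * (δ * v1)
      ≤ ((1/2 : ℝ) * (V2.card : ℝ) ^ m) * (δ * v1) := by
    refine (h2.trans h1).trans ?_
    have := mul_le_mul_of_nonneg_right hQ (by positivity : (0:ℝ) ≤ (1/2 : ℝ) * (V2.card : ℝ) ^ m)
    linarith
  have h5 := le_of_mul_le_mul_right h4 hdv
  linarith

lemma cs_close (V1 Q : Finset G) (hV1 : V1.Nonempty) (δ : ℝ) (hδ : 0 < δ) (f g : G → ℝ) (s : G)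
    (hs : ∀ v ∈ V1, v + s ∈ Q) (hf : ∀ z, 0 ≤ f z ∧ f z ≤ 1) (hg : ∀ z, 0 ≤ g z ∧ g z ≤ 1)
    (hb : ((Q.filter (fun z => δ < |f z - g z|)).card : ℝ) ≤ δ * V1.card) :
    |(∑ v ∈ V1, f (v + s)) / V1.card - (∑ v ∈ V1, g (v + s)) / V1.card| ≤ 2 * δ := by
  have hv0 : (0:ℝ) < V1.card := by exact_mod_cast hV1.card_pos
  rw [← sub_div, ← Finset.sum_sub_distrib, abs_div, Nat.abs_cast, div_le_iff₀ hv0]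
  refine (Finset.abs_sum_le_sum_abs _ _).trans ?_
  have h1 : ∀ v ∈ V1, |f (v + s) - g (v + s)| ≤ δ + (if δ < |f (v + s) - g (v+s)| then 1 else 0) := by
    intro v _
    split_ifs with h
    · have := hf (v+s); have := hg (v+s)
      have : |f (v + s) - g (v + s)| ≤ 1 := by rw [abs_le]; constructor <;> linarith
      linarith
    · linarith
  refine (Finset.sum_le_sum h1).trans ?_
  rw [Finset.sum_add_distrib]
  have h2 : ∑ v ∈ V1, (if δ < |f (v + s) - g (v+s)| then (1:ℝ) else 0) ≤ δ * V1.card := by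
    refine le_trans ?_ hb
    rw [← Finset.natCast_card_filter]
    apply Nat.cast_le.2
    apply Finset.card_le_card_of_injOn (fun v => v + s)
    · intro v hv
      have hv := Finset.mem_filter.1 hv
      exact Finset.mem_coe.2 (Finset.mem_filter.2 ⟨hs v hv.1, hv.2⟩)
    · intro v _ v' _ h
      exact add_right_cancel h
  simp only [Finset.sum_const, nsmul_eq_mul]
  linarith

lemma km_cs (V1 V2 T R Q S : Finset G) (hV1 : V1.Nonempty) (hV2 : V2.Nonempty) (hR : R.Nonempty)
    (m : ℕ) (hm : 0 < m) (δ : ℝ) (hδ : 0 < δ)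
    (hRR : ∀ v ∈ V2, ∀ τ ∈ T, v + τ ∈ R)
    (hQ : 4 * Real.exp (-(m * δ ^ 2 / 2)) * Q.card ≤ δ * V1.card) :
    ∃ Xs ⊆ T, 1 / 2 * ((V2.card : ℝ) / R.card) ^ m * T.card ≤ Xs.card ∧
      ∀ s, ∀ τ ∈ Xs, ∀ τ' ∈ Xs, (∀ v ∈ V1, v + s ∈ Q) → (∀ v ∈ V1, v + (s + τ' - τ) ∈ Q) →
        |Psi V1 V2 S (s + τ' - τ) - Psi V1 V2 S s| ≤ 4 * δ := by
  classical
  have hv0 : (0:ℝ) < V1.card := by exact_mod_cast hV1.card_pos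
  have hr0 : (0:ℝ) < R.card := by exact_mod_cast hR.card_pos
  obtain ⟨Lg, hLsub, hLcard, hLg⟩ := km_cs_good V2 S Q hV2 m hm δ V1.card hδ hv0 hQ
  have hm0 : (0:ℝ) < m := by exact_mod_cast hm
  -- pigeonhole
  set RR := Fintype.piFinset (fun _ : Fin m => R) with hRRdef
  have hRRc : (RR.card : ℝ) = (R.card : ℝ) ^ m := by rw [hRRdef, Fintype.card_piFinset]; simp
  have hpig : ∃ a ∈ RR, 1 / 2 * ((V2.card : ℝ) / R.card) ^ m * T.card ≤
      ((T.filter (fun τ => (fun i => a i - τ) ∈ Lg)).card : ℝ) := by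
    apply Finset.exists_le_of_sum_le
    · obtain ⟨r, hr⟩ := hR
      exact ⟨fun _ => r, Fintype.mem_piFinset.2 fun _ => hr⟩
    · have e : ∑ a ∈ RR, ((T.filter (fun τ => (fun i => a i - τ) ∈ Lg)).card : ℝ) = T.card * Lg.card := by
        simp only [Finset.card_filter]; push_cast
        rw [Finset.sum_comm, ← nsmul_eq_mul, ← Finset.sum_const]
        refine Finset.sum_congr rfl fun τ hτ => ?_
        rw [← Finset.natCast_card_filter]
        congr 1
        refine Finset.card_bij' (fun a _ => fun i => a i - τ) (fun a _ => fun i => a i + τ) ?_ ?_ ?_ ?_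
        · intro a ha; exact (Finset.mem_filter.1 ha).2
        · intro a ha
          refine Finset.mem_filter.2 ⟨Fintype.mem_piFinset.2 fun i => hRR _ (Fintype.mem_piFinset.1 (hLsub ha) i) τ hτ, ?_⟩
          simpa using ha
        · intro a _; simp
        · intro a _; simp
      rw [e]
      simp only [Finset.sum_const, nsmul_eq_mul, hRRc, div_pow]
      have : (R.card : ℝ)^m * (1 / 2 * ((V2.card : ℝ) ^ m / (R.card : ℝ)^m) * T.card) = T.card * (1 / 2 * (V2.card : ℝ) ^ m) := by
        field_simp
      rw [this]
      exact mul_le_mul_of_nonneg_left hLcard (by positivity)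
  obtain ⟨a, -, ha⟩ := hpig
  refine ⟨_, Finset.filter_subset _ _, ha, ?_⟩
  have key : ∀ s, ∀ τ ∈ T.filter (fun τ => (fun i => a i - τ) ∈ Lg), (∀ v ∈ V1, v + s ∈ Q) →
      |(∑ v ∈ V1, (∑ i, ind S (v + (s + τ) - a i)) / m) / V1.card - Psi V1 V2 S s| ≤ 2 * δ := by
    intro s τ hτ hs
    have h1 := hLg _ (Finset.mem_filter.1 hτ).2
    have h2 := cs_close V1 Q hV1 δ hδ (fun z => (∑ i, ind S (z - (a i - τ))) / m)
      (fun z => (∑ v ∈ V2, ind S (z - v)) / V2.card) s hs ?_ (fun z => avg_ind_mem V2 S z) h1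
    · unfold Psi
      refine le_trans (le_of_eq ?_) h2
      congr 3
      refine Finset.sum_congr rfl fun v _ => ?_
      congr 1
      refine Finset.sum_congr rfl fun i _ => ?_
      congr 1; abel
    · intro z
      constructor
      · exact div_nonneg (Finset.sum_nonneg fun _ _ => ind_nonneg _ _) hm0.le
      · apply div_le_one_of_le₀ _ hm0.le
        calc _ ≤ ∑ i : Fin m, (1:ℝ) := Finset.sum_le_sum fun _ _ => ind_le_one _ _
          _ = _ := by simp
  intro s τ hτ τ' hτ' hs hs'
  have k1 := key s τ' hτ' hs
  have k2 := key (s + τ' - τ) τ hτ hs'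
  rw [sub_add_cancel] at k2
  rw [abs_le] at k1 k2 ⊢
  constructor <;> linarith [k1.1, k1.2, k2.1, k2.2]
end KM
section KM
variable {G : Type*} [AddCommGroup G] [Fintype G] [DecidableEq G]

/-- exponential sum over a set -/
noncomputable def es (X : Finset G) (γ : AddChar G ℂ) : ℂ := ∑ x ∈ X, γ x

lemma es_conj (X : Finset G) (γ : AddChar G ℂ) : (starRingEnd ℂ) (es X γ) = ∑ x ∈ X, γ (-x) := by
  unfold es
  rw [map_sum]
  exact Finset.sum_congr rfl fun x _ => (AddChar.map_neg_eq_conj γ x).symm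

lemma es_norm_le (X : Finset G) (γ : AddChar G ℂ) : ‖es X γ‖ ≤ X.card := by
  unfold es
  refine (norm_sum_le _ _).trans (le_of_eq ?_)
  simp [AddChar.norm_apply]

lemma es_parseval (X : Finset G) : ∑ γ : AddChar G ℂ, ‖es X γ‖ ^ 2 = Fintype.card G * X.card := by
  have h : ((∑ γ : AddChar G ℂ, ‖es X γ‖ ^ 2 : ℝ) : ℂ) = ((Fintype.card G * X.card : ℝ) : ℂ) := by
    push_cast
    have e : ∀ γ : AddChar G ℂ, ((‖es X γ‖ : ℂ)) ^ 2 = ∑ x ∈ X, ∑ y ∈ X, γ (x - y) := by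
      intro γ
      rw [← Complex.mul_conj', es_conj, es, Finset.sum_mul_sum]
      simp_rw [sub_eq_add_neg, AddChar.map_add_eq_mul]
    simp_rw [e]
    rw [Finset.sum_comm]
    have e2 : ∀ x ∈ X, ∑ γ : AddChar G ℂ, ∑ y ∈ X, γ (x - y) = (Fintype.card G : ℂ) := by
      intro x hx
      rw [Finset.sum_comm]
      simp_rw [AddChar.sum_apply_eq_ite, sub_eq_zero]
      rw [Finset.sum_ite_eq]; simp [hx]
    rw [Finset.sum_congr rfl e2]; simp [mul_comm]
  exact_mod_cast h

lemma ind_fourier (S : Finset G) (y : G) :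
    ((ind S y : ℝ) : ℂ) = ∑ γ : AddChar G ℂ, (starRingEnd ℂ) (es S γ) / Fintype.card G * γ y := by
  have hN : (Fintype.card G : ℂ) ≠ 0 := by simp [Fintype.card_ne_zero]
  simp_rw [es_conj, div_mul_eq_mul_div, Finset.sum_mul, ← AddChar.map_add_eq_mul]
  rw [← Finset.sum_div, Finset.sum_comm]
  simp_rw [AddChar.sum_apply_eq_ite]
  have : ∀ x, (-x + y = 0) ↔ (y = x) := fun x => by rw [neg_add_eq_zero]; exact eq_comm
  simp_rw [this]
  rw [Finset.sum_ite_eq]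
  unfold ind
  split_ifs
  · field_simp; norm_num
  · simp

lemma psi_fourier (V1 V2 S : Finset G) (hV1 : V1.Nonempty) (hV2 : V2.Nonempty) :
    ∃ c : AddChar G ℂ → ℂ, (∀ s, ((Psi V1 V2 S s : ℝ) : ℂ) = ∑ γ, c γ * γ s) ∧
      ∑ γ, ‖c γ‖ ≤ Real.sqrt (S.card / V1.card) := by
  have hN : (0:ℝ) < Fintype.card G := by exact_mod_cast Fintype.card_pos
  have hv1 : (0:ℝ) < V1.card := by exact_mod_cast hV1.card_pos
  have hv2 : (0:ℝ) < V2.card := by exact_mod_cast hV2.card_pos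
  refine ⟨fun γ => (starRingEnd ℂ) (es S γ) / Fintype.card G * (es V1 γ / V1.card)
    * ((starRingEnd ℂ) (es V2 γ) / V2.card), ?_, ?_⟩
  · intro s
    unfold Psi
    push_cast
    simp_rw [ind_fourier]
    have e : ∀ v, ∑ v' ∈ V2, ∑ γ : AddChar G ℂ, (starRingEnd ℂ) (es S γ) / Fintype.card G * γ (v + s - v')
        = ∑ γ : AddChar G ℂ, (starRingEnd ℂ) (es S γ) / Fintype.card G * γ s * (starRingEnd ℂ) (es V2 γ) * γ v := by
      intro v
      rw [Finset.sum_comm]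
      refine Finset.sum_congr rfl fun γ _ => ?_
      rw [es_conj V2, Finset.mul_sum, Finset.sum_mul]
      refine Finset.sum_congr rfl fun v' _ => ?_
      rw [sub_eq_add_neg, AddChar.map_add_eq_mul, AddChar.map_add_eq_mul]; ring
    simp_rw [e]
    rw [← Finset.sum_div, Finset.sum_comm, Finset.sum_div, Finset.sum_div]
    refine Finset.sum_congr rfl fun γ _ => ?_
    rw [← Finset.mul_sum, ← es]
    ring
  · have h1 : ∀ γ : AddChar G ℂ, ‖(starRingEnd ℂ) (es S γ) / Fintype.card G * (es V1 γ / V1.card)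
        * ((starRingEnd ℂ) (es V2 γ) / V2.card)‖ ≤ (‖es S γ‖ * ‖es V1 γ‖) / (Fintype.card G * V1.card) := by
      intro γ
      have h2 : ‖(starRingEnd ℂ) (es V2 γ) / (V2.card : ℂ)‖ ≤ 1 := by
        rw [norm_div, RCLike.norm_conj, Complex.norm_natCast]
        exact div_le_one_of_le₀ (es_norm_le _ _) hv2.le
      rw [norm_mul]
      refine (mul_le_of_le_one_right (norm_nonneg _) h2).trans (le_of_eq ?_)
      rw [norm_mul, norm_div, norm_div, RCLike.norm_conj, Complex.norm_natCast, Complex.norm_natCast]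
      field_simp
    refine (Finset.sum_le_sum fun γ _ => h1 γ).trans ?_
    rw [← Finset.sum_div]
    apply Real.le_sqrt_of_sq_le
    rw [div_pow, div_le_iff₀ (by positivity)]
    refine (Finset.sum_mul_sq_le_sq_mul_sq _ _ _).trans (le_of_eq ?_)
    rw [es_parseval, es_parseval]
    field_simp

/-- averaging over differences -/
noncomputable def Av (X : Finset G) (f : G → ℝ) (s : G) : ℝ :=
  (∑ τ ∈ X, ∑ τ' ∈ X, f (s + τ' - τ)) / (X.card : ℝ) ^ 2

lemma av_def (X : Finset G) (f : G → ℝ) (s : G) :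
  Av X f s = (∑ τ ∈ X, ∑ τ' ∈ X, f (s + τ' - τ)) / (X.card : ℝ) ^ 2 := rfl

lemma av_fourier (X : Finset G) (f : G → ℝ) (c : AddChar G ℂ → ℂ)
    (h : ∀ s, ((f s : ℝ) : ℂ) = ∑ γ, c γ * γ s) (s : G) :
    ((Av X f s : ℝ) : ℂ) = ∑ γ, (c γ * ((‖es X γ‖ / X.card) ^ 2 : ℝ)) * γ s := by
  unfold Av
  push_cast
  simp_rw [h]
  have e : ∑ τ ∈ X, ∑ τ' ∈ X, ∑ γ, c γ * γ (s + τ' - τ)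
      = ∑ γ, c γ * (es X γ * (starRingEnd ℂ) (es X γ)) * γ s := by
    have e1 : ∀ τ ∈ X, ∑ τ' ∈ X, ∑ γ, c γ * γ (s + τ' - τ) = ∑ γ, c γ * γ s * es X γ * γ (-τ) := by
      intro τ _
      rw [Finset.sum_comm]
      refine Finset.sum_congr rfl fun γ _ => ?_
      rw [es, Finset.mul_sum, Finset.sum_mul]
      refine Finset.sum_congr rfl fun τ' _ => ?_
      rw [sub_eq_add_neg, AddChar.map_add_eq_mul, AddChar.map_add_eq_mul]; ring
    rw [Finset.sum_congr rfl e1, Finset.sum_comm]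
    refine Finset.sum_congr rfl fun γ _ => ?_
    rw [← Finset.mul_sum, ← es_conj]; ring
  rw [e, Finset.sum_div]
  refine Finset.sum_congr rfl fun γ _ => ?_
  rw [Complex.mul_conj', div_pow]
  ring

lemma av_iter_fourier (X : Finset G) (f : G → ℝ) (c : AddChar G ℂ → ℂ)
    (h : ∀ s, ((f s : ℝ) : ℂ) = ∑ γ, c γ * γ s) (l : ℕ) (s : G) :
    (((Av X)^[l] f s : ℝ) : ℂ) = ∑ γ, (c γ * ((‖es X γ‖ / X.card) ^ (2 * l) : ℝ)) * γ s := by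
  induction l generalizing s with
  | zero => simp [h]
  | succ l ih =>
    rw [Function.iterate_succ_apply', av_fourier X _ _ ih]
    refine Finset.sum_congr rfl fun γ _ => ?_
    rw [mul_assoc (c γ), ← Complex.ofReal_mul, ← pow_add]
    rfl

lemma av_spectral (V1 V2 S Xs : Finset G) (hV1 : V1.Nonempty) (hV2 : V2.Nonempty) (l : ℕ)
    (ν : ℝ) (b : G) (hν : 2 * (1/4 : ℝ) ^ l ≤ ν)
    (hb : ∀ γ : AddChar G ℂ, (1/2 : ℝ) * Xs.card ≤ ‖es Xs γ‖ → ‖γ b - 1‖ ≤ ν) :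
    |(Av Xs)^[l] (Psi V1 V2 S) b - (Av Xs)^[l] (Psi V1 V2 S) 0| ≤ ν * Real.sqrt (S.card / V1.card) := by
  obtain ⟨c, hc, hcs⟩ := psi_fourier V1 V2 S hV1 hV2
  have h1 := av_iter_fourier Xs _ c hc l b
  have h2 := av_iter_fourier Xs _ c hc l 0
  have hν0 : 0 ≤ ν := le_trans (by positivity) hν
  have h3 : |(Av Xs)^[l] (Psi V1 V2 S) b - (Av Xs)^[l] (Psi V1 V2 S) 0|
      = ‖((((Av Xs)^[l] (Psi V1 V2 S) b - (Av Xs)^[l] (Psi V1 V2 S) 0 : ℝ)) : ℂ)‖ := by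
    rw [Complex.norm_real]; rfl
  rw [h3]
  push_cast
  rw [h1, h2, ← Finset.sum_sub_distrib]
  refine (norm_sum_le _ _).trans ?_
  refine le_trans ?_ (mul_le_mul_of_nonneg_left hcs hν0)
  rw [Finset.mul_sum]
  refine Finset.sum_le_sum fun γ _ => ?_
  rw [AddChar.map_zero_eq_one, ← mul_sub, norm_mul, norm_mul, Complex.norm_real]
  have hk : ‖(‖es Xs γ‖ / Xs.card) ^ (2 * l)‖ * ‖γ b - 1‖ ≤ ν := by
    rw [Real.norm_eq_abs, abs_of_nonneg (by positivity)]
    by_cases hg : (1/2 : ℝ) * Xs.card ≤ ‖es Xs γ‖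
    · refine le_trans ?_ (hb γ hg)
      apply mul_le_of_le_one_left (norm_nonneg _)
      apply pow_le_one₀ (by positivity)
      exact div_le_one_of_le₀ (es_norm_le _ _) (by positivity)
    · push Not at hg
      have h4 : ‖γ b - 1‖ ≤ 2 := by
        refine (norm_sub_le _ _).trans ?_
        rw [AddChar.norm_apply]; norm_num
      have h5 : ‖es Xs γ‖ / Xs.card ≤ 1/2 := by
        rcases Nat.eq_zero_or_pos Xs.card with h0 | h0
        · rw [h0]; norm_num
        · rw [div_le_iff₀ (by exact_mod_cast h0)]; exact hg.le
      have h6 : (‖es Xs γ‖ / Xs.card) ^ (2 * l) ≤ (1/4 : ℝ)^l := by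
        calc _ ≤ (1/2 : ℝ) ^ (2 * l) := pow_le_pow_left₀ (by positivity) h5 _
          _ = _ := by rw [pow_mul]; norm_num
      calc _ ≤ (1/4 : ℝ)^l * 2 := mul_le_mul h6 h4 (norm_nonneg _) (by positivity)
        _ ≤ ν := by linarith
  calc ‖c γ‖ * ‖(‖es Xs γ‖ / Xs.card) ^ (2 * l)‖ * ‖γ b - 1‖
      = ‖c γ‖ * (‖(‖es Xs γ‖ / Xs.card) ^ (2 * l)‖ * ‖γ b - 1‖) := by ring
    _ ≤ ‖c γ‖ * ν := mul_le_mul_of_nonneg_left hk (norm_nonneg _)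
    _ = _ := mul_comm _ _

lemma av_close (f : G → ℝ) (Xs : Finset G) (hX : Xs.Nonempty) (l : ℕ) (δ : ℝ) (hδ : 0 ≤ δ) (H : ℕ → Set G)
    (hH : ∀ j < l, ∀ s ∈ H j, ∀ τ ∈ Xs, ∀ τ' ∈ Xs, s + τ' - τ ∈ H (j+1))
    (hf : ∀ j < l, ∀ s ∈ H j, ∀ τ ∈ Xs, ∀ τ' ∈ Xs, |f (s + τ' - τ) - f s| ≤ δ) :
    ∀ j ≤ l, ∀ s ∈ H (l - j), |(Av Xs)^[j] f s - f s| ≤ j * δ := by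
  have hx : (0:ℝ) < Xs.card := by exact_mod_cast hX.card_pos
  intro j
  induction j with
  | zero => intro _ s _; simp
  | succ j ih =>
    intro hj s hs
    rw [Function.iterate_succ_apply']
    have e : f s = (∑ τ ∈ Xs, ∑ τ' ∈ Xs, f s) / (Xs.card : ℝ) ^ 2 := by
      simp; field_simp
    rw [av_def, e]
    rw [← sub_div, abs_div, abs_of_pos (by positivity : (0:ℝ) < (Xs.card : ℝ) ^ 2), div_le_iff₀ (by positivity),
      ← Finset.sum_sub_distrib]
    have hp : ∀ τ ∈ Xs, ∀ τ' ∈ Xs, |(Av Xs)^[j] f (s + τ' - τ) - f s| ≤ (j + 1) * δ := by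
      intro τ hτ τ' hτ'
      have k1 := ih (by omega) (s + τ' - τ) (by
        have := hH (l - (j+1)) (by omega) s hs τ hτ τ' hτ'
        rwa [show l - (j+1) + 1 = l - j by omega] at this)
      have k2 := hf (l - (j+1)) (by omega) s hs τ hτ τ' hτ'
      rw [abs_le] at k1 k2 ⊢
      constructor <;> linarith [k1.1, k1.2, k2.1, k2.2]
    refine (Finset.abs_sum_le_sum_abs _ _).trans ?_
    have : ∀ τ ∈ Xs, |∑ τ' ∈ Xs, (Av Xs)^[j] f (s + τ' - τ) - ∑ τ' ∈ Xs, f s| ≤ Xs.card * ((j+1) * δ) := by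
      intro τ hτ
      rw [← Finset.sum_sub_distrib]
      refine (Finset.abs_sum_le_sum_abs _ _).trans ?_
      rw [← nsmul_eq_mul]
      exact Finset.sum_le_card_nsmul _ _ _ fun τ' hτ' => hp τ hτ τ' hτ'
    refine (Finset.sum_le_card_nsmul _ _ _ this).trans (le_of_eq ?_)
    rw [nsmul_eq_mul]; push_cast; ring

lemma av_le (f : G → ℝ) (Xs B : Finset G) (hX : Xs.Nonempty) (l : ℕ) (c : ℝ)
    (h : ∀ s, ∑ b ∈ B, f (s + b) ≤ c) (s : G) : ∑ b ∈ B, (Av Xs)^[l] f (s + b) ≤ c := by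
  have hx : (0:ℝ) < Xs.card := by exact_mod_cast hX.card_pos
  induction l generalizing s with
  | zero => simpa using h s
  | succ l ih =>
    simp_rw [Function.iterate_succ_apply']
    simp_rw [av_def]
    rw [← Finset.sum_div, div_le_iff₀ (by positivity), Finset.sum_comm]
    have : ∀ τ ∈ Xs, ∑ b ∈ B, ∑ τ' ∈ Xs, (Av Xs)^[l] f (s + b + τ' - τ) ≤ Xs.card * c := by
      intro τ _
      rw [Finset.sum_comm, ← nsmul_eq_mul]
      apply Finset.sum_le_card_nsmul
      intro τ' _
      have e : ∀ b, s + b + τ' - τ = s + τ' - τ + b := fun b => by abel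
      simp_rw [e]
      exact ih (s + τ' - τ)
    refine (Finset.sum_le_card_nsmul _ _ _ this).trans (le_of_eq ?_)
    rw [nsmul_eq_mul]; ring
end KM
section KM
variable {G : Type*} [AddCommGroup G] [Fintype G] [DecidableEq G]

/-- signs -/
def sg3 : Fin 3 → ℤ := ![0, 1, -1]
/-- product character -/
noncomputable def chi {n : ℕ} (lam : Fin n → AddChar G ℂ) (e : Fin n → Fin 3) : AddChar G ℂ :=
  ∏ i, lam i ^ (sg3 (e i))
/-- dissociated tuple -/
def Dissoc (Xs T' : Finset G) (κ : ℝ) {n : ℕ} (lam : Fin n → AddChar G ℂ) : Prop :=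
  (∀ i, (1/2 : ℝ) * Xs.card ≤ ‖es Xs (lam i)‖) ∧
    ∀ e : Fin n → Fin 3, e ≠ 0 → ‖es T' (chi lam e)‖ ≤ κ * T'.card

lemma char_inv_conj (γ : AddChar G ℂ) (x : G) : (γ⁻¹) x = (starRingEnd ℂ) (γ x) := by
  rw [AddChar.inv_apply, AddChar.map_neg_eq_conj]

lemma chi_apply {n : ℕ} (lam : Fin n → AddChar G ℂ) (e : Fin n → Fin 3) (x : G) :
    chi lam e x = ∏ i, (lam i ^ (sg3 (e i))) x := by
  unfold chi; rw [AddChar.prod_apply]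

/-- coefficient -/
noncomputable def cf (c : ℂ) : Fin 3 → ℂ :=
  ![(Real.cosh (1/2) : ℂ), (Real.sinh (1/2) : ℂ) / 2 * c, (Real.sinh (1/2) : ℂ) / 2 * (starRingEnd ℂ) c]

lemma cf_sum (c : ℂ) (γ : AddChar G ℂ) (x : G) :
    ((Real.cosh (1/2) + (c * γ x).re * Real.sinh (1/2) : ℝ) : ℂ) = ∑ j, cf c j * (γ ^ (sg3 j)) x := by
  rw [Fin.sum_univ_three]
  simp only [cf, sg3, Matrix.cons_val_zero, Matrix.cons_val_one, Matrix.cons_val_two,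
    Matrix.head_cons, Matrix.tail_cons, Matrix.cons_val, zpow_zero, zpow_one, zpow_neg]
  rw [char_inv_conj, AddChar.one_apply]
  have h : (((c * γ x).re : ℝ) : ℂ) = (c * γ x + (starRingEnd ℂ) (c * γ x)) / 2 := by
    rw [Complex.re_eq_add_conj]
  push_cast at h ⊢
  rw [h, map_mul]
  ring

lemma cf_norm (c : ℂ) (hc : ‖c‖ = 1) : ∑ j, ‖cf c j‖ = Real.exp (1/2) := by
  rw [Fin.sum_univ_three]
  have hs : 0 ≤ Real.sinh (1/2) := Real.sinh_nonneg_iff.2 (by norm_num)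
  simp only [cf, Matrix.cons_val_zero, Matrix.cons_val_one, Matrix.cons_val_two,
    Matrix.head_cons, Matrix.tail_cons, Matrix.cons_val]
  rw [norm_mul, norm_mul, norm_div, Complex.norm_real, Complex.norm_real, RCLike.norm_conj, hc,
    Real.norm_eq_abs, Real.norm_eq_abs, abs_of_nonneg hs, abs_of_pos (Real.cosh_pos _)]
  rw [← Real.cosh_add_sinh (1/2)]
  simp only [mul_one, Complex.norm_ofNat]
  ring

lemma chang_pt {n : ℕ} (lam : Fin n → AddChar G ℂ) (Xs T' : Finset G) (κ : ℝ) (hκ : 0 ≤ κ) (hT : T'.Nonempty)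
    (hd : Dissoc Xs T' κ lam) (c : Fin n → ℂ) (hc : ∀ i, ‖c i‖ = 1) (z : G) :
    ∑ w ∈ T', ∏ i, (Real.cosh (1/2) + (c i * lam i (z + w)).re * Real.sinh (1/2))
      ≤ T'.card * (Real.cosh (1/2) ^ n + κ * Real.exp (n / 2)) := by
  set S := ∑ w ∈ T', ∏ i, (Real.cosh (1/2) + (c i * lam i (z + w)).re * Real.sinh (1/2)) with hS
  have h1 : ((S : ℝ) : ℂ) = ∑ e : Fin n → Fin 3, (∏ i, cf (c i) (e i)) * chi lam e z * es T' (chi lam e) := by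
    rw [hS]
    rw [Complex.ofReal_sum]
    simp_rw [Complex.ofReal_prod, cf_sum]
    simp_rw [Finset.prod_univ_sum, Fintype.piFinset_univ, Finset.prod_mul_distrib, ← chi_apply]
    rw [Finset.sum_comm]
    refine Finset.sum_congr rfl fun e _ => ?_
    rw [es, Finset.mul_sum]
    refine Finset.sum_congr rfl fun w _ => ?_
    rw [AddChar.map_add_eq_mul]; ring
  have h2 : ‖((S : ℝ) : ℂ)‖ ≤ T'.card * (Real.cosh (1/2) ^ n + κ * Real.exp (n / 2)) := by
    rw [h1]
    refine (norm_sum_le _ _).trans ?_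
    have h3 : ∀ e : Fin n → Fin 3, ‖(∏ i, cf (c i) (e i)) * chi lam e z * es T' (chi lam e)‖
        ≤ (∏ i, ‖cf (c i) (e i)‖) * (κ * T'.card) + (if e = 0 then Real.cosh (1/2) ^ n * T'.card else 0) := by
      intro e
      rw [norm_mul, norm_mul, AddChar.norm_apply, mul_one, norm_prod]
      split_ifs with he
      · have h4 : ∏ i, ‖cf (c i) (e i)‖ = Real.cosh (1/2) ^ n := by
          subst he
          simp only [cf, Pi.zero_apply, Matrix.cons_val_zero]
          rw [Complex.norm_real, Real.norm_eq_abs, abs_of_pos (Real.cosh_pos _)]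
          simp
        rw [h4]
        have h5 := mul_le_mul_of_nonneg_left (es_norm_le T' (chi lam e)) (pow_pos (Real.cosh_pos (1/2)) n).le
        have h6 : 0 ≤ Real.cosh (1/2) ^ n * (κ * T'.card) := mul_nonneg (pow_pos (Real.cosh_pos (1/2)) n).le (by positivity)
        linarith
      · rw [add_zero]
        exact mul_le_mul_of_nonneg_left (hd.2 e he) (Finset.prod_nonneg fun _ _ => norm_nonneg _)
    refine (Finset.sum_le_sum fun e _ => h3 e).trans ?_
    rw [Finset.sum_add_distrib, ← Finset.sum_mul, Finset.sum_ite_eq']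
    have h4 : ∑ e : Fin n → Fin 3, ∏ i, ‖cf (c i) (e i)‖ = Real.exp (n / 2) := by
      have := Finset.prod_univ_sum (fun _ : Fin n => (Finset.univ : Finset (Fin 3))) (fun i j => ‖cf (c i) j‖)
      rw [Fintype.piFinset_univ] at this
      rw [← this, Finset.prod_congr rfl fun i _ => cf_norm (c i) (hc i)]
      simp only [Finset.prod_const, Finset.card_univ, Fintype.card_fin]
      rw [← Real.exp_nat_mul]; congr 1; ring
    rw [h4]
    simp only [Finset.mem_univ, if_true]
    apply le_of_eq; ring
  rw [Complex.norm_real] at h2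
  exact (le_abs_self S).trans h2

lemma chang_size {n : ℕ} (lam : Fin n → AddChar G ℂ) (Xs T T' Tp : Finset G) (κ : ℝ) (hκ : 0 ≤ κ)
    (hT : T'.Nonempty) (hXT : Xs ⊆ T) (hX : Xs.Nonempty) (hTp : ∀ x ∈ T, ∀ y ∈ T', x - y ∈ Tp)
    (hd : Dissoc Xs T' κ lam) :
    Xs.card * Real.exp (n / 4) ≤ Tp.card * (Real.exp (n / 8) + κ * Real.exp (n / 2)) := by
  have hx0 : (0:ℝ) < Xs.card := by exact_mod_cast hX.card_pos
  have ht0 : (0:ℝ) < T'.card := by exact_mod_cast hT.card_pos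
  set c : Fin n → ℂ := fun i => (starRingEnd ℂ) (es Xs (lam i)) / ‖es Xs (lam i)‖ with hcdef
  have hne : ∀ i, (0:ℝ) < ‖es Xs (lam i)‖ := fun i => lt_of_lt_of_le (by positivity) (hd.1 i)
  have hc : ∀ i, ‖c i‖ = 1 := by
    intro i
    rw [hcdef]; simp only
    rw [norm_div, RCLike.norm_conj, Complex.norm_real, norm_norm, div_self (hne i).ne']
  have hsum : ∀ i, ∑ x ∈ Xs, (c i * lam i x).re = ‖es Xs (lam i)‖ := by
    intro i
    rw [← Complex.re_sum, ← Finset.mul_sum, ← es]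
    have : c i * es Xs (lam i) = ((‖es Xs (lam i)‖ : ℝ) : ℂ) := by
      rw [hcdef]; simp only
      have h0 : ((‖es Xs (lam i)‖ : ℝ) : ℂ) ≠ 0 := by exact_mod_cast (hne i).ne'
      rw [div_mul_eq_mul_div, mul_comm, Complex.mul_conj']
      field_simp
    rw [this, Complex.ofReal_re]
  have hy : ∀ i x, |(c i * lam i x).re| ≤ 1 := by
    intro i x
    refine (Complex.abs_re_le_norm _).trans ?_
    rw [norm_mul, hc, AddChar.norm_apply, one_mul]
  have hs : 0 ≤ Real.sinh (1/2) := Real.sinh_nonneg_iff.2 (by norm_num)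
  set f : G → ℝ := fun x => ∏ i, (Real.cosh (1/2) + (c i * lam i x).re * Real.sinh (1/2)) with hf
  have hfge : ∀ x, Real.exp (1/2 * ∑ i, (c i * lam i x).re) ≤ f x := by
    intro x
    rw [Finset.mul_sum, Real.exp_sum]
    exact Finset.prod_le_prod (fun _ _ => (Real.exp_pos _).le) fun i _ => exp_le_cosh_add _ _ (hy i x)
  have hf0 : ∀ x, 0 ≤ f x := fun x => (Real.exp_pos _).le.trans (hfge x)
  have hlow : Xs.card * Real.exp (n / 4) ≤ ∑ x ∈ Xs, f x := by
    have h1 : ∀ x ∈ Xs, Real.exp (n/4) * (1 + (1/2 * ∑ i, (c i * lam i x).re - n/4)) ≤ f x := by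
      intro x _
      refine le_trans ?_ (hfge x)
      have h2 := Real.add_one_le_exp (1/2 * ∑ i, (c i * lam i x).re - n/4)
      have h3 : Real.exp (1/2 * ∑ i, (c i * lam i x).re) = Real.exp (n/4) * Real.exp (1/2 * ∑ i, (c i * lam i x).re - n/4) := by
        rw [← Real.exp_add]; congr 1; ring
      rw [h3]
      exact mul_le_mul_of_nonneg_left (by linarith) (Real.exp_pos _).le
    refine le_trans ?_ (Finset.sum_le_sum h1)
    rw [← Finset.mul_sum, mul_comm]
    apply mul_le_mul_of_nonneg_left _ (Real.exp_pos _).le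
    rw [Finset.sum_add_distrib, Finset.sum_sub_distrib, ← Finset.mul_sum, Finset.sum_comm]
    simp_rw [hsum]
    have h4 : ∑ i : Fin n, (1/2 : ℝ) * Xs.card ≤ ∑ i, ‖es Xs (lam i)‖ := Finset.sum_le_sum fun i _ => hd.1 i
    simp only [Finset.sum_const, nsmul_eq_mul, Finset.card_univ, Fintype.card_fin] at h4 ⊢
    linarith
  have hup : T'.card * ∑ x ∈ Xs, f x ≤ ∑ w ∈ T', ∑ z ∈ Tp, f (z + w) := by
    rw [← nsmul_eq_mul]
    apply Finset.card_nsmul_le_sum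
    intro w hw
    have : ∑ x ∈ Xs, f x = ∑ z ∈ Xs.image (fun x => x - w), f (z + w) := by
      rw [Finset.sum_image (fun x _ y _ h => sub_left_injective h)]
      simp
    rw [this]
    apply Finset.sum_le_sum_of_subset_of_nonneg
    · intro z hz
      obtain ⟨x, hx, rfl⟩ := Finset.mem_image.1 hz
      exact hTp x (hXT hx) w hw
    · intro _ _ _; exact hf0 _
  have hup2 : ∑ w ∈ T', ∑ z ∈ Tp, f (z + w) ≤ Tp.card * (T'.card * (Real.cosh (1/2) ^ n + κ * Real.exp (n / 2))) := by
    rw [Finset.sum_comm, ← nsmul_eq_mul]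
    apply Finset.sum_le_card_nsmul
    intro z _
    exact chang_pt lam Xs T' κ hκ hT hd c hc z
  have hcosh : Real.cosh (1/2) ^ n ≤ Real.exp (n / 8) := by
    calc _ ≤ (Real.exp ((1/2)^2/2)) ^ n := pow_le_pow_left₀ (Real.cosh_pos _).le (Real.cosh_le_exp_half_sq _) _
      _ = _ := by rw [← Real.exp_nat_mul]; congr 1; ring
  have h5 : (T'.card : ℝ) * (Xs.card * Real.exp (n / 4)) ≤ T'.card * (Tp.card * (Real.exp (n / 8) + κ * Real.exp (n / 2))) := by
    refine (mul_le_mul_of_nonneg_left hlow ht0.le).trans ((hup.trans hup2).trans ?_)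
    have h6 := mul_le_mul_of_nonneg_left hcosh (by positivity : (0:ℝ) ≤ T'.card * Tp.card)
    linarith
  exact le_of_mul_le_mul_left h5 ht0
lemma norm_prod_sub_one {ι : Type*} (s : Finset ι) (z : ι → ℂ) (hz : ∀ i ∈ s, ‖z i‖ = 1) :
    ‖∏ i ∈ s, z i - 1‖ ≤ ∑ i ∈ s, ‖z i - 1‖ := by
  classical
  induction s using Finset.induction_on with
  | empty => simp
  | insert a s ha ih =>
    rw [Finset.prod_insert ha, Finset.sum_insert ha]
    have h1 := ih fun i hi => hz i (Finset.mem_insert_of_mem hi)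
    have e : z a * ∏ i ∈ s, z i - 1 = z a * (∏ i ∈ s, z i - 1) + (z a - 1) := by ring
    rw [e]
    refine (norm_add_le _ _).trans ?_
    rw [norm_mul, hz a (Finset.mem_insert_self _ _), one_mul]
    linarith

lemma norm_pow_sg3 (γ : AddChar G ℂ) (j : Fin 3) (b : G) : ‖(γ ^ (sg3 j)) b - 1‖ ≤ ‖γ b - 1‖ := by
  fin_cases j
  · simp [sg3]
  · simp [sg3]
  · simp only [sg3, Fin.reduceFinMk, Matrix.cons_val, zpow_neg, zpow_one]
    rw [char_inv_conj, ← RCLike.norm_conj (γ b - 1)]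
    simp

lemma norm_pow_sg3' (γ : AddChar G ℂ) (j : Fin 3) (hj : j ≠ 0) (b : G) :
    ‖γ b - 1‖ = ‖(γ ^ (sg3 j)) b - 1‖ := by
  fin_cases j
  · simp at hj
  · simp [sg3]
  · simp only [sg3, Fin.reduceFinMk, Matrix.cons_val, zpow_neg, zpow_one]
    rw [char_inv_conj, ← RCLike.norm_conj (γ b - 1)]
    simp

lemma es_shift (T : Finset G) (χ : AddChar G ℂ) (b : G) :
    ‖χ b - 1‖ * ‖es T χ‖ ≤ 2 * ((T.filter (fun x => x + b ∉ T)).card : ℝ) := by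
  classical
  rw [← norm_mul]
  set T2 := T.image (fun x => x + b) with hT2
  have hinj : Set.InjOn (fun x : G => x + b) T := fun x _ y _ h => add_right_cancel h
  have e1 : (χ b - 1) * es T χ = ∑ x ∈ T2, χ x - ∑ x ∈ T, χ x := by
    rw [hT2, Finset.sum_image hinj, sub_mul, one_mul, es, Finset.mul_sum]
    congr 1
    exact Finset.sum_congr rfl fun x _ => by rw [AddChar.map_add_eq_mul, mul_comm]
  have e2 : ∑ x ∈ T2, χ x - ∑ x ∈ T, χ x = ∑ x ∈ T2 \ T, χ x - ∑ x ∈ T \ T2, χ x := by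
    have h1 := Finset.sum_sdiff_sub_sum_sdiff (s₁ := T) (s₂ := T2) (f := fun x => χ x)
    exact h1.symm
  have c1 : (T2 \ T).card = (T.filter (fun x => x + b ∉ T)).card := by
    have : T2 \ T = (T.filter (fun x => x + b ∉ T)).image (fun x => x + b) := by
      ext y
      simp only [hT2, Finset.mem_sdiff, Finset.mem_image, Finset.mem_filter]
      constructor
      · rintro ⟨⟨x, hx, rfl⟩, hy⟩; exact ⟨x, ⟨hx, hy⟩, rfl⟩
      · rintro ⟨x, ⟨hx, hy⟩, rfl⟩; exact ⟨⟨x, hx, rfl⟩, hy⟩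
    rw [this, Finset.card_image_of_injective _ (add_left_injective b)]
  have c2 : (T \ T2).card = (T2 \ T).card := by
    apply Finset.card_sdiff_comm
    rw [hT2, Finset.card_image_of_injective _ (add_left_injective b)]
  rw [e1, e2]
  refine (norm_sub_le _ _).trans ?_
  have hb : ∀ U : Finset G, ‖∑ x ∈ U, χ x‖ ≤ U.card := fun U => es_norm_le U χ
  have := hb (T2 \ T)
  have := hb (T \ T2)
  rw [c2] at this
  rw [← c1]
  linarith

lemma chang_max (Xs T T' Tp : Finset G) (κ : ℝ) (hκ : 0 < κ) (n1 : ℕ) (hκ1 : κ * Real.exp (n1 / 2) ≤ 1)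
    (hT : T'.Nonempty) (hXT : Xs ⊆ T) (hX : Xs.Nonempty) (hTp : ∀ x ∈ T, ∀ y ∈ T', x - y ∈ Tp)
    (hn1 : 2 * (Tp.card : ℝ) < Xs.card * Real.exp (n1 / 8)) :
    ∃ n < n1, ∃ lam : Fin n → AddChar G ℂ, ∀ γ : AddChar G ℂ, (1/2 : ℝ) * Xs.card ≤ ‖es Xs γ‖ →
      ∀ b : G, ∀ ν η : ℝ, (∀ i, ‖lam i b - 1‖ ≤ ν) →
        ((T'.filter (fun x => x + b ∉ T')).card : ℝ) ≤ η * T'.card → ‖γ b - 1‖ ≤ n * ν + 2 * η / κ := by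
  classical
  have ht0 : (0:ℝ) < T'.card := by exact_mod_cast hT.card_pos
  have hex : ∃ n, ¬ ∃ lam : Fin n → AddChar G ℂ, Dissoc Xs T' κ lam := by
    refine ⟨n1, ?_⟩
    rintro ⟨lam, hd⟩
    have h1 := chang_size lam Xs T T' Tp κ hκ.le hT hXT hX hTp hd
    have h2 : (1:ℝ) ≤ Real.exp (n1/8) := Real.one_le_exp (by positivity)
    have h3 : (Real.exp (n1/8) + κ * Real.exp (n1 / 2)) ≤ 2 * Real.exp (n1/8) := by linarith
    have h4 := mul_le_mul_of_nonneg_left h3 (by positivity : (0:ℝ) ≤ Tp.card)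
    have h5 : Real.exp (n1/4 : ℝ) = Real.exp (n1/8) * Real.exp (n1/8) := by rw [← Real.exp_add]; congr 1; ring
    rw [h5] at h1
    have h6 := mul_lt_mul_of_pos_right hn1 (Real.exp_pos (n1/8 : ℝ))
    linarith
  have hspec := Nat.find_spec hex
  have hn0 : Nat.find hex ≠ 0 := by
    intro h0
    rw [h0] at hspec
    exact hspec ⟨Fin.elim0, fun i => i.elim0, fun e he => absurd (Subsingleton.elim _ _) he⟩
  obtain ⟨n, hn⟩ := Nat.exists_eq_succ_of_ne_zero hn0
  have hle : Nat.find hex ≤ n1 := by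
    apply Nat.find_min'
    rintro ⟨lam, hd⟩
    have h1 := chang_size lam Xs T T' Tp κ hκ.le hT hXT hX hTp hd
    have h2 : (1:ℝ) ≤ Real.exp (n1/8) := Real.one_le_exp (by positivity)
    have h3 : (Real.exp (n1/8) + κ * Real.exp (n1 / 2)) ≤ 2 * Real.exp (n1/8) := by linarith
    have h4 := mul_le_mul_of_nonneg_left h3 (by positivity : (0:ℝ) ≤ Tp.card)
    have h5 : Real.exp (n1/4 : ℝ) = Real.exp (n1/8) * Real.exp (n1/8) := by rw [← Real.exp_add]; congr 1; ring
    rw [h5] at h1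
    have h6 := mul_lt_mul_of_pos_right hn1 (Real.exp_pos (n1/8 : ℝ))
    linarith
  have hP : ∃ lam : Fin n → AddChar G ℂ, Dissoc Xs T' κ lam := by
    by_contra hc
    have := Nat.find_min' hex hc
    omega
  rw [hn] at hspec
  obtain ⟨lam, hd⟩ := hP
  refine ⟨n, by omega, lam, ?_⟩
  intro γ hγ b ν η hb hη
  have hnd : ¬ Dissoc Xs T' κ (Fin.cons γ lam : Fin (n+1) → AddChar G ℂ) := fun h => hspec ⟨_, h⟩
  unfold Dissoc at hnd
  rw [not_and] at hnd
  have hnd2 := hnd (by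
    intro i
    refine Fin.cases ?_ (fun i => ?_) i
    · simpa using hγ
    · simpa using hd.1 i)
  push Not at hnd2
  obtain ⟨e, he, hbig⟩ := hnd2
  have hchi : chi (Fin.cons γ lam : Fin (n+1) → AddChar G ℂ) e = γ ^ (sg3 (e 0)) * chi lam (fun i => e i.succ) := by
    unfold chi
    rw [Fin.prod_univ_succ]; simp
  have he0 : e 0 ≠ 0 := by
    intro h0
    have hne : (fun i : Fin n => e i.succ) ≠ 0 := by
      intro h1
      apply he
      funext i
      refine Fin.cases ?_ (fun i => ?_) i
      · exact h0
      · exact congrFun h1 i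
    have h2 := hd.2 _ hne
    rw [hchi, h0] at hbig
    simp only [sg3, Matrix.cons_val_zero, zpow_zero, one_mul] at hbig
    linarith
  set χ := chi (Fin.cons γ lam : Fin (n+1) → AddChar G ℂ) e with hχ
  have h1 := es_shift T' χ b
  have h2 : ‖χ b - 1‖ ≤ 2 * η / κ := by
    rw [le_div_iff₀ hκ]
    have h3 := mul_le_mul_of_nonneg_left hbig.le (norm_nonneg (χ b - 1))
    have h4 : (‖χ b - 1‖ * κ) * T'.card ≤ (2 * η) * T'.card := by linarith
    exact le_of_mul_le_mul_right h4 ht0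
  have h3 : ‖chi lam (fun i => e i.succ) b - 1‖ ≤ n * ν := by
    rw [chi_apply]
    refine (norm_prod_sub_one _ _ fun i _ => AddChar.norm_apply _ _).trans ?_
    refine (Finset.sum_le_card_nsmul _ _ ν fun i _ => (norm_pow_sg3 _ _ _).trans (hb i)).trans ?_
    simp
  rw [norm_pow_sg3' γ (e 0) he0 b]
  have h4 : χ b = (γ ^ (sg3 (e 0))) b * chi lam (fun i => e i.succ) b := by rw [hchi, AddChar.mul_apply]
  set u := (γ ^ (sg3 (e 0))) b
  set v := chi lam (fun i => e i.succ) b with hv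
  have hvn : ‖v‖ = 1 := AddChar.norm_apply _ _
  have h5 : (u - 1) * v = (χ b - 1) - (v - 1) := by rw [h4]; ring
  have h6 : ‖u - 1‖ = ‖(χ b - 1) - (v - 1)‖ := by rw [← h5, norm_mul, hvn, mul_one]
  rw [h6]
  refine (norm_sub_le _ _).trans ?_
  linarith
end KM
section KM
variable {G : Type*} [AddCommGroup G] [Fintype G] [DecidableEq G]

noncomputable def Bohr (Γ : Finset (AddChar G ℂ)) (r : ℝ) : Finset G :=
  univ.filter (fun x => ∀ γ ∈ Γ, ‖γ x - 1‖ ≤ r)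

lemma mem_bohr {Γ : Finset (AddChar G ℂ)} {r : ℝ} {x : G} :
    x ∈ Bohr Γ r ↔ ∀ γ ∈ Γ, ‖γ x - 1‖ ≤ r := by simp [Bohr]

lemma bohr_zero {Γ : Finset (AddChar G ℂ)} {r : ℝ} (hr : 0 ≤ r) : (0:G) ∈ Bohr Γ r := by
  simp [mem_bohr, hr]

lemma bohr_mono {Γ : Finset (AddChar G ℂ)} {r s : ℝ} (h : r ≤ s) : Bohr Γ r ⊆ Bohr Γ s := by
  intro x hx; rw [mem_bohr] at *; exact fun γ hγ => (hx γ hγ).trans h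

lemma bohr_sub {Γ : Finset (AddChar G ℂ)} {r s : ℝ} {x y : G} (hx : x ∈ Bohr Γ r)
    (hy : y ∈ Bohr Γ s) : x - y ∈ Bohr Γ (r + s) := by
  rw [mem_bohr] at *
  intro γ hγ
  have h1 : γ (x - y) * γ y = γ x := by rw [← AddChar.map_add_eq_mul, sub_add_cancel]
  have h2 : ‖γ y‖ = 1 := AddChar.norm_apply γ y
  have h3 : ‖γ (x-y) - 1‖ = ‖γ x - γ y‖ := by
    rw [← h1, ← sub_one_mul, norm_mul, h2, mul_one]
  rw [h3]
  calc ‖γ x - γ y‖ = ‖(γ x - 1) - (γ y - 1)‖ := by congr 1; ring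
    _ ≤ _ := (norm_sub_le _ _).trans (add_le_add (hx γ hγ) (hy γ hγ))

lemma bohr_neg {Γ : Finset (AddChar G ℂ)} {r : ℝ} {x : G} (hx : x ∈ Bohr Γ r) :
    -x ∈ Bohr Γ r := by
  simpa using bohr_sub (bohr_zero (Γ := Γ) le_rfl) hx

lemma bohr_add {Γ : Finset (AddChar G ℂ)} {r s : ℝ} {x y : G} (hx : x ∈ Bohr Γ r)
    (hy : y ∈ Bohr Γ s) : x + y ∈ Bohr Γ (r + s) := by
  simpa using bohr_sub hx (bohr_neg hy)

lemma bohr_shift {Γ : Finset (AddChar G ℂ)} {r κ η : ℝ} (h : (#(Bohr Γ (r+κ)) : ℝ) ≤ (1+η) * #(Bohr Γ r))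
    (hκ : 0 ≤ κ) {s : G} (hs : s ∈ Bohr Γ κ) :
    (#((Bohr Γ r).filter (fun x => x + s ∉ Bohr Γ r)) : ℝ) ≤ η * #(Bohr Γ r) := by
  have h1 : #((Bohr Γ r).filter (fun x => x + s ∉ Bohr Γ r)) ≤ #(Bohr Γ (r+κ) \ Bohr Γ r) := by
    apply card_le_card_of_injOn (fun x => x + s)
    · intro x hx
      simp only [coe_filter, Set.mem_setOf_eq, coe_sdiff, Set.mem_diff, mem_coe] at hx ⊢
      exact ⟨bohr_add hx.1 hs, hx.2⟩
    · intro x _ y _ hxy; simpa using hxy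
  have h2 := card_sdiff_add_card_eq_card (bohr_mono (Γ := Γ) (show r ≤ r + κ by linarith))
  have h3 : (#(Bohr Γ (r+κ) \ Bohr Γ r) : ℝ) + #(Bohr Γ r) = #(Bohr Γ (r+κ)) := by exact_mod_cast h2
  have h4 : (#((Bohr Γ r).filter (fun x => x + s ∉ Bohr Γ r)) : ℝ) ≤ #(Bohr Γ (r+κ) \ Bohr Γ r) := by
    exact_mod_cast h1
  linarith

lemma floor_box {t ρ : ℝ} (hρ : 0 < ρ) (h : |t| ≤ ρ) : ⌊4 * t / ρ⌋ ∈ Icc (-4:ℤ) 4 := by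
  rw [abs_le] at h
  rw [mem_Icc]
  constructor
  · rw [Int.le_floor]; push_cast; rw [le_div_iff₀ hρ]; linarith
  · have : ⌊4 * t / ρ⌋ < 5 := by
      rw [Int.floor_lt]; push_cast; rw [div_lt_iff₀ hρ]; linarith
    omega

lemma floor_close {t u ρ : ℝ} (hρ : 0 < ρ) (h : ⌊4 * t / ρ⌋ = ⌊4 * u / ρ⌋) : |t - u| ≤ ρ / 4 := by
  have h1 := Int.abs_sub_lt_one_of_floor_eq_floor h
  rw [← sub_div, abs_div, abs_of_pos hρ, div_lt_one hρ, ← mul_sub, abs_mul] at h1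
  norm_num at h1
  linarith

lemma bohr_double (Γ : Finset (AddChar G ℂ)) {ρ : ℝ} (hρ : 0 < ρ) :
    #(Bohr Γ ρ) ≤ 81 ^ #Γ * #(Bohr Γ (ρ/2)) := by
  classical
  let f : G → (Γ → ℤ × ℤ) := fun x γ => (⌊4 * (γ.1 x - 1).re / ρ⌋, ⌊4 * (γ.1 x - 1).im / ρ⌋)
  have h1 : #((Bohr Γ ρ).image f) ≤ 81 ^ #Γ := by
    have : (Bohr Γ ρ).image f ⊆ Fintype.piFinset (fun _ : Γ => Icc (-4:ℤ) 4 ×ˢ Icc (-4:ℤ) 4) := by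
      intro g hg
      obtain ⟨x, hx, rfl⟩ := mem_image.1 hg
      rw [Fintype.mem_piFinset]
      intro γ
      have := mem_bohr.1 hx γ.1 γ.2
      exact mem_product.2 ⟨floor_box hρ ((Complex.abs_re_le_norm _).trans this),
        floor_box hρ ((Complex.abs_im_le_norm _).trans this)⟩
    refine (card_le_card this).trans ?_
    rw [Fintype.card_piFinset]; simp
  have h2 := card_le_mul_card_image (f := f) (Bohr Γ ρ) (#(Bohr Γ (ρ/2))) (by
    intro g hg
    obtain ⟨y, hy, rfl⟩ := mem_image.1 hg
    apply card_le_card_of_injOn (fun x => x - y)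
    · intro x hx
      simp only [coe_filter, Set.mem_setOf_eq] at hx
      rw [mem_coe, mem_bohr]
      intro γ hγ
      have h1 : γ (x - y) * γ y = γ x := by rw [← AddChar.map_add_eq_mul, sub_add_cancel]
      have h2 : ‖γ y‖ = 1 := AddChar.norm_apply γ y
      have h3 : ‖γ (x-y) - 1‖ = ‖γ x - γ y‖ := by
        rw [← h1, ← sub_one_mul, norm_mul, h2, mul_one]
      rw [h3]
      have h4 := congrFun hx.2 ⟨γ, hγ⟩
      simp only [f, Prod.mk.injEq] at h4
      have a1 := floor_close hρ h4.1
      have a2 := floor_close hρ h4.2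
      have e1 : |(γ x - γ y).re| ≤ ρ/4 := by simpa using a1
      have e2 : |(γ x - γ y).im| ≤ ρ/4 := by simpa using a2
      have := Complex.norm_le_abs_re_add_abs_im (γ x - γ y)
      linarith
    · intro x _ z _ hxz; simpa using hxz)
  calc _ ≤ _ := h2
    _ ≤ _ := by rw [mul_comm]; gcongr

lemma bohr_size (Γ : Finset (AddChar G ℂ)) (j : ℕ) :
    Fintype.card G ≤ 81 ^ (#Γ * (j+1)) * #(Bohr Γ ((1/2:ℝ)^j)) := by
  induction j with
  | zero =>
    have h := bohr_double Γ (show (0:ℝ) < 2 by norm_num)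
    have h2 : Bohr Γ 2 = univ := by
      ext x; simp only [mem_univ, iff_true, mem_bohr]
      intro γ _
      refine (norm_sub_le _ _).trans ?_
      rw [AddChar.norm_apply]; norm_num
    rw [h2, card_univ] at h
    simpa using h
  | succ j ih =>
    have h := bohr_double Γ (show (0:ℝ) < (1/2)^j by positivity)
    calc _ ≤ _ := ih
      _ ≤ 81 ^ (#Γ * (j+1)) * (81 ^ #Γ * #(Bohr Γ ((1/2:ℝ)^j/2))) := by gcongr
      _ = _ := by rw [← mul_assoc, ← pow_add, pow_succ]; ring_nf

lemma bohr_regular (Γ : Finset (AddChar G ℂ)) {ρ : ℝ} (hρ : 0 < ρ) (n d : ℕ) (hn : 1 ≤ n)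
    (hd : #Γ ≤ d) {κ : ℝ} (hκ : κ = ρ / (28 * n * (d+1))) :
    ∃ r, ρ/2 ≤ r ∧ r ≤ ρ ∧ (#(Bohr Γ (r+2*κ)) : ℝ) ≤ (1+1/n) * #(Bohr Γ r) := by
  by_contra! hcon
  have hn0 : (0:ℝ) < n := by exact_mod_cast hn
  have hκ0 : 0 < κ := by rw [hκ]; positivity
  set J := 7 * n * (d+1) with hJ
  have hJκ : 2 * J * κ = ρ/2 := by rw [hκ, hJ]; push_cast; field_simp; norm_num
  have key : ∀ j ≤ J, (1+1/(n:ℝ))^j * #(Bohr Γ (ρ/2)) ≤ #(Bohr Γ (ρ/2 + 2*j*κ)) := by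
    intro j
    induction j with
    | zero => intro _; simp
    | succ j ih =>
      intro hj
      have h0 : (j:ℝ)+1 ≤ J := by exact_mod_cast hj
      have h1 := hcon (ρ/2 + 2*j*κ) (by have : (0:ℝ) ≤ 2*j*κ := by positivity
                                        linarith)
        (by nlinarith)
      have h2 := ih (by omega)
      have e : ρ/2 + 2*(j+1:ℕ)*κ = ρ/2 + 2*j*κ + 2*κ := by push_cast; ring
      rw [e, pow_succ]
      calc _ = (1+1/(n:ℝ)) * ((1+1/(n:ℝ))^j * #(Bohr Γ (ρ/2))) := by ring
        _ ≤ (1+1/(n:ℝ)) * #(Bohr Γ (ρ/2 + 2*j*κ)) := by gcongr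
        _ ≤ _ := h1.le
  have h1 := key J le_rfl
  rw [hJκ, add_halves] at h1
  have h2 : (#(Bohr Γ ρ) : ℝ) ≤ 81 ^ #Γ * #(Bohr Γ (ρ/2)) := by exact_mod_cast bohr_double Γ hρ
  have h3 : (0:ℝ) < #(Bohr Γ (ρ/2)) := by
    exact_mod_cast card_pos.2 ⟨0, bohr_zero (by positivity)⟩
  have h4 : (1+1/(n:ℝ))^J ≤ 81 ^ #Γ := le_of_mul_le_mul_right (h1.trans h2) h3
  have h5 : (2:ℝ) ≤ (1+1/(n:ℝ))^n := by
    have := one_add_mul_le_pow (a := 1/(n:ℝ)) (by have : 0 < 1/(n:ℝ) := by positivity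
                                                  linarith) n
    rw [mul_one_div_cancel hn0.ne'] at this
    linarith
  have h6 : (128:ℝ)^(d+1) ≤ (1+1/(n:ℝ))^J := by
    calc (128:ℝ)^(d+1) = 2^(7*(d+1)) := by rw [pow_mul]; norm_num
      _ ≤ ((1+1/(n:ℝ))^n)^(7*(d+1)) := by gcongr
      _ = _ := by rw [← pow_mul, hJ]; congr 1; ring
  have h7 : (81:ℝ)^#Γ ≤ 81^d := pow_le_pow_right₀ (by norm_num) hd
  have h8 : (81:ℝ)^d < 128^(d+1) := by
    calc (81:ℝ)^d ≤ 128^d := by gcongr; norm_num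
      _ < 128^(d+1) := pow_lt_pow_right₀ (by norm_num) (by omega)
  linarith
end KM
section KM
variable {G : Type*} [AddCommGroup G] [Fintype G] [DecidableEq G]

lemma km_tail (X V V2 S Xs B : Finset G) (l : ℕ) (M α : ℝ) (hV0 : (0:ℝ) < #V) (hV20 : (0:ℝ) < #V2)
    (hXsne : Xs.Nonempty) (hB0 : (0:ℝ) < #B) (hα : 0 < α) (hM : M = α * #X) (hX : X.Nonempty)
    (hS : ∀ s ∈ S, 1.01 * M ≤ corr (ind X) (ind X) s)
    (hFb : ∀ b ∈ B, 1 - 4/2000 ≤ (Av Xs)^[l] (Psi V V2 S) b) :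
    ∃ t, 1.005 * α * #B ≤ #(B.filter (fun b => t + b ∈ X)) := by
  obtain ⟨t, -, ht⟩ := exists_max_image (univ : Finset G) (fun t => ∑ b ∈ B, ind S (t+b)) ⟨0, mem_univ _⟩
  have hav := av_le (Psi V V2 S) Xs B hXsne l (∑ b ∈ B, ind S (t+b)) (by
    intro s
    unfold Psi
    rw [← sum_div, sum_comm, div_le_iff₀ hV0]
    calc _ ≤ ∑ v ∈ V, ∑ b ∈ B, ind S (t+b) := by
          apply sum_le_sum; intro v hv
          rw [← sum_div, sum_comm, div_le_iff₀ hV20]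
          calc _ ≤ ∑ v' ∈ V2, ∑ b ∈ B, ind S (t+b) := by
                apply sum_le_sum; intro v' hv'
                have := ht (v + s - v') (mem_univ _)
                refine le_trans (le_of_eq ?_) this
                apply sum_congr rfl; intro b _; congr 1; abel
            _ = _ := by rw [sum_const, nsmul_eq_mul, mul_comm]
      _ = _ := by rw [sum_const, nsmul_eq_mul, mul_comm]) 0
  have hsum : (1 - 4/2000) * #B ≤ ∑ b ∈ B, ind S (t+b) := by
    refine le_trans ?_ hav
    rw [mul_comm, ← nsmul_eq_mul, ← sum_const]
    apply sum_le_sum; intro b hb; rw [zero_add]; exact hFb b hb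
  have hX0 : (0:ℝ) < #X := by exact_mod_cast hX.card_pos
  have hM0 : 0 < M := by rw [hM]; positivity
  have hu : 1.01 * M * ∑ b ∈ B, ind S (t+b) ≤ ∑ b ∈ B, corr (ind X) (ind X) (t+b) := by
    rw [mul_sum]
    apply sum_le_sum; intro b hb
    by_cases hc : t + b ∈ S
    · have := hS _ hc
      rw [show ind S (t+b) = 1 from if_pos hc]; linarith
    · rw [show ind S (t+b) = 0 from if_neg hc, mul_zero]
      exact sum_nonneg (fun x _ => mul_nonneg (ind_nonneg _ _) (ind_nonneg _ _))
  have hu2 : ∑ b ∈ B, corr (ind X) (ind X) (t+b) =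
      ∑ x ∈ X, (#(B.filter (fun b => x + t + b ∈ X)) : ℝ) := by
    unfold corr
    rw [sum_comm]
    have : ∀ x : G, ∑ b ∈ B, ind X x * ind X (x + (t+b)) =
        if x ∈ X then (#(B.filter (fun b => x + t + b ∈ X)) : ℝ) else 0 := by
      intro x
      by_cases hx : x ∈ X
      · simp only [ind, hx, if_true, one_mul, card_filter, Nat.cast_sum]
        apply sum_congr rfl; intro b _; rw [add_assoc]; split_ifs <;> simp
      · simp [ind, hx]
    rw [sum_congr rfl (fun x _ => this x), sum_ite_mem, univ_inter]
  by_contra! hcon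
  have hlast : ∑ x ∈ X, (#(B.filter (fun b => x + t + b ∈ X)) : ℝ) ≤ ∑ x ∈ X, 1.005 * α * #B :=
    sum_le_sum (fun x _ => (hcon (x+t)).le)
  rw [sum_const, nsmul_eq_mul, ← hu2] at hlast
  have hf := hu.trans hlast
  have hg : 1.01 * M * ((1 - 4/2000) * #B) ≤ 1.01 * M * ∑ b ∈ B, ind S (t+b) := by gcongr
  have hMB : 0 < M * #B := by positivity
  have : (#X:ℝ) * (1.005 * α * #B) = 1.005 * (M * #B) := by rw [hM]; ring
  rw [this] at hf
  nlinarith only [hf, hg, hMB]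

set_option maxHeartbeats 1000000 in
lemma km_incr (Γ : Finset (AddChar G ℂ)) (X : Finset G) (w w' k τ τ' M α θ : ℝ) (p q l m n1 : ℕ)
    (hw : 0 ≤ w) (hw' : 0 ≤ w') (hτ : 0 ≤ τ) (hτ' : 0 ≤ τ') (hwk : w' ≤ k) (hlk : 2*l*τ ≤ k)
    (hW : (#(Bohr Γ (w+k)) : ℝ) ≤ 2 * #(Bohr Γ w))
    (hW' : (#(Bohr Γ (w'+τ)) : ℝ) ≤ 2 * #(Bohr Γ w'))
    (hT : (#(Bohr Γ (τ+τ')) : ℝ) ≤ 2 * #(Bohr Γ τ))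
    (hq : q = 64*p) (hp : 12 ≤ p) (hα : 0 < α) (hM : M = α * #X) (hX : X.Nonempty)
    (hl : 1 ≤ l) (hm : 1 ≤ m) (hn1 : 1 ≤ n1) (hθ0 : 0 < θ) (hθ : θ ≤ α^q)
    (h1 : 8 * Real.exp (-(m * (1/(8000*l))^2/2)) ≤ 1/(8000*l) * θ)
    (h2 : 8 < (θ/8)^m * Real.exp (n1/8))
    (h3 : 2 * (1/4:ℝ)^l * √(2/θ) ≤ 1/2000)
    (h : 4^p * M^q * (#(Bohr Γ w):ℝ)^2 ≤
      ∑ v ∈ Bohr Γ w, ∑ v' ∈ Bohr Γ w, (corr (ind X) (ind X) (v-v'))^q) :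
    ∃ n < n1, ∃ lam : Fin n → AddChar G ℂ, ∀ B : Finset G, B.Nonempty →
      (∀ b ∈ B, ∀ i, ‖lam i b - 1‖ ≤ (1/4)^l/n1) →
      (∀ b ∈ B, (#((Bohr Γ τ').filter (fun x => x + b ∉ Bohr Γ τ')) : ℝ) ≤
        (Real.exp (-(n1/2)) * (1/4)^l/2) * #(Bohr Γ τ')) →
      ∃ t, 1.005 * α * #B ≤ #(B.filter (fun b => t + b ∈ X)) := by
  have hWne : (Bohr Γ w).Nonempty := ⟨0, bohr_zero hw⟩
  have hk0 : 0 ≤ k := hw'.trans hwk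
  have hl0 : (0:ℝ) < l := by exact_mod_cast hl
  obtain ⟨V, hVW, hVc, hVbad⟩ := km_sift X (Bohr Γ w) p q M α hq hp hα hM hX hWne h
  have hW0 : (0:ℝ) < #(Bohr Γ w) := by exact_mod_cast hWne.card_pos
  have hVθ : θ * #(Bohr Γ w) ≤ #V := (mul_le_mul_of_nonneg_right hθ hW0.le).trans hVc
  have hV0 : (0:ℝ) < #V := lt_of_lt_of_le (by positivity) hVθ
  have hVne : V.Nonempty := card_pos.1 (by exact_mod_cast hV0)
  have hWW : (#(Bohr Γ (w+w')) : ℝ) ≤ 2 * #(Bohr Γ w) := by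
    refine le_trans ?_ hW
    exact_mod_cast card_le_card (bohr_mono (by linarith))
  obtain ⟨y, V2, hV2, hV2y, hV2c, hV2bad⟩ := km_localize V (Bohr Γ w') (Bohr Γ (w+w')) hVne
    ⟨0, bohr_zero hw'⟩ θ (1/2000) (by norm_num) (fun v hv u hu => bohr_sub (hVW hv) hu)
    (by nlinarith only [hWW, hθ0, hVθ]) (fun v v' => corr (ind X) (ind X) (v - v') < 1.01*M) hVbad
  have hW'0 : (0:ℝ) < #(Bohr Γ w') := by exact_mod_cast card_pos.2 ⟨0, bohr_zero hw'⟩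
  have hV20 : (0:ℝ) < #V2 := lt_of_lt_of_le (by positivity) hV2c
  have hV2ne : V2.Nonempty := card_pos.1 (by exact_mod_cast hV20)
  set S : Finset G := univ.filter (fun t => t + y ∈ Bohr Γ (w+w') ∧
    ¬ corr (ind X) (ind X) t < 1.01*M) with hS
  have hSc : (#S:ℝ) ≤ 2 * #(Bohr Γ w) := by
    refine le_trans ?_ hWW
    have : #S ≤ #(Bohr Γ (w+w')) := by
      apply card_le_card_of_injOn (fun t => t + y)
      · intro t ht; exact (mem_filter.1 ht).2.1
      · intro a _ b _ hab; simpa using hab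
    exact_mod_cast this
  have hPsi : 1 - 1/1000 ≤ Psi V V2 S 0 := by
    have e : ∑ v ∈ V, ∑ v' ∈ V2, ind S (v + 0 - v') =
        #V * #V2 - #((V ×ˢ V2).filter (fun v => corr (ind X) (ind X) (v.1 - v.2) < 1.01*M)) := by
      rw [card_filter, ← sum_product', Nat.cast_sum, ← Nat.cast_mul, ← card_product, card_eq_sum_ones, Nat.cast_sum,
        ← sum_sub_distrib]
      apply sum_congr rfl
      rintro ⟨v, v'⟩ hv
      rw [mem_product] at hv
      have hmem : v - v' + y ∈ Bohr Γ (w+w') := by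
        have := bohr_sub (hVW hv.1) (hV2y v' hv.2)
        rwa [show v - v' + y = v - (v' - y) by abel]
      have hiff : v + 0 - v' ∈ S ↔ ¬ corr (ind X) (ind X) (v - v') < 1.01*M := by
        rw [hS, mem_filter, add_zero]; exact ⟨fun h => h.2.2, fun h => ⟨mem_univ _, hmem, h⟩⟩
      show (if v + 0 - v' ∈ S then (1:ℝ) else 0) = _
      by_cases hc : corr (ind X) (ind X) (v - v') < 1.01*M
      · rw [if_neg (by rw [hiff]; exact not_not.2 hc), if_pos hc]; simp
      · rw [if_pos (hiff.2 hc), if_neg hc]; simp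
    unfold Psi
    simp_rw [← sum_div]
    rw [e, div_div, le_div_iff₀ (by positivity)]
    linarith only [hV2bad]
  obtain ⟨Xs, hXs, hXsc, hXsP⟩ := km_cs V V2 (Bohr Γ τ) ((Bohr Γ (w'+τ)).image (fun x => x + y))
    (Bohr Γ (w+k)) S hVne hV2ne (Finset.Nonempty.image ⟨0, bohr_zero (by linarith)⟩ _) m hm
    (1/(8000*l)) (by positivity) (by
      intro v hv t ht
      rw [mem_image]
      exact ⟨v - y + t, bohr_add (hV2y v hv) ht, by abel⟩) (by
      have := Real.exp_pos (-(m * (1/(8000*l:ℝ))^2/2))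
      have hθV : 1/(8000*l) * (θ * #(Bohr Γ w)) ≤ 1/(8000*(l:ℝ)) * #V := by gcongr
      have h11 := mul_le_mul_of_nonneg_right h1 hW0.le
      have h12 := mul_le_mul_of_nonneg_left hW this.le
      nlinarith only [h11, h12, hθV])
  have hT0 : (0:ℝ) < #(Bohr Γ τ) := by exact_mod_cast card_pos.2 ⟨0, bohr_zero hτ⟩
  have hXsc2 : 1/2 * (θ/8)^m * #(Bohr Γ τ) ≤ #Xs := by
    refine le_trans ?_ hXsc
    have hR0 : (0:ℝ) < #(Bohr Γ (w'+τ)) := by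
      exact_mod_cast card_pos.2 ⟨0, bohr_zero (add_nonneg hw' hτ)⟩
    rw [card_image_of_injective _ (add_left_injective y)]
    have : θ/8 ≤ #V2 / #(Bohr Γ (w'+τ)) := by
      rw [le_div_iff₀ hR0]; nlinarith only [hV2c, hW', hθ0]
    gcongr
  have hXs0 : (0:ℝ) < #Xs := lt_of_lt_of_le (by positivity) hXsc2
  have hXsne : Xs.Nonempty := card_pos.1 (by exact_mod_cast hXs0)
  have hclose := av_close (Psi V V2 S) Xs hXsne l (4*(1/(8000*l))) (by positivity)
    (fun j => (Bohr Γ (2*j*τ) : Set G)) (by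
      intro j hj s hs a ha b hb
      simp only [mem_coe] at *
      have := bohr_sub (bohr_add hs (hXs hb)) (hXs ha)
      refine bohr_mono ?_ this
      push_cast; linarith) (by
      intro j hj s hs a ha b hb
      simp only [mem_coe] at *
      have hj1 : ((j:ℝ)+1) ≤ l := by exact_mod_cast hj
      have hjt : 2*((j:ℝ)+1)*τ ≤ k := le_trans (by gcongr) hlk
      apply hXsP s a ha b hb
      · intro v hv
        exact bohr_mono (by linarith only [hjt, hτ]) (bohr_add (hVW hv) hs)
      · intro v hv
        have := bohr_add (hVW hv) (bohr_sub (bohr_add hs (hXs hb)) (hXs ha))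
        exact bohr_mono (by linarith only [hjt, hτ]) this) l le_rfl 0 (by
      simp only [mem_coe]; exact bohr_zero (by simp))
  have hl4 : (l:ℝ) * (4*(1/(8000*l))) = 1/2000 := by field_simp; norm_num
  rw [hl4] at hclose
  have hn10 : (0:ℝ) < n1 := by exact_mod_cast hn1
  obtain ⟨n, hn, lam, hlam⟩ := chang_max Xs (Bohr Γ τ) (Bohr Γ τ') (Bohr Γ (τ+τ'))
    (Real.exp (-(n1/2))) (Real.exp_pos _) n1 (by rw [← Real.exp_add]; simp)
    ⟨0, bohr_zero hτ'⟩ hXs hXsne (fun x hx y hy => bohr_sub hx hy) (by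
      have h5 : (1/2 * (θ/8)^m * #(Bohr Γ τ)) * Real.exp (n1/8) ≤ #Xs * Real.exp (n1/8) := by gcongr
      nlinarith only [mul_lt_mul_of_pos_right h2 hT0, h5, hT])
  refine ⟨n, hn, lam, fun B hBne hBlam hBinv => ?_⟩
  have hB0 : (0:ℝ) < #B := by exact_mod_cast hBne.card_pos
  set F := (Av Xs)^[l] (Psi V V2 S) with hF
  have hF0 : 1 - 3/2000 ≤ F 0 := by
    have := (abs_le.1 hclose).1; linarith
  have hsq : √(#S/#V) ≤ √(2/θ) := by
    apply Real.sqrt_le_sqrt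
    rw [div_le_div_iff₀ hV0 hθ0]
    nlinarith only [hSc, hθ0, hVθ]
  have hFb : ∀ b ∈ B, 1 - 4/2000 ≤ F b := by
    intro b hb
    have := av_spectral V V2 S Xs hVne hV2ne l (2*(1/4)^l) b le_rfl (by
      intro γ hγ
      have h6 := hlam γ hγ b _ _ (hBlam b hb) (hBinv b hb)
      refine h6.trans ?_
      have h7 : (n:ℝ) ≤ n1 := by exact_mod_cast hn.le
      have h8 : (n:ℝ) * ((1/4)^l/n1) ≤ (1/4)^l := by
        rw [← mul_div_assoc, div_le_iff₀ hn10, mul_comm]; gcongr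
      have h9 : 2 * (Real.exp (-(n1/2)) * (1/4)^l/2) / Real.exp (-(n1/2)) = (1/4)^l := by
        field_simp
      rw [h9]; linarith)
    have h6 : 2*(1/4:ℝ)^l * √(#S/#V) ≤ 1/2000 := le_trans (by gcongr) h3
    have := (abs_le.1 (this.trans h6)).1
    linarith
  exact km_tail X V V2 S Xs B l M α hV0 hV20 hXsne hB0 hα hM hX
    (fun s hs => not_lt.1 (mem_filter.1 hs).2.2) hFb
end KM

lemma exp_neg_half (n : ℕ) : Real.exp (-(n:ℝ)) ≤ (1/2)^n := by
  have h : Real.exp (-(n:ℝ)) = (Real.exp (-1))^n := by rw [← Real.exp_nat_mul]; congr 1; ring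
  rw [h]
  have h2 : Real.exp (-1) ≤ 1/2 := by
    rw [Real.exp_neg, one_div]
    exact inv_anti₀ (by norm_num) (by have := Real.add_one_le_exp (1:ℝ); linarith)
  gcongr

lemma half_le {a b : ℕ} (h : a ≤ b) : (1/2:ℝ)^b ≤ (1/2)^a :=
  pow_le_pow_of_le_one (by norm_num) (by norm_num) h

lemma km_params (Λ l m n1 : ℕ) (hΛ : 1 ≤ Λ) (hl : l = 512*Λ^2) (hm : m = 4*l*(8000*l)^2)
    (hn : n1 = 8*m*l) :
    8 * Real.exp (-(m * (1/(8000*l))^2/2)) ≤ 1/(8000*(l:ℝ)) * (1/2)^(128*Λ^2) ∧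
    8 < ((1/2)^(128*Λ^2)/8)^m * Real.exp ((n1:ℝ)/8) ∧
    2 * (1/4:ℝ)^l * √(2/(1/2)^(128*Λ^2)) ≤ 1/2000 ∧
    (1/2:ℝ)^(2*n1) ≤ (1/4)^l/n1 ∧ (1/2:ℝ)^(2*n1) ≤ Real.exp (-(n1/2)) * (1/4)^l/2 := by
  have hl512 : 512 ≤ l := by rw [hl]; nlinarith
  have hl0 : (0:ℝ) < l := by exact_mod_cast (by omega : 0 < l)
  have hm1 : 1 ≤ m := by rw [hm]; exact Nat.mul_pos (by omega) (by positivity)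
  have hb : 128*Λ^2*4 = l := by rw [hl]; ring
  set b := 128*Λ^2 with hbd
  have hb128 : 128 ≤ b := by rw [hbd]; nlinarith
  clear_value b
  have hml : 512 ≤ m*l := by nlinarith
  have h4 : (1/4:ℝ)^l = (1/2)^(2*l) := by rw [pow_mul]; norm_num
  have hln1 : 2*l+1 ≤ n1 := by rw [hn]; nlinarith
  have hn10 : (0:ℝ) < n1 := by exact_mod_cast (by omega : 0 < n1)
  refine ⟨?_, ?_, ?_, ?_, ?_⟩
  · have e : (m:ℝ) * (1/(8000*l))^2/2 = ((2*l : ℕ):ℝ) := by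
      rw [hm]; push_cast; field_simp; norm_num
    rw [e]
    have h1 := exp_neg_half (2*l)
    have h2 : (1/2:ℝ)^(2*l) ≤ (1/2)^l * ((1/2)^b * (1/2)^16) := by
      rw [← pow_add, ← pow_add]; exact half_le (by omega)
    have h3 : (l:ℝ) * (1/2)^l ≤ 1 := by
      rw [one_div, inv_pow, ← div_eq_mul_inv, div_le_one (by positivity)]
      exact_mod_cast Nat.lt_two_pow_self.le
    have h5 : (0:ℝ) < (1/2)^b := by positivity
    rw [one_div_mul_eq_div, le_div_iff₀ (by positivity)]
    calc 8 * Real.exp (-((2*l:ℕ):ℝ)) * (8000*l) ≤ 8 * ((1/2)^l * ((1/2)^b * (1/2)^16)) * (8000*l) := by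
          gcongr; exact h1.trans h2
      _ = (l * (1/2)^l) * ((1/2)^b * (64000 * (1/2)^16)) := by ring
      _ ≤ 1 * ((1/2)^b * 1) := by gcongr; norm_num
      _ = _ := by ring
  · have e : (n1:ℝ)/8 = ((m*l:ℕ):ℝ) := by rw [hn]; push_cast; ring
    rw [e]
    have h1 := exp_neg_half (m*l)
    have h2 : (2:ℝ)^(m*l) ≤ Real.exp ((m*l:ℕ):ℝ) := by
      rw [Real.exp_neg, one_div, inv_pow] at h1
      exact (inv_le_inv₀ (Real.exp_pos _) (by positivity)).1 h1
    have h3 : ((1/2:ℝ)^b/8)^m = (1/2)^((b+3)*m) := by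
      rw [pow_mul, pow_add]; congr 1; ring
    rw [h3]
    calc (8:ℝ) < 2^4 := by norm_num
      _ ≤ 2^(m*l - (b+3)*m) := by
          apply pow_le_pow_right₀ (by norm_num)
          have : (b+3)*m + 4 ≤ m*l := by nlinarith
          omega
      _ = (1/2)^((b+3)*m) * 2^(m*l) := by
          have : (b+3)*m ≤ m*l := by nlinarith
          rw [one_div, inv_pow, ← div_eq_inv_mul, pow_sub₀ _ (by norm_num) this, div_eq_mul_inv]
      _ ≤ _ := by gcongr
  · have h1 : √(2/(1/2)^b) ≤ 2^(b+1) := by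
      rw [Real.sqrt_le_left (by positivity), one_div, inv_pow, div_inv_eq_mul, ← pow_succ', ← pow_mul]
      exact pow_le_pow_right₀ (by norm_num) (by omega)
    rw [h4]
    calc 2 * (1/2:ℝ)^(2*l) * √(2/(1/2)^b) ≤ 2 * ((1/2)^(b+1+12)) * 2^(b+1) := by
          have := half_le (show b+1+12 ≤ 2*l by omega)
          gcongr
      _ = 2 * (1/2)^12 * ((1/2)^(b+1) * 2^(b+1)) := by rw [pow_add]; ring
      _ = 2 * (1/2)^12 * 1 := by rw [← mul_pow]; norm_num
      _ ≤ _ := by norm_num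
  · rw [h4, le_div_iff₀ hn10]
    have h3 : (n1:ℝ) * (1/2)^n1 ≤ 1 := by
      rw [one_div, inv_pow, ← div_eq_mul_inv, div_le_one (by positivity)]
      exact_mod_cast Nat.lt_two_pow_self.le
    calc (1/2:ℝ)^(2*n1) * n1 = (1/2)^n1 * (n1 * (1/2)^n1) := by rw [two_mul, pow_add]; ring
      _ ≤ (1/2)^n1 * 1 := by gcongr
      _ ≤ _ := by rw [mul_one]; exact half_le (by omega)
  · rw [h4]
    have h1 : (1/2:ℝ)^n1 ≤ Real.exp (-(n1/2)) := by
      have e : Real.exp (-((n1:ℝ)/2)) = Real.exp (-(1/2))^n1 := by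
        rw [← Real.exp_nat_mul]; congr 1; ring
      rw [e]
      have := Real.add_one_le_exp (-(1/2:ℝ))
      gcongr; linarith
    calc (1/2:ℝ)^(2*n1) = (1/2)^n1 * (1/2)^n1 := by rw [two_mul, pow_add]
      _ ≤ Real.exp (-(n1/2)) * (1/2)^(2*l+1) := by
          have := half_le hln1
          gcongr ?_ * ?_
      _ = _ := by rw [pow_succ]; ring
section KM
variable {G : Type*} [AddCommGroup G] [Fintype G] [DecidableEq G]

lemma cnv_comm' (f g : G → ℝ) (z : G) : cnv f g z = cnv g f z := by
  unfold cnv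
  apply Fintype.sum_equiv (Equiv.subLeft z)
  intro x; simp [mul_comm]

lemma cnv_ge (X D : Finset G) (hX : X ⊆ D) (z : G) (η : ℝ)
    (h : (#(D.filter (fun x => z - x ∉ D)) : ℝ) ≤ η * #D) :
    (#X:ℝ) - η * #D ≤ cnv (ind X) (ind D) z := by
  have e : cnv (ind X) (ind D) z = #(X.filter (fun x => z - x ∈ D)) := by
    unfold cnv
    have : ∀ x, ind X x * ind D (z - x) = if x ∈ X then (if z - x ∈ D then (1:ℝ) else 0) else 0 := by
      intro x; simp only [ind]; split_ifs <;> simp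
    rw [sum_congr rfl (fun x _ => this x), sum_ite_mem, univ_inter, card_filter]
    push_cast; rfl
  have h1 : #(X.filter (fun x => z - x ∈ D)) + #(X.filter (fun x => z - x ∉ D)) = #X :=
    card_filter_add_card_filter_not _
  have h2 : #(X.filter (fun x => z - x ∉ D)) ≤ #(D.filter (fun x => z - x ∉ D)) :=
    card_le_card (filter_subset_filter _ hX)
  have h3 : (#(X.filter (fun x => z - x ∈ D)):ℝ) + #(X.filter (fun x => z - x ∉ D)) = #X := by
    exact_mod_cast h1
  have h4 : (#(X.filter (fun x => z - x ∉ D)):ℝ) ≤ #(D.filter (fun x => z - x ∉ D)) := by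
    exact_mod_cast h2
  rw [e]; linarith

lemma cnv_le (D : Finset G) (z : G) : cnv (ind D) (ind D) z ≤ #D := by
  rw [← sum_ind D 0]; simp only [add_zero]
  unfold cnv
  exact sum_le_sum (fun x _ => mul_le_of_le_one_right (ind_nonneg _ _) (ind_le_one _ _))

lemma cnv_expand (X Y D : Finset G) (a b : ℝ) (z : G) :
    cnv (fun x => ind X x - a * ind D x) (fun x => ind Y x - b * ind D x) z =
      cnv (ind X) (ind Y) z - b * cnv (ind X) (ind D) z - a * cnv (ind Y) (ind D) z
        + a * b * cnv (ind D) (ind D) z := by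
  rw [cnv_comm' (ind Y) (ind D)]
  unfold cnv
  simp only [mul_sum, ← sum_sub_distrib, ← sum_add_distrib]
  exact sum_congr rfl (fun x _ => by ring)

lemma km_dens (X Y Z D E E' Ep : Finset G) (hX : X ⊆ D) (hY : Y ⊆ D) (hZ : Z ⊆ E)
    (αX αY η MX MY : ℝ) (p : ℕ) (hp : Even p) (hαX : αX = #X/#D) (hαY : αY = #Y/#D)
    (hMX : MX = αX * #X) (hMY : MY = αY * #Y)
    (hX0 : 0 < αX) (hY0 : 0 < αY) (hZne : Z.Nonempty) (hE' : E'.Nonempty)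
    (hinv : ∀ z ∈ E, (#(D.filter (fun x => z - x ∉ D)) : ℝ) ≤ η * #D)
    (hEp : ∀ z ∈ E, ∀ v ∈ E', z - v ∈ Ep) (hEpc : (#Ep:ℝ) ≤ 2 * #E)
    (hsol : ∑ z ∈ Z, cnv (ind X) (ind Y) z ≤ #Z) (hη0 : 0 ≤ η) (hηX : 8 * η ≤ αX) (hηY : 8 * η ≤ αY)
    (hD : 4 ≤ αX * αY * #D) (hZE : 2 * (#E:ℝ) ≤ 4^p * #Z) :
    (MX/8)^p * (#Ep:ℝ)^2 ≤ ∑ v ∈ Ep, ∑ v' ∈ Ep,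
      (corr (fun x => ind X x - αX * ind D x) (fun x => ind X x - αX * ind D x) (v-v'))^p ∨
    (MY/8)^p * (#E':ℝ)^2 ≤ ∑ v ∈ E', ∑ v' ∈ E',
      (corr (fun x => ind Y x - αY * ind D x) (fun x => ind Y x - αY * ind D x) (v-v'))^p := by
  set f : G → ℝ := fun x => ind X x - αX * ind D x with hf
  set g : G → ℝ := fun x => ind Y x - αY * ind D x with hg
  have hD0 : (0:ℝ) < #D := by
    rcases Nat.eq_zero_or_pos (#D) with h | h
    · rw [h] at hD; norm_num at hD
    · exact_mod_cast h
  have hXD : (#X:ℝ) = αX * #D := by rw [hαX, div_mul_cancel₀ _ hD0.ne']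
  have hYD : (#Y:ℝ) = αY * #D := by rw [hαY, div_mul_cancel₀ _ hD0.ne']
  have hZ0 : (0:ℝ) < #Z := by exact_mod_cast hZne.card_pos
  have hE'0 : (0:ℝ) < #E' := by exact_mod_cast hE'.card_pos
  set a := αX * αY * #D with ha
  have hsum : ∑ z ∈ Z, cnv f g z ≤ -(a/2) * #Z := by
    have : ∀ z ∈ Z, cnv f g z ≤ cnv (ind X) (ind Y) z - a + (αX + αY) * η * #D := by
      intro z hz
      have i1 := cnv_ge X D hX z η (hinv z (hZ hz))
      have i2 := cnv_ge Y D hY z η (hinv z (hZ hz))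
      have i3 := cnv_le D z
      rw [hf, hg, cnv_expand]
      have j1 := mul_le_mul_of_nonneg_left i1 hY0.le
      have j2 := mul_le_mul_of_nonneg_left i2 hX0.le
      have j3 := mul_le_mul_of_nonneg_left i3 (mul_pos hX0 hY0).le
      rw [hXD] at j1; rw [hYD] at j2
      rw [ha]; linarith only [j1, j2, j3]
    have h2 := sum_le_sum this
    rw [sum_add_distrib, sum_sub_distrib, sum_const, sum_const, nsmul_eq_mul, nsmul_eq_mul] at h2
    have h3 : (αX + αY) * η * #D ≤ a/4 := by
      rw [ha]
      have := mul_le_mul_of_nonneg_right (show (αX + αY) * η ≤ αX*αY/4 by nlinarith only [hηX, hηY, hX0, hY0]) hD0.le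
      linarith only [this]
    nlinarith only [h2, h3, hsol, hD, hZ0]
  have hpow : (a/2)^p * #Z ≤ ∑ z ∈ Z, (cnv f g z)^p := by
    have h2 := inv_pos.2 hZ0
    have h3 := Real.pow_arith_mean_le_arith_mean_pow_of_even Z (fun _ => (#Z:ℝ)⁻¹) (fun z => cnv f g z)
      (fun _ _ => h2.le) (by rw [sum_const, nsmul_eq_mul, mul_inv_cancel₀ hZ0.ne']) hp
    rw [← mul_sum, ← mul_sum, ← hp.neg_pow] at h3
    have h4 : a/2 ≤ -((#Z:ℝ)⁻¹ * ∑ z ∈ Z, cnv f g z) := by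
      have := mul_le_mul_of_nonneg_left hsum h2.le
      have e : (#Z:ℝ)⁻¹ * (-(a/2) * #Z) = -(a/2) := by rw [mul_comm, mul_assoc, mul_inv_cancel₀ hZ0.ne', mul_one]
      rw [e] at this; linarith
    have h5 := (pow_le_pow_left₀ (by linarith) h4 p).trans h3
    rw [inv_mul_eq_div, le_div_iff₀ hZ0] at h5
    exact h5
  have hbig : #E' * ((a/2)^p * #Z) ≤ ∑ z₁ ∈ Ep, ∑ z₂ ∈ E', (cnv f g (z₁+z₂))^p := by
    rw [sum_comm, ← nsmul_eq_mul, ← sum_const]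
    apply sum_le_sum
    intro v hv
    refine hpow.trans ?_
    have : ∑ z ∈ Z, (cnv f g z)^p = ∑ u ∈ Z.image (fun z => z - v), (cnv f g (u+v))^p := by
      rw [sum_image (fun x _ y _ h => by simpa using h)]; simp
    rw [this]
    apply sum_le_sum_of_subset_of_nonneg
    · intro u hu
      obtain ⟨z, hz, rfl⟩ := mem_image.1 hu
      exact hEp z (hZ hz) v hv
    · intro i _ _; exact hp.pow_nonneg _
  have hdec := km_decouple f g Ep E' p
  by_contra! hcon
  have c1 := mul_lt_mul'' hcon.1 hcon.2 (km_corr_nonneg _ _ _) (km_corr_nonneg _ _ _)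
  have hEpZ : (1/8:ℝ)^p * #Ep ≤ (1/2)^p * #Z := by
    have e : (1/2:ℝ)^p = 4^p * (1/8)^p := by rw [← mul_pow]; norm_num
    rw [e]
    have : (0:ℝ) < (1/8)^p := by positivity
    nlinarith only [hEpc, hZE, this]
  have ha0 : 0 < a := by linarith
  have hlow : (#E' * ((a/8)^p * #Ep))^2 ≤ (#E' * ((a/2)^p * #Z))^2 := by
    have e1 : (a/8)^p * #Ep = a^p * ((1/8)^p * #Ep) := by rw [← mul_assoc, ← mul_pow]; congr 2; ring
    have e2 : (a/2)^p * #Z = a^p * ((1/2)^p * #Z) := by rw [← mul_assoc, ← mul_pow]; congr 2; ring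
    rw [e1, e2]
    refine pow_le_pow_left₀ ?_ (mul_le_mul_of_nonneg_left (mul_le_mul_of_nonneg_left hEpZ (pow_pos ha0 p).le) hE'0.le) 2
    exact mul_nonneg hE'0.le (mul_nonneg (pow_pos ha0 p).le (mul_nonneg (pow_nonneg (by norm_num) p) (Nat.cast_nonneg _)))
  have hlow2 : (#E' * ((a/2)^p * #Z))^2 ≤ (∑ z₁ ∈ Ep, ∑ z₂ ∈ E', (cnv f g (z₁+z₂))^p)^2 := by
    refine pow_le_pow_left₀ ?_ hbig 2
    exact mul_nonneg hE'0.le (mul_nonneg (pow_nonneg (by linarith only [ha0]) p) hZ0.le)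
  have e3 : (MX/8)^p * (#Ep:ℝ)^2 * ((MY/8)^p * (#E':ℝ)^2) = (#E' * ((a/8)^p * #Ep))^2 := by
    have : (MX/8)^p * (MY/8)^p = ((a/8)^p)^2 := by
      rw [← mul_pow, ← pow_mul, mul_comm p 2, pow_mul]; congr 1
      rw [hMX, hMY, ha, hXD, hYD]; ring
    calc _ = ((MX/8)^p * (MY/8)^p) * (#Ep:ℝ)^2 * (#E':ℝ)^2 := by ring
      _ = _ := by rw [this]; ring
  linarith only [c1, hlow, hlow2, hdec, e3]
end KM
section KM
variable {G : Type*} [AddCommGroup G] [Fintype G] [DecidableEq G]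

def Reg (n1 : ℕ) (Γ : Finset (AddChar G ℂ)) (r κ : ℝ) : Prop :=
  0 < r ∧ 0 < κ ∧ (#(Bohr Γ (r+2*κ)) : ℝ) ≤ (1+(1/2)^(2*n1)) * #(Bohr Γ r)

lemma exists_reg (n1 : ℕ) (Γ : Finset (AddChar G ℂ)) {ρ : ℝ} (hρ : 0 < ρ) (h5 : 5 ≤ n1)
    (hd : #Γ + 1 ≤ 2^n1) : ∃ r, ρ/2 ≤ r ∧ r ≤ ρ ∧ Reg n1 Γ r (ρ * (1/2)^(4*n1)) := by
  obtain ⟨r, h1, h2, h3⟩ := bohr_regular Γ hρ (2^(2*n1)) (#Γ) Nat.one_le_two_pow le_rfl rfl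
  refine ⟨r, h1, h2, by linarith, by positivity, ?_⟩
  have e : (1/2:ℝ)^(2*n1) = 1/((2^(2*n1) : ℕ):ℝ) := by push_cast; rw [one_div, one_div, inv_pow]
  rw [e]
  refine le_trans ?_ h3
  have : Bohr Γ (r + 2*(ρ * (1/2)^(4*n1))) ⊆ Bohr Γ (r + 2*(ρ / (28 * ((2^(2*n1):ℕ):ℝ) * (#Γ+1)))) := by
    apply bohr_mono
    have : ρ * (1/2)^(4*n1) ≤ ρ / (28 * ((2^(2*n1):ℕ):ℝ) * (#Γ+1)) := by
      rw [le_div_iff₀ (by positivity)]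
      have a1 : ((#Γ:ℝ)+1) ≤ 2^n1 := by exact_mod_cast hd
      have a2 : (28:ℝ) ≤ 2^n1 := by
        calc (28:ℝ) ≤ 2^5 := by norm_num
          _ ≤ 2^n1 := pow_le_pow_right₀ (by norm_num) h5
      push_cast
      calc ρ * (1/2)^(4*n1) * (28 * 2^(2*n1) * (#Γ+1)) ≤ ρ * (1/2)^(4*n1) * (2^n1 * 2^(2*n1) * 2^n1) := by gcongr
        _ = ρ * ((1/2)^(4*n1) * 2^(4*n1)) := by rw [← pow_add, ← pow_add]; ring_nf
        _ ≤ ρ := by rw [← mul_pow]; norm_num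
    linarith
  exact_mod_cast card_le_card this

lemma Reg.two {n1 : ℕ} {Γ : Finset (AddChar G ℂ)} {r κ s : ℝ} (h : Reg n1 Γ r κ) (hs : s ≤ 2*κ) :
    (#(Bohr Γ (r+s)) : ℝ) ≤ 2 * #(Bohr Γ r) := by
  have h1 : (#(Bohr Γ (r+s)) : ℝ) ≤ #(Bohr Γ (r+2*κ)) := by
    exact_mod_cast card_le_card (bohr_mono (by linarith))
  have h2 : (1/2:ℝ)^(2*n1) ≤ 1 := pow_le_one₀ (by norm_num) (by norm_num)
  have h3 : (0:ℝ) ≤ #(Bohr Γ r) := Nat.cast_nonneg _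
  nlinarith only [h.2.2, h1, h2, h3]

lemma Reg.shift {n1 : ℕ} {Γ : Finset (AddChar G ℂ)} {r κ : ℝ} (h : Reg n1 Γ r κ) {s : G}
    (hs : s ∈ Bohr Γ (2*κ)) :
    (#((Bohr Γ r).filter (fun x => x + s ∉ Bohr Γ r)) : ℝ) ≤ (1/2)^(2*n1) * #(Bohr Γ r) :=
  bohr_shift h.2.2 (by linarith [h.2.1]) hs

set_option maxHeartbeats 1000000 in
lemma km_case (Γ : Finset (AddChar G ℂ)) (D X : Finset G) (w k α M : ℝ) (Λ l m n1 p q : ℕ)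
    (hΛ : 6 ≤ Λ) (hl : l = 512*Λ^2) (hm : m = 4*l*(8000*l)^2) (hn : n1 = 8*m*l)
    (hp : p = 2*Λ) (hq : q = 64*p) (hw : 0 ≤ w) (hk : 0 < k) (hk1 : k ≤ 1)
    (hd : #Γ + n1 + 1 ≤ 2^n1) (hX : X ⊆ D) (hα : α = #X/#D) (hαΛ : (1/2)^Λ ≤ α) (hM : M = α * #X)
    (hinv : ∀ v ∈ Bohr Γ w, ∀ v' ∈ Bohr Γ w,
      (#(D.filter (fun x => x + (v-v') ∉ D)) : ℝ) ≤ (1/2)^(2*n1) * #D)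
    (hW : (#(Bohr Γ (w+k)) : ℝ) ≤ 2 * #(Bohr Γ w))
    (h : (M/8)^p * (#(Bohr Γ w):ℝ)^2 ≤ ∑ v ∈ Bohr Γ w, ∑ v' ∈ Bohr Γ w,
      (corr (fun x => ind X x - α * ind D x) (fun x => ind X x - α * ind D x) (v-v'))^p) :
    ∃ Γ' : Finset (AddChar G ℂ), #Γ' ≤ #Γ + n1 ∧ ∃ r, Reg n1 Γ' r (k * ((1/2)^(4*n1))^6) ∧
      r ≤ 1 ∧ ∃ t, 1.005 * α * #(Bohr Γ' r) ≤ #((Bohr Γ' r).filter (fun b => t + b ∈ X)) := by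
  classical
  obtain ⟨P1, P2, P3, P4, P5⟩ := km_params Λ l m n1 (by omega) hl hm hn
  have hl512 : 512*6 ≤ l := by rw [hl]; nlinarith only [hΛ]
  have hm1 : 1 ≤ m := by rw [hm]; exact Nat.mul_pos (by omega) (by positivity)
  have hn1l : 8*l ≤ n1 := by rw [hn]; nlinarith only [hm1, hl512]
  have hlΛ : 512*Λ ≤ l := by rw [hl]; nlinarith only [hΛ]
  have hα0 : 0 < α := lt_of_lt_of_le (by positivity) hαΛ
  have hXne : X.Nonempty := by
    rw [nonempty_iff_ne_empty]; rintro rfl; simp at hα; linarith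
  have hD0 : (0:ℝ) < #D := by exact_mod_cast (hXne.mono hX).card_pos
  have hXD : (#X:ℝ) = α * #D := by rw [hα, div_mul_cancel₀ _ hD0.ne']
  have hun := km_unbalance X D (Bohr Γ w) hX hXne ((1/2)^(2*n1)) (2*(1/2)^(2*n1)/α) p q hinv
    (by positivity) (by
      rw [hXD, ← mul_assoc, div_mul_cancel₀ _ hα0.ne'])
    hq (by omega) (by rw [hp]; exact even_two_mul Λ) (by
      rw [← mul_div_assoc, div_le_iff₀ hα0]
      have a1 : (q:ℝ) ≤ 2^n1 := by exact_mod_cast (show q ≤ n1 by omega).trans Nat.lt_two_pow_self.le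
      have a2 : (1/2:ℝ)^(n1) ≤ (1/2)^(Λ+2) := half_le (by omega)
      have a3 : (2:ℝ)^n1 * (1/2)^n1 = 1 := by rw [← mul_pow]; norm_num
      have a4 : (0:ℝ) < (1/2)^n1 := by positivity
      calc (q:ℝ) * (2*(1/2)^(2*n1)) ≤ 2^n1 * (2*(1/2)^(2*n1)) := by gcongr
        _ = 2 * (2^n1 * (1/2)^n1) * (1/2)^n1 := by rw [two_mul n1, pow_add]; ring
        _ ≤ 2 * 1 * (1/2)^(Λ+2) := by rw [a3]; gcongr ?_ * ?_
        _ = 1/2 * (1/2)^Λ := by rw [pow_add]; ring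
        _ ≤ _ := by gcongr) M α hα hM h
  set ε : ℝ := (1/2)^(4*n1) with hε
  have hε0 : 0 < ε := by positivity
  have hε1 : ε ≤ (1/2)^(2*n1) := half_le (by omega)
  have hε2 : ε ≤ 1 := pow_le_one₀ (by norm_num) (by norm_num)
  have hε3 : 2*l*ε ≤ 1 := by
    have a1 : ((2*l:ℕ):ℝ) ≤ 2^(4*n1) := by
      exact_mod_cast (show 2*l ≤ 4*n1 by omega).trans Nat.lt_two_pow_self.le
    calc 2*l*ε ≤ 2^(4*n1) * ε := by push_cast at a1; gcongr
      _ = 1 := by rw [hε, ← mul_pow]; norm_num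
  have hΓ : #Γ + 1 ≤ 2^n1 := by omega
  have h5 : 5 ≤ n1 := by omega
  clear_value ε
  obtain ⟨w', hw'1, hw'2, hw'r⟩ := exists_reg n1 Γ hk h5 hΓ
  rw [← hε] at hw'r
  obtain ⟨τ, hτ1, hτ2, hτr⟩ := exists_reg n1 Γ (show 0 < k*ε*ε by positivity) h5 hΓ
  obtain ⟨τ', hτ'1, hτ'2, hτ'r⟩ := exists_reg n1 Γ (show 0 < k*ε*ε*ε by positivity) h5 hΓ
  rw [← hε] at hτr hτ'r
  have hke : k*ε*ε ≤ k*ε := mul_le_of_le_one_right (by positivity) hε2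
  have hθ : (1/2:ℝ)^(128*Λ^2) ≤ α^q := by
    calc (1/2:ℝ)^(128*Λ^2) = ((1/2)^Λ)^q := by rw [← pow_mul, hq, hp]; congr 1; ring
      _ ≤ α^q := by gcongr
  obtain ⟨n, hnn, lam, hlam⟩ := km_incr Γ X w w' k τ τ' M α ((1/2)^(128*Λ^2)) p q l m n1
    hw hw'r.1.le hτr.1.le hτ'r.1.le hw'2
    (by
      have : 2*(l:ℝ)*τ ≤ 2*l*(k*ε*ε) := by gcongr
      nlinarith only [this, mul_le_mul_of_nonneg_right hε3 (show 0 ≤ k*ε by positivity), hke, hε2, hk])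
    hW (hw'r.two (by nlinarith only [hτ2, hke, hk, hε0])) (hτr.two (by nlinarith only [hτ'2, hτr.2.1]))
    hq (by omega) hα0 hM hXne (by omega) hm1 (by omega) (by positivity) hθ P1 P2 P3 hun
  set Γ' : Finset (AddChar G ℂ) := Γ ∪ univ.image lam with hΓ'
  have hΓ'c : #Γ' ≤ #Γ + n1 := by
    refine (card_union_le _ _).trans ?_
    have := card_image_le (s := (univ : Finset (Fin n))) (f := lam)
    simp at this; omega
  obtain ⟨r, hr1, hr2, hr⟩ := exists_reg n1 Γ' (show 0 < k*ε^5 by positivity) h5 (by omega)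
  rw [← hε] at hr
  have hε4 : ε^4 ≤ 1 := pow_le_one₀ hε0.le hε2
  have hrε : r ≤ ε := by
    refine hr2.trans ?_
    calc k*ε^5 = k*ε^4*ε := by ring
      _ ≤ 1*1*ε := by gcongr
      _ = ε := by ring
  refine ⟨Γ', hΓ'c, r, ?_, hrε.trans hε2, ?_⟩
  · have : k*ε^5*ε = k*ε^6 := by ring
    rwa [this] at hr
  apply hlam _ ⟨0, bohr_zero hr.1.le⟩
  · intro b hb i
    exact (mem_bohr.1 hb (lam i) (by rw [hΓ']; exact mem_union_right _ (mem_image_of_mem _ (mem_univ _)))).trans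
      ((hrε.trans hε1).trans P4)
  · intro b hb
    refine (hτ'r.shift (s := b) ?_).trans (mul_le_mul_of_nonneg_right P5 (Nat.cast_nonneg _))
    rw [mem_bohr] at hb ⊢
    intro γ hγ
    refine (hb γ (by rw [hΓ']; exact mem_union_left _ hγ)).trans ?_
    calc r ≤ k*ε^5 := hr2
      _ = (k*ε^4)*ε := by ring
      _ ≤ (k*ε^4)*1 := by gcongr
      _ ≤ 2*(k*ε*ε*ε*ε) := by nlinarith only [show 0 < k*ε^4 by positivity]
end KM
section KM
variable {G : Type*} [AddCommGroup G] [Fintype G] [DecidableEq G]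

lemma km_step (Γ : Finset (AddChar G ℂ)) (X Y Z : Finset G) (ρ1 κ1 ρ2 κ2 αX αY : ℝ) (Λ l m n1 : ℕ)
    (hΛ : 6 ≤ Λ) (hl : l = 512*Λ^2) (hm : m = 4*l*(8000*l)^2) (hn : n1 = 8*m*l)
    (hd : #Γ + n1 + 1 ≤ 2^n1) (h1 : Reg n1 Γ ρ1 κ1) (h2 : Reg n1 Γ ρ2 κ2) (h12 : ρ2 + κ2 ≤ κ1)
    (hκ2 : κ2 ≤ 1) (hX : X ⊆ Bohr Γ ρ1) (hY : Y ⊆ Bohr Γ ρ1) (hZ : Z ⊆ Bohr Γ ρ2)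
    (hαX : αX = #X/#(Bohr Γ ρ1)) (hαY : αY = #Y/#(Bohr Γ ρ1)) (hX0 : (1/2)^Λ ≤ αX) (hY0 : (1/2)^Λ ≤ αY)
    (hZ0 : (1/2)^Λ * (#(Bohr Γ ρ2):ℝ) ≤ #Z) (hD : 4 * 4^Λ ≤ (#(Bohr Γ ρ1) : ℝ))
    (hsol : ∑ z ∈ Z, cnv (ind X) (ind Y) z ≤ #Z) :
    ∃ Γ' : Finset (AddChar G ℂ), #Γ' ≤ #Γ + n1 ∧ ∃ r, Reg n1 Γ' r (κ2 * ((1/2)^(4*n1))^7) ∧ r ≤ 1 ∧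
      ∃ t, 1.005 * αX * #(Bohr Γ' r) ≤ #((Bohr Γ' r).filter (fun b => t + b ∈ X)) ∨
        1.005 * αY * #(Bohr Γ' r) ≤ #((Bohr Γ' r).filter (fun b => t + b ∈ Y)) := by
  have hl512 : 512*6 ≤ l := by rw [hl]; nlinarith only [hΛ]
  have hm1 : 1 ≤ m := by rw [hm]; exact Nat.mul_pos (by omega) (by positivity)
  have hn1l : 8*l ≤ n1 := by rw [hn]; nlinarith only [hm1, hl512]
  have hlΛ : 512*Λ ≤ l := by rw [hl]; nlinarith only [hΛ]
  set ε : ℝ := (1/2)^(4*n1) with hε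
  have hε0 : 0 < ε := by positivity
  have hε2 : ε ≤ 1 := pow_le_one₀ (by norm_num) (by norm_num)
  obtain ⟨ρ3, hρ1, hρ2, h3⟩ := exists_reg n1 Γ h2.2.1 (by omega) (by omega)
  rw [← hε] at h3
  have hκ3 : κ2 * ε ≤ κ2 := mul_le_of_le_one_right h2.2.1.le hε2
  have hX00 : 0 < αX := lt_of_lt_of_le (by positivity) hX0
  have hY00 : 0 < αY := lt_of_lt_of_le (by positivity) hY0
  have hη : 8 * (1/2:ℝ)^(2*n1) ≤ (1/2)^Λ := by
    calc 8 * (1/2:ℝ)^(2*n1) ≤ 8 * (1/2)^(Λ+3) := by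
          have := half_le (show Λ+3 ≤ 2*n1 by omega)
          linarith only [this]
      _ = (1/2)^Λ := by rw [pow_add]; ring
  have hE0 : (0:ℝ) < #(Bohr Γ ρ2) := by exact_mod_cast card_pos.2 ⟨0, bohr_zero h2.1.le⟩
  have hZne : Z.Nonempty := by
    rw [← card_pos]
    have : (0:ℝ) < #Z := lt_of_lt_of_le (by positivity) hZ0
    exact_mod_cast this
  have hinv : ∀ s ∈ Bohr Γ (2*κ1), (#((Bohr Γ ρ1).filter (fun x => x + s ∉ Bohr Γ ρ1)) : ℝ) ≤
      (1/2)^(2*n1) * #(Bohr Γ ρ1) := fun s hs => h1.shift hs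
  have hcase := km_dens X Y Z (Bohr Γ ρ1) (Bohr Γ ρ2) (Bohr Γ ρ3) (Bohr Γ (ρ2+ρ3)) hX hY hZ αX αY
    ((1/2)^(2*n1)) (αX * #X) (αY * #Y) (2*Λ) (even_two_mul Λ) hαX hαY rfl rfl hX00 hY00 hZne
    ⟨0, bohr_zero h3.1.le⟩ (by
      intro z hz
      have hz' : -z ∈ Bohr Γ (2*κ1) := bohr_mono (by linarith only [h12, h2.1, h2.2.1]) (bohr_neg hz)
      have := hinv _ hz'
      refine le_trans (le_of_eq ?_) this
      congr 2
      apply filter_congr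
      intro x _
      rw [not_iff_not]
      constructor
      · intro h; have := bohr_neg h; simpa [sub_eq_add_neg] using this
      · intro h; have := bohr_neg h; simpa [sub_eq_add_neg] using this)
    (fun z hz v hv => bohr_sub hz hv) (h2.two (by linarith only [hρ2, h2.2.1])) hsol (by positivity)
    (hη.trans hX0) (hη.trans hY0) (by
      have a1 : (1/2:ℝ)^Λ * (1/2)^Λ ≤ αX * αY := by gcongr
      have a2 : (1/2:ℝ)^Λ * (1/2)^Λ * 4^Λ = 1 := by rw [← mul_pow, ← mul_pow]; norm_num
      calc (4:ℝ) = (1/2:ℝ)^Λ * (1/2)^Λ * (4 * 4^Λ) := by linarith only [a2]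
        _ ≤ _ := mul_le_mul a1 hD (by positivity) (by positivity)) (by
      have a1 : (2:ℝ) ≤ 4^(2*Λ) * (1/2)^Λ := by
        rw [pow_mul, ← mul_pow]
        calc (2:ℝ) ≤ 8^1 := by norm_num
          _ ≤ 8^Λ := pow_le_pow_right₀ (by norm_num) (by omega)
          _ = _ := by norm_num
      calc 2 * (#(Bohr Γ ρ2):ℝ) ≤ 4^(2*Λ) * (1/2)^Λ * #(Bohr Γ ρ2) := by gcongr
        _ = 4^(2*Λ) * ((1/2)^Λ * #(Bohr Γ ρ2)) := by ring
        _ ≤ _ := by gcongr)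
  have e7 : κ2 * ε * ε^6 = κ2 * ε^7 := by ring
  rcases hcase with hc | hc
  · obtain ⟨Γ', g1, r, g2, g3, t, g4⟩ := km_case Γ (Bohr Γ ρ1) X (ρ2+ρ3) (κ2*ε) αX (αX * #X) Λ l m n1
      (2*Λ) (64*(2*Λ)) hΛ hl hm hn rfl rfl (by linarith only [h2.1, h3.1]) h3.2.1 (by linarith) hd hX hαX hX0 rfl
      (fun v hv v' hv' => hinv _ (bohr_mono (by linarith only [hρ2, h12]) (bohr_sub hv hv')))
      (by
        rw [add_assoc]
        refine (h2.two (by linarith only [hρ2, hκ3])).trans ?_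
        have := card_le_card (bohr_mono (Γ := Γ) (show ρ2 ≤ ρ2+ρ3 by linarith only [h3.1]))
        have : (#(Bohr Γ ρ2):ℝ) ≤ #(Bohr Γ (ρ2+ρ3)) := by exact_mod_cast this
        linarith only [this]) hc
    rw [← hε, e7] at g2
    exact ⟨Γ', g1, r, g2, g3, t, Or.inl g4⟩
  · obtain ⟨Γ', g1, r, g2, g3, t, g4⟩ := km_case Γ (Bohr Γ ρ1) Y ρ3 (κ2*ε) αY (αY * #Y) Λ l m n1
      (2*Λ) (64*(2*Λ)) hΛ hl hm hn rfl rfl h3.1.le h3.2.1 (by linarith) hd hY hαY hY0 rfl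
      (fun v hv v' hv' => hinv _ (bohr_mono (by linarith only [hρ2, h12, h2.1]) (bohr_sub hv hv')))
      (h3.two (by linarith only [h3.2.1])) hc
    rw [← hε, e7] at g2
    exact ⟨Γ', g1, r, g2, g3, t, Or.inr g4⟩
end KM

lemma Reg.mono {G : Type*} [AddCommGroup G] [Fintype G] [DecidableEq G] {n1 : ℕ}
    {Γ : Finset (AddChar G ℂ)} {r κ κ' : ℝ} (h : Reg n1 Γ r κ) (h0 : 0 < κ') (hκ : κ' ≤ κ) :
    Reg n1 Γ r κ' :=
  ⟨h.1, h0, le_trans (by exact_mod_cast card_le_card (bohr_mono (by linarith))) h.2.2⟩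

lemma km_avg {G : Type*} [AddCommGroup G] [Fintype G] [DecidableEq G] {n1 : ℕ}
    {Γ : Finset (AddChar G ℂ)} {r κ α : ℝ} (h : Reg n1 Γ r κ) (A S : Finset G) (hS : S ⊆ Bohr Γ (2*κ))
    (t : G) (hA : α * #(Bohr Γ r) ≤ #((Bohr Γ r).filter (fun b => t + b ∈ A))) :
    #S * ((α - (1/2)^(2*n1)) * #(Bohr Γ r)) ≤
      ∑ b ∈ Bohr Γ r, (#(S.filter (fun s => t + b + s ∈ A)) : ℝ) := by
  have e : ∑ b ∈ Bohr Γ r, (#(S.filter (fun s => t + b + s ∈ A)) : ℝ) =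
      ∑ s ∈ S, (#((Bohr Γ r).filter (fun b => t + b + s ∈ A)) : ℝ) := by
    simp only [card_filter, Nat.cast_sum]
    exact sum_comm
  rw [e, ← nsmul_eq_mul, ← sum_const]
  apply sum_le_sum
  intro s hs
  have h1 := h.shift (bohr_neg (hS hs))
  have h2 : #((Bohr Γ r).filter (fun b => t + b ∈ A)) ≤
      #((Bohr Γ r).filter (fun x => x + -s ∉ Bohr Γ r)) + #((Bohr Γ r).filter (fun b => t + b + s ∈ A)) := by
    have a1 : (Bohr Γ r).filter (fun b => t + b ∈ A) ⊆ ((Bohr Γ r).filter (fun x => x + -s ∉ Bohr Γ r)) ∪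
        ((Bohr Γ r).filter (fun b => t + b + s ∈ A)).image (fun b => b + s) := by
      intro b hb
      rw [mem_filter] at hb
      by_cases hc : b + -s ∈ Bohr Γ r
      · apply mem_union_right
        rw [mem_image]
        refine ⟨b + -s, mem_filter.2 ⟨hc, ?_⟩, by abel⟩
        have : t + (b + -s) + s = t + b := by abel
        rw [this]; exact hb.2
      · exact mem_union_left _ (mem_filter.2 ⟨hb.1, hc⟩)
    exact (card_le_card a1).trans ((card_union_le _ _).trans (Nat.add_le_add_left card_image_le _))
  have h3 : (#((Bohr Γ r).filter (fun b => t + b ∈ A)):ℝ) ≤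
      #((Bohr Γ r).filter (fun x => x + -s ∉ Bohr Γ r)) + #((Bohr Γ r).filter (fun b => t + b + s ∈ A)) := by
    exact_mod_cast h2
  linarith only [h1, h3, hA]

section ZM
variable {P : ℕ} [Fact P.Prime]

noncomputable def dil (u : ZMod P) (Γ : Finset (AddChar (ZMod P) ℂ)) : Finset (AddChar (ZMod P) ℂ) :=
  open scoped Classical in Γ.image (fun γ => γ.mulShift u)

lemma dil_card (u : ZMod P) (Γ : Finset (AddChar (ZMod P) ℂ)) : #(dil u Γ) ≤ #Γ := card_image_le

lemma mem_dil {u : ZMod P} {Γ : Finset (AddChar (ZMod P) ℂ)} {r : ℝ} {x : ZMod P} :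
    x ∈ Bohr (dil u Γ) r ↔ u * x ∈ Bohr Γ r := by
  simp [mem_bohr, dil, AddChar.mulShift_apply]

lemma dil_filter {u : ZMod P} (hu : u ≠ 0) (Γ : Finset (AddChar (ZMod P) ℂ)) (r : ℝ)
    (Q : ZMod P → Prop) [DecidablePred Q] :
    #((Bohr (dil u Γ) r).filter Q) = #((Bohr Γ r).filter (fun x => Q (u⁻¹ * x))) := by
  apply card_bij (fun s _ => u * s)
  · intro s hs
    rw [mem_filter] at hs ⊢
    rw [inv_mul_cancel_left₀ hu]
    exact ⟨mem_dil.1 hs.1, hs.2⟩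
  · intro a _ b _ h; exact mul_left_cancel₀ hu h
  · intro x hx
    rw [mem_filter] at hx
    refine ⟨u⁻¹ * x, mem_filter.2 ⟨mem_dil.2 ?_, hx.2⟩, mul_inv_cancel_left₀ hu x⟩
    rw [mul_inv_cancel_left₀ hu]; exact hx.1

lemma bohr_dil_card {u : ZMod P} (hu : u ≠ 0) (Γ : Finset (AddChar (ZMod P) ℂ)) (r : ℝ) :
    #(Bohr (dil u Γ) r) = #(Bohr Γ r) := by
  have := dil_filter hu Γ r (fun _ => True)
  simpa using this

lemma Reg.dil {u : ZMod P} (hu : u ≠ 0) {Γ : Finset (AddChar (ZMod P) ℂ)} {n1 : ℕ} {r κ : ℝ}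
    (h : Reg n1 Γ r κ) : Reg n1 (dil u Γ) r κ := by
  unfold Reg
  rw [bohr_dil_card hu, bohr_dil_card hu]
  exact h

lemma bohr_nat {Γ : Finset (AddChar (ZMod P) ℂ)} {r : ℝ} {x : ZMod P} (hx : x ∈ Bohr Γ r) (n : ℕ) :
    (n:ZMod P) * x ∈ Bohr Γ (n * r) := by
  induction n with
  | zero => simp [bohr_zero]
  | succ n ih =>
    have := bohr_add ih hx
    push_cast
    rw [add_mul, add_mul, one_mul, one_mul]
    exact this

lemma bohr_int {Γ : Finset (AddChar (ZMod P) ℂ)} {r : ℝ} {x : ZMod P} (hx : x ∈ Bohr Γ r) (n : ℤ)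
    {R : ℝ} (hR : |(n:ℝ)| * r ≤ R) : (n:ZMod P) * x ∈ Bohr Γ R := by
  refine bohr_mono hR ?_
  obtain ⟨k, rfl | rfl⟩ := n.eq_nat_or_neg
  · have := bohr_nat hx k
    simpa using this
  · have := bohr_neg (bohr_nat hx k)
    simpa using this

def St (A : Finset (ZMod P)) (n1 d : ℕ) (κ α : ℝ) : Prop :=
  ∃ Γ : Finset (AddChar (ZMod P) ℂ), #Γ ≤ d ∧ ∃ r t, Reg n1 Γ r κ ∧
    α * #(Bohr Γ r) ≤ #((Bohr Γ r).filter (fun b => t + b ∈ A))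

lemma cnv_le_one {G : Type*} [AddCommGroup G] [Fintype G] [DecidableEq G] (X Y : Finset G) (z x0 : G)
    (h : ∀ x ∈ X, z - x ∈ Y → x = x0) : cnv (ind X) (ind Y) z ≤ 1 := by
  unfold cnv
  rw [sum_eq_single x0]
  · exact mul_le_one₀ (ind_le_one _ _) (ind_nonneg _ _) (ind_le_one _ _)
  · intro x _ hx
    by_cases h1 : x ∈ X
    · by_cases h2 : z - x ∈ Y
      · exact absurd (h x h1 h2) hx
      · simp [ind, h2]
    · simp [ind, h1]
  · simp

lemma km_zmod (A : Finset (ZMod P)) (c1 c2 c3 : ℤ) (hc : c1 + c2 + c3 = 0)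
    (h1 : (c1 : ZMod P) ≠ 0) (h2 : (c2 : ZMod P) ≠ 0) (h3 : (c3 : ZMod P) ≠ 0)
    (hA : ∀ x ∈ A, ∀ y ∈ A, ∀ z ∈ A, (c1:ZMod P) * x + c2 * y + c3 * z = 0 → x = z)
    (Λ l m n1 d : ℕ) (κ α ε : ℝ)
    (hΛ : 6 ≤ Λ) (hl : l = 512*Λ^2) (hm : m = 4*l*(8000*l)^2) (hn : n1 = 8*m*l)
    (hε : ε = (1/2)^(4*n1)) (hC1 : |(c2*c3:ℝ)| * ε ≤ 1) (hC2 : |(c1*c3:ℝ)| * ε ≤ 1) (hC3 : |(c1*c2:ℝ)| * ε ≤ 1)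
    (hd : d + n1 + 1 ≤ 2^n1) (hκ : 0 < κ) (hκ1 : κ ≤ 1) (hα : 2 * (1/2)^Λ ≤ α)
    (hbig : ∀ Γ : Finset (AddChar (ZMod P) ℂ), #Γ ≤ d → 4 * 4^Λ ≤ (#(Bohr Γ (κ*ε/2)) : ℝ))
    (hst : St A n1 d κ α) : St A n1 (d+n1) (κ*ε^11) (1.001*α) := by
  have hl512 : 512*6 ≤ l := by rw [hl]; nlinarith only [hΛ]
  have hm1 : 1 ≤ m := by rw [hm]; exact Nat.mul_pos (by omega) (by positivity)
  have hn1l : 8*l ≤ n1 := by rw [hn]; nlinarith only [hm1, hl512]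
  have hlΛ : 512*Λ ≤ l := by rw [hl]; nlinarith only [hΛ]
  have hε0 : 0 < ε := by rw [hε]; positivity
  have hε2 : ε ≤ 1/2 := by
    rw [hε]; calc (1/2:ℝ)^(4*n1) ≤ (1/2)^1 := half_le (by omega)
      _ = 1/2 := by norm_num
  have hη : 3000 * (1/2:ℝ)^(2*n1) ≤ α := by
    refine le_trans ?_ hα
    calc 3000 * (1/2:ℝ)^(2*n1) ≤ 3000 * (1/2)^(12+Λ) := by
          have := half_le (show 12+Λ ≤ 2*n1 by omega)
          linarith only [this]
      _ = (3000 * (1/2)^12) * (1/2)^Λ := by rw [pow_add]; ring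
      _ ≤ 2 * (1/2)^Λ := by gcongr; norm_num
  have hα0 : 0 < α := lt_of_lt_of_le (by positivity) hα
  obtain ⟨Γ, hΓ, r, t, hreg, hdens⟩ := hst
  have hU : (c1:ZMod P) * (c2:ZMod P) * (c3:ZMod P) ≠ 0 := mul_ne_zero (mul_ne_zero h1 h2) h3
  set Δ := dil ((c1:ZMod P) * (c2:ZMod P) * (c3:ZMod P))⁻¹ Γ with hΔ
  have hΔc : #Δ ≤ d := (dil_card _ _).trans hΓ
  have h5 : 5 ≤ n1 := by omega
  obtain ⟨ρ1, a1, a2, R1⟩ := exists_reg n1 Δ (show 0 < κ*ε by positivity) h5 (by omega)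
  obtain ⟨ρ2, b1, b2, R2⟩ := exists_reg n1 Δ (show 0 < κ*ε^3 by positivity) h5 (by omega)
  rw [← hε] at R1 R2
  have hρ : ρ2 ≤ κ*ε := by
    refine b2.trans ?_
    calc κ*ε^3 = κ*ε*(ε*ε) := by ring
      _ ≤ κ*ε*1 := by gcongr; nlinarith only [hε2, hε0]
      _ = κ*ε := mul_one _
  -- inclusion
  have hincl : ∀ (u : ZMod P) (v : ℤ) (ρ : ℝ), u * (v:ZMod P) = (c1:ZMod P) * (c2:ZMod P) * (c3:ZMod P) → |(v:ℝ)| * ε ≤ 1 → ρ ≤ κ*ε →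
      Bohr (dil u Δ) ρ ⊆ Bohr Γ (2*κ) := by
    intro u v ρ huv hv hρ x hx
    have hx1 := mem_dil.1 (mem_dil.1 hx)
    have e : x = (v:ZMod P) * (((c1:ZMod P) * (c2:ZMod P) * (c3:ZMod P))⁻¹ * (u * x)) := by
      have hh : (v:ZMod P) * (((c1:ZMod P) * (c2:ZMod P) * (c3:ZMod P))⁻¹ * (u * x)) =
        ((c1:ZMod P) * (c2:ZMod P) * (c3:ZMod P))⁻¹ * (u * (v:ZMod P)) * x := by ring
      rw [hh, huv, inv_mul_cancel₀ hU, one_mul]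
    rw [e]
    apply bohr_int hx1
    have : |(v:ℝ)| * ρ ≤ |(v:ℝ)| * (κ*ε) := by gcongr
    nlinarith only [this, mul_le_mul_of_nonneg_left hv hκ.le, hκ]
  have hu3 : (-(c3:ZMod P)) ≠ 0 := neg_ne_zero.2 h3
  have hS1 := hincl c1 (c2*c3) ρ1 (by push_cast; ring) (by push_cast; exact hC1) a2
  have hS2 := hincl c2 (c1*c3) ρ1 (by push_cast; ring) (by push_cast; exact hC2) a2
  have hS3 := hincl (-c3) (-(c1*c2)) ρ2 (by push_cast; ring) (by push_cast; rw [abs_neg]; exact hC3) hρ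
  have hS1c : (0:ℝ) < #(Bohr Δ ρ1) := by exact_mod_cast card_pos.2 ⟨0, bohr_zero R1.1.le⟩
  have hS3c : (0:ℝ) < #(Bohr Δ ρ2) := by exact_mod_cast card_pos.2 ⟨0, bohr_zero R2.1.le⟩
  have hBc : (0:ℝ) < #(Bohr Γ r) := by exact_mod_cast card_pos.2 ⟨0, bohr_zero hreg.1.le⟩
  have A1 := km_avg hreg A _ hS1 t hdens
  have A2 := km_avg hreg A _ hS2 t hdens
  have A3 := km_avg hreg A _ hS3 t hdens
  rw [bohr_dil_card h1] at A1
  rw [bohr_dil_card h2] at A2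
  rw [bohr_dil_card hu3] at A3
  have hε10 : κ*ε^11 ≤ κ*ε*ε := by
    calc κ*ε^11 = κ*ε*ε*ε^9 := by ring
      _ ≤ κ*ε*ε*1 := by gcongr; exact pow_le_one₀ hε0.le (by linarith)
      _ = _ := mul_one _
  have hε11 : κ*ε^11 ≤ κ*ε^3*ε := by
    calc κ*ε^11 = κ*ε^3*ε*ε^7 := by ring
      _ ≤ κ*ε^3*ε*1 := by gcongr; exact pow_le_one₀ hε0.le (by linarith)
      _ = _ := mul_one _
  have hκ0 : 0 < κ*ε^11 := by positivity
  by_contra hno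
  have N : ∀ (u : ZMod P) (hu : u ≠ 0) (ρ κ' : ℝ), Reg n1 Δ ρ κ' → κ*ε^11 ≤ κ' → ∀ t',
      (#((Bohr (dil u Δ) ρ).filter (fun b => t' + b ∈ A)) : ℝ) ≤ 1.001 * α * #(Bohr Δ ρ) := by
    intro u hu ρ κ' hR hk t'
    by_contra! hcon
    refine hno ⟨dil u Δ, ((dil_card _ _).trans hΔc).trans (Nat.le_add_right _ _), ρ, t', (hR.dil hu).mono hκ0 hk, ?_⟩
    rw [bohr_dil_card hu]; exact hcon.le
  have N1 := N c1 h1 ρ1 _ R1 hε10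
  have N2 := N c2 h2 ρ1 _ R1 hε10
  have N3 := N (-c3) hu3 ρ2 _ R2 hε11
  obtain ⟨b, hb, hsum⟩ : ∃ b ∈ Bohr Γ r, 3 * (α - (1/2)^(2*n1)) ≤
      (#((Bohr (dil (c1:ZMod P) Δ) ρ1).filter (fun s => t + b + s ∈ A)) : ℝ) / #(Bohr Δ ρ1) +
      (#((Bohr (dil (c2:ZMod P) Δ) ρ1).filter (fun s => t + b + s ∈ A)) : ℝ) / #(Bohr Δ ρ1) +
      (#((Bohr (dil (-c3:ZMod P) Δ) ρ2).filter (fun s => t + b + s ∈ A)) : ℝ) / #(Bohr Δ ρ2) := by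
    apply exists_le_of_sum_le (⟨0, bohr_zero hreg.1.le⟩ : (Bohr Γ r).Nonempty)
    rw [sum_add_distrib, sum_add_distrib, ← sum_div, ← sum_div, ← sum_div, sum_const, nsmul_eq_mul]
    have B1 := (le_div_iff₀' hS1c).2 A1
    have B2 := (le_div_iff₀' hS1c).2 A2
    have B3 := (le_div_iff₀' hS3c).2 A3
    linarith only [B1, B2, B3]
  have D1 := (div_le_iff₀ hS1c).2 (N1 (t+b))
  have D2 := (div_le_iff₀ hS1c).2 (N2 (t+b))
  have D3 := (div_le_iff₀ hS3c).2 (N3 (t+b))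
  rw [dil_filter h1] at hsum D1
  rw [dil_filter h2] at hsum D2
  rw [dil_filter hu3] at hsum D3
  set t' := t + b with ht'
  set X := (Bohr Δ ρ1).filter (fun x => t' + (c1:ZMod P)⁻¹ * x ∈ A) with hX
  set Y := (Bohr Δ ρ1).filter (fun x => t' + (c2:ZMod P)⁻¹ * x ∈ A) with hY
  set Z := (Bohr Δ ρ2).filter (fun x => t' + (-c3:ZMod P)⁻¹ * x ∈ A) with hZ
  have E1 : 0.997 * α ≤ (#X:ℝ)/#(Bohr Δ ρ1) := by linarith only [hsum, D2, D3, hη]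
  have E2 : 0.997 * α ≤ (#Y:ℝ)/#(Bohr Δ ρ1) := by linarith only [hsum, D1, D3, hη]
  have E3 : 0.997 * α ≤ (#Z:ℝ)/#(Bohr Δ ρ2) := by linarith only [hsum, D1, D2, hη]
  have hcs : (c1:ZMod P) + c2 + c3 = 0 := by exact_mod_cast congrArg (Int.cast : ℤ → ZMod P) hc
  have hsol : ∑ z ∈ Z, cnv (ind X) (ind Y) z ≤ #Z := by
    rw [card_eq_sum_ones, Nat.cast_sum]
    apply sum_le_sum
    intro z hz
    rw [Nat.cast_one]
    apply cnv_le_one X Y z (c1 * ((-c3:ZMod P)⁻¹ * z))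
    intro x hx hy
    have q1 := (mem_filter.1 hx).2
    have q2 := (mem_filter.1 hy).2
    have q3 := (mem_filter.1 hz).2
    have := hA _ q1 _ q2 _ q3 (by
      rw [inv_neg]
      field_simp
      linear_combination t' * hcs)
    have h9 := add_left_cancel this
    rw [← h9, mul_inv_cancel_left₀ h1]
  have hΛα : (1/2)^Λ ≤ 0.997 * α := by
    have : (0:ℝ) < (1/2)^Λ := by positivity
    linarith only [this, hα]
  obtain ⟨Γ', g1, r', g2, g3, s, g4⟩ := km_step Δ X Y Z ρ1 (κ*ε*ε) ρ2 (κ*ε^3*ε) _ _ Λ l m n1 hΛ hl hm hn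
    (by omega) R1 R2 (by
      have : κ*ε*ε*ε ≤ κ*ε*ε*(1/2) := by gcongr
      have : κ*ε*ε*ε*ε ≤ κ*ε*ε*(1/2)*(1/2) := by gcongr
      have : 0 < κ*ε*ε := by positivity
      nlinarith) (by
      calc κ*ε^3*ε = κ*ε^4 := by ring
        _ ≤ 1*1 := by gcongr; exact pow_le_one₀ hε0.le (by linarith)
        _ = 1 := by norm_num)
    (filter_subset _ _) (filter_subset _ _) (filter_subset _ _) rfl rfl (hΛα.trans E1) (hΛα.trans E2)
    (by have := hΛα.trans E3
        rwa [le_div_iff₀ hS3c] at this)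
    ((hbig Δ hΔc).trans (by exact_mod_cast card_le_card (bohr_mono a1))) hsol
  rw [← hε, show κ*ε^3*ε*ε^7 = κ*ε^11 by ring] at g2
  have fin : ∀ (u : ZMod P) (hu : u ≠ 0) (W : Finset (ZMod P)), (∀ x ∈ W, t' + u⁻¹ * x ∈ A) →
      0.997 * α ≤ (#W:ℝ)/#(Bohr Δ ρ1) →
      1.005 * ((#W:ℝ)/#(Bohr Δ ρ1)) * #(Bohr Γ' r') ≤ #((Bohr Γ' r').filter (fun b => s + b ∈ W)) → False := by
    intro u hu W hW hWd hh
    refine hno ⟨dil u Γ', (dil_card _ _).trans (g1.trans (Nat.add_le_add_right hΔc _)), r', t' + u⁻¹ * s, g2.dil hu, ?_⟩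
    rw [bohr_dil_card hu, dil_filter hu]
    have i1 : (#((Bohr Γ' r').filter (fun b => s + b ∈ W)) : ℝ) ≤
        #((Bohr Γ' r').filter (fun x => t' + u⁻¹ * s + u⁻¹ * x ∈ A)) := by
      have : (Bohr Γ' r').filter (fun b => s + b ∈ W) ⊆
          (Bohr Γ' r').filter (fun x => t' + u⁻¹ * s + u⁻¹ * x ∈ A) := by
        intro x hx
        rw [mem_filter] at hx ⊢
        refine ⟨hx.1, ?_⟩
        rw [add_assoc, ← mul_add]; exact hW _ hx.2
      exact_mod_cast card_le_card this
    refine le_trans ?_ (hh.trans i1)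
    have : (0:ℝ) ≤ #(Bohr Γ' r') := Nat.cast_nonneg _
    apply mul_le_mul_of_nonneg_right _ this
    linarith only [hWd, hα0]
  rcases g4 with g4 | g4
  · exact fin c1 h1 X (fun x hx => (mem_filter.1 hx).2) E1 g4
  · exact fin c2 h2 Y (fun x hx => (mem_filter.1 hx).2) E2 g4
end ZM

lemma sq_lt_two_pow' (n : ℕ) (hn : 5 ≤ n) : n*n + 1 ≤ 2^n := by
  induction n, hn using Nat.le_induction with
  | base => norm_num
  | succ n hn ih => rw [pow_succ]; nlinarith only [ih, hn]

lemma km_iter {P : ℕ} [Fact P.Prime] (A : Finset (ZMod P)) (c1 c2 c3 : ℤ) (hc : c1 + c2 + c3 = 0)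
    (h1 : (c1 : ZMod P) ≠ 0) (h2 : (c2 : ZMod P) ≠ 0) (h3 : (c3 : ZMod P) ≠ 0)
    (hA : ∀ x ∈ A, ∀ y ∈ A, ∀ z ∈ A, (c1:ZMod P) * x + c2 * y + c3 * z = 0 → x = z)
    (Λ l m n1 J : ℕ) (ε : ℝ)
    (hΛ : 6 ≤ Λ) (hl : l = 512*Λ^2) (hm : m = 4*l*(8000*l)^2) (hn : n1 = 8*m*l) (hJ : J = 700*Λ)
    (hε : ε = (1/2)^(4*n1)) (hC1 : |(c2*c3:ℝ)| * ε ≤ 1) (hC2 : |(c1*c3:ℝ)| * ε ≤ 1) (hC3 : |(c1*c2:ℝ)| * ε ≤ 1)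
    (hP : 4*4^Λ*81^(J*n1*(4*n1*(11*J+1)+2)) ≤ P) :
    (#A : ℝ) < 2 * (1/2)^Λ * P := by
  by_contra! hcon
  have hP0 : (0:ℝ) < P := by exact_mod_cast (Fact.out : P.Prime).pos
  set α : ℝ := 2 * (1/2)^Λ with hα
  have hα0 : 0 < α := by positivity
  have hl512 : 512*Λ ≤ l := by rw [hl]; nlinarith only [hΛ]
  have hm1 : 1 ≤ m := by rw [hm]; exact Nat.mul_pos (by omega) (by rw [sq]; exact Nat.mul_pos (by omega) (by omega))
  have hn1l : 8*l ≤ n1 := by rw [hn]; nlinarith only [hm1, hl512]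
  have hJn : J ≤ n1 := by omega
  have hε0 : 0 < ε := by rw [hε]; positivity
  have hε2 : ε ≤ 1 := by rw [hε]; exact pow_le_one₀ (by norm_num) (by norm_num)
  have key : ∀ j, j ≤ J → St A n1 (j*n1) (ε^(11*j)) (1.001^j * α) := by
    intro j
    induction j with
    | zero =>
      intro _
      have hb : ∀ r, Bohr (∅ : Finset (AddChar (ZMod P) ℂ)) r = univ := by intro r; ext x; simp [mem_bohr]
      refine ⟨∅, by simp, 1, 0, ⟨by norm_num, by simp, ?_⟩, ?_⟩
      · rw [hb, hb]
        have : (0:ℝ) ≤ (1/2)^(2*n1) := by positivity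
        have : (0:ℝ) ≤ #(univ : Finset (ZMod P)) := Nat.cast_nonneg _
        nlinarith
      · rw [hb]
        have : (univ.filter (fun b => (0:ZMod P) + b ∈ A)) = A := by ext; simp
        rw [this, card_univ, ZMod.card]
        simpa using hcon
    | succ j ih =>
      intro hj
      have ih := ih (by omega)
      have hpw : (1:ℝ) ≤ 1.001^j := one_le_pow₀ (by norm_num)
      have := km_zmod A c1 c2 c3 hc h1 h2 h3 hA Λ l m n1 (j*n1) (ε^(11*j)) (1.001^j*α) ε hΛ hl hm hn hε hC1 hC2 hC3
        (by
          have : (j+1)*n1 ≤ n1*n1 := Nat.mul_le_mul_right _ (by omega)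
          have h5 := sq_lt_two_pow' n1 (by omega)
          have e : (j+1)*n1 = j*n1+n1 := by ring
          omega)
        (by positivity) (pow_le_one₀ hε0.le hε2)
        (by nlinarith only [hpw, hα0]) (by
          intro Γ hΓ
          have hs := bohr_size Γ (4*n1*(11*J+1)+1)
          rw [ZMod.card] at hs
          have hΓJ : #Γ ≤ J*n1 := hΓ.trans (Nat.mul_le_mul_right _ (by omega))
          have hp : 81^(#Γ*(4*n1*(11*J+1)+1+1)) ≤ 81^(J*n1*(4*n1*(11*J+1)+2)) :=
            Nat.pow_le_pow_right (by norm_num) (Nat.mul_le_mul_right _ hΓJ)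
          have hr : (1/2:ℝ)^(4*n1*(11*J+1)+1) ≤ ε^(11*j)*ε/2 := by
            rw [pow_succ, pow_mul, ← hε, ← pow_succ]
            have : ε^(11*J+1) ≤ ε^(11*j+1) := pow_le_pow_of_le_one hε0.le hε2 (by omega)
            linarith only [this]
          have hle : 4*4^Λ ≤ #(Bohr Γ ((1/2)^(4*n1*(11*J+1)+1))) := by
            have hpos : 0 < 81^(J*n1*(4*n1*(11*J+1)+2)) := by positivity
            have h7 := (hP.trans hs).trans (Nat.mul_le_mul_right _ hp)
            rw [mul_comm (4*4^Λ)] at h7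
            exact Nat.le_of_mul_le_mul_left h7 hpos
          have h8 : 4*4^Λ ≤ #(Bohr Γ (ε^(11*j)*ε/2)) := hle.trans (card_le_card (bohr_mono hr))
          exact_mod_cast h8) ih
      have e1 : (j+1)*n1 = j*n1+n1 := by ring
      have e2 : ε^(11*(j+1)) = ε^(11*j)*ε^11 := by ring
      have e3 : (1.001:ℝ)^(j+1)*α = 1.001*(1.001^j*α) := by ring
      rw [e1, e2, e3]; exact this
  obtain ⟨Γ, -, r, t, hreg, hd⟩ := key J le_rfl
  have hBc : (0:ℝ) < #(Bohr Γ r) := by exact_mod_cast card_pos.2 ⟨0, bohr_zero hreg.1.le⟩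
  have h9 : (#((Bohr Γ r).filter (fun b => t + b ∈ A)) : ℝ) ≤ #(Bohr Γ r) := by
    exact_mod_cast card_le_card (filter_subset _ _)
  have h10 : 2 ≤ (1.001:ℝ)^J*α := by
    have e : (1.001:ℝ)^J = (1.001^700)^Λ := by rw [hJ, pow_mul]
    have h700 : (2:ℝ) ≤ 1.001^700 := by
      have i1 : (1.0724:ℝ) ≤ 1.001^70 := by norm_num
      calc (2:ℝ) ≤ 1.0724^10 := by norm_num
        _ ≤ (1.001^70)^10 := pow_le_pow_left₀ (by norm_num) i1 _
        _ = 1.001^700 := by rw [← pow_mul]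
    have h11 : (2:ℝ)^Λ ≤ 1.001^J := by rw [e]; exact pow_le_pow_left₀ (by norm_num) h700 _
    calc (2:ℝ) = 2^Λ * α := by rw [hα]; rw [mul_left_comm, ← mul_pow]; norm_num
      _ ≤ _ := mul_le_mul_of_nonneg_right h11 hα0.le
  nlinarith only [h10, h9, hd, hBc]

/-- Kelley–Meka for a prime modulus. -/
lemma km_prime : ∃ C : ℕ, ∀ Λ : ℕ, 6 ≤ Λ → ∀ (P : ℕ) [Fact P.Prime], 2^(C*Λ^18) ≤ P →
    ∀ (A : Finset (ZMod P)) (c1 c2 c3 : ℤ), c1 + c2 + c3 = 0 →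
    (c1 : ZMod P) ≠ 0 → (c2 : ZMod P) ≠ 0 → (c3 : ZMod P) ≠ 0 →
    |(c2*c3:ℝ)| ≤ 2^Λ → |(c1*c3:ℝ)| ≤ 2^Λ → |(c1*c2:ℝ)| ≤ 2^Λ →
    2 * (1/2)^Λ * P ≤ (#A:ℝ) →
    ∃ x ∈ A, ∃ y ∈ A, ∃ z ∈ A, (c1:ZMod P) * x + c2 * y + c3 * z = 0 ∧ x ≠ z := by
  obtain ⟨b, hb⟩ : ∃ b : ℕ, b = 8*(4*512*(8000*512)^2)*512 := ⟨_, rfl⟩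
  refine ⟨4 + 7*(700*b*(4*b*7701+2)), ?_⟩
  intro Λ hΛ P _ hP A c1 c2 c3 hc h1 h2 h3 k1 k2 k3 hA
  by_contra! hno
  have hn : b*Λ^8 = 8*(4*(512*Λ^2)*(8000*(512*Λ^2))^2)*(512*Λ^2) := by rw [hb]; ring
  have hn1 : Λ ≤ 4*(b*Λ^8) := by
    have : 1 ≤ b := by rw [hb]; norm_num
    calc Λ = 1*Λ^1 := by ring
      _ ≤ (4*b)*Λ^8 := Nat.mul_le_mul (by omega) (Nat.pow_le_pow_right (by omega) (by norm_num))
      _ = _ := by ring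
  have hk : ∀ x : ℝ, x ≤ 2^Λ → x * (1/2)^(4*(b*Λ^8)) ≤ 1 := by
    intro x hx
    calc x * (1/2)^(4*(b*Λ^8)) ≤ 2^Λ * (1/2)^Λ := mul_le_mul hx (half_le hn1) (by positivity) (by positivity)
      _ = 1 := by rw [← mul_pow]; norm_num
  refine absurd hA (not_le.2 (km_iter A c1 c2 c3 hc h1 h2 h3 hno Λ (512*Λ^2) _ (b*Λ^8) (700*Λ) _ hΛ rfl rfl hn rfl rfl
    (hk _ k1) (hk _ k2) (hk _ k3) (le_trans ?_ hP)))
  have p81 : 81^(700*Λ*(b*Λ^8)*(4*(b*Λ^8)*(11*(700*Λ)+1)+2)) ≤ 2^(7*(700*Λ*(b*Λ^8)*(4*(b*Λ^8)*(11*(700*Λ)+1)+2))) := by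
    rw [pow_mul 2 7]; exact Nat.pow_le_pow_left (by norm_num) _
  have p4 : 4*4^Λ = 2^(2+2*Λ) := by rw [pow_add, pow_mul]; norm_num
  calc _ ≤ 2^(2+2*Λ) * 2^(7*(700*Λ*(b*Λ^8)*(4*(b*Λ^8)*(11*(700*Λ)+1)+2))) := by
        rw [p4]; exact Nat.mul_le_mul_left _ p81
    _ = 2^(2+2*Λ + 7*(700*Λ*(b*Λ^8)*(4*(b*Λ^8)*(11*(700*Λ)+1)+2))) := by rw [← pow_add]
    _ ≤ _ := by
      apply Nat.pow_le_pow_right (by norm_num)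
      have g1 : 1 ≤ Λ := by omega
      have q0 : 2+2*Λ ≤ 4*Λ^18 := by
        have : Λ^1 ≤ Λ^18 := Nat.pow_le_pow_right (by omega) (by norm_num)
        rw [pow_one] at this
        omega
      have q1 : 4*(b*Λ^8)*(11*(700*Λ)+1)+2 ≤ (4*b*7701+2)*Λ^9 := by
        have i1 : 1 ≤ Λ^9 := Nat.one_le_pow _ _ (by omega)
        have i2 : 11*(700*Λ)+1 ≤ 7701*Λ := by omega
        calc _ ≤ 4*(b*Λ^8)*(7701*Λ)+2*Λ^9 := Nat.add_le_add (Nat.mul_le_mul_left _ i2) (by omega)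
          _ = _ := by ring
      have q2 := Nat.mul_le_mul_left (700*Λ*(b*Λ^8)) q1
      have e : 700*Λ*(b*Λ^8)*((4*b*7701+2)*Λ^9) = 700*b*(4*b*7701+2)*Λ^18 := by ring
      rw [e] at q2
      have e2 : (4 + 7*(700*b*(4*b*7701+2)))*Λ^18 = 4*Λ^18 + 7*(700*b*(4*b*7701+2)*Λ^18) := by ring
      rw [e2]
      omega

lemma km_int (c1 c2 c3 : ℤ) (hc : c1 + c2 + c3 = 0) (h1 : c1 ≠ 0) (h2 : c2 ≠ 0) (h3 : c3 ≠ 0) (K : ℕ) :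
    ∃ N0 : ℕ, ∀ N : ℕ, N0 ≤ N → ∀ A : Finset ℕ, A ⊆ Icc 1 N → (N:ℝ) / (Real.log N)^K ≤ #A →
      ∃ x ∈ A, ∃ y ∈ A, ∃ z ∈ A, c1 * (x:ℤ) + c2 * y + c3 * z = 0 ∧ x ≠ z := by
  obtain ⟨C, hC⟩ := km_prime
  obtain ⟨M, hM⟩ : ∃ M : ℕ, M = c1.natAbs + c2.natAbs + c3.natAbs + 1 := ⟨_, rfl⟩
  have ev1 : ∀ᶠ y : ℝ in Filter.atTop, (C:ℝ) * (2*K+3)^18 * (Real.log y)^18 ≤ y := by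
    have := (Real.isLittleO_pow_log_id_atTop (n := 18)).def (c := ((C:ℝ) * (2*K+3)^18 + 1)⁻¹) (by positivity)
    filter_upwards [this, Filter.eventually_ge_atTop 1] with y hy hy1
    rw [Real.norm_of_nonneg (pow_nonneg (Real.log_nonneg hy1) _), id, Real.norm_of_nonneg (by linarith),
      inv_mul_eq_div, le_div_iff₀ (by positivity)] at hy
    have : 0 ≤ (Real.log y)^18 := pow_nonneg (Real.log_nonneg hy1) _
    nlinarith only [hy, this]
  have ev : ∀ᶠ y : ℝ in Filter.atTop, (C:ℝ) * (2*K+3)^18 * (Real.log y)^18 ≤ y ∧ Real.exp 3 ≤ y ∧ 4*(M:ℝ)^2 ≤ y :=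
    ev1.and ((Filter.eventually_ge_atTop _).and (Filter.eventually_ge_atTop _))
  have evN := (Real.tendsto_log_atTop.comp tendsto_natCast_atTop_atTop).eventually ev
  obtain ⟨N0, hN0⟩ := Filter.eventually_atTop.1 evN
  refine ⟨N0 + 1, fun N hN A hA hcard => ?_⟩
  obtain ⟨e1, e2, e3⟩ := hN0 N (by omega)
  simp only [Function.comp] at e1 e2 e3
  set y := Real.log N with hy
  have hN1 : 1 ≤ N := by omega
  have hNpos : (0:ℝ) < N := by exact_mod_cast hN1
  have hM1 : 1 ≤ M := by omega
  have hM1r : (1:ℝ) ≤ M := by exact_mod_cast hM1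
  have hy0 : 0 < y := lt_of_lt_of_le (Real.exp_pos _) e2
  have hly : 3 ≤ Real.log y := (Real.le_log_iff_exp_le hy0).2 e2
  have hyM : (M:ℝ)^2 ≤ y := by nlinarith only [e3, hM1r]
  have hy1 : 1 ≤ y := by nlinarith only [e3, hM1r]
  set Λ := ⌈2*(K+1)*Real.log y⌉₊ with hΛ
  have hΛl : 2*(K+1)*Real.log y ≤ Λ := Nat.le_ceil _
  have hΛu : (Λ:ℝ) ≤ (2*K+3)*Real.log y := by
    have := Nat.ceil_lt_add_one (show 0 ≤ 2*(K+1)*Real.log y by positivity)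
    rw [← hΛ] at this
    linarith only [this, hly]
  have hK0 : (0:ℝ) ≤ K := Nat.cast_nonneg _
  have hΛ6 : 6 ≤ Λ := by
    have : (6:ℝ) ≤ Λ := by nlinarith only [hΛl, hly, hK0, mul_nonneg hK0 (by linarith only [hly] : 0 ≤ Real.log y)]
    exact_mod_cast this
  have h2Λ : y^(K+1) ≤ 2^Λ := by
    have l2 : 1/2 ≤ Real.log 2 := by linarith only [Real.log_two_gt_d9]
    have : (K+1:ℕ) * Real.log y ≤ Λ * Real.log 2 := by
      push_cast
      have := mul_le_mul_of_nonneg_left l2 (Nat.cast_nonneg (α := ℝ) Λ)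
      linarith only [this, hΛl]
    rw [← Real.log_pow, ← Real.log_pow] at this
    exact (Real.log_le_log_iff (by positivity) (by positivity)).1 this
  have hyK : 1 ≤ y^K := one_le_pow₀ hy1
  have h2Λ' : (M:ℝ)^2 ≤ 2^Λ := by
    refine le_trans ?_ h2Λ
    rw [pow_succ y K]; nlinarith only [hyM, hyK, hy1]
  have hMN : M*N ≠ 0 := by positivity
  obtain ⟨P, hP, hPl, hPu⟩ := Nat.exists_prime_lt_and_le_two_mul (M*N) hMN
  haveI : Fact P.Prime := ⟨hP⟩
  have hNP : N < P := by nlinarith only [hPl, hM1]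
  have hcP : ∀ c : ℤ, c ≠ 0 → c.natAbs ≤ M → ((c:ℤ) : ZMod P) ≠ 0 := by
    intro c hc0 hcM h
    rw [ZMod.intCast_zmod_eq_zero_iff_dvd] at h
    apply hc0
    apply Int.eq_zero_of_abs_lt_dvd h
    rw [Int.abs_eq_natAbs]
    have : M ≤ M*N := Nat.le_mul_of_pos_right _ hN1
    exact_mod_cast (show c.natAbs < P by omega)
  have hcM : ∀ c d : ℤ, c.natAbs ≤ M → d.natAbs ≤ M → |(c*d:ℝ)| ≤ 2^Λ := by
    intro c d hc hd
    refine le_trans ?_ h2Λ'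
    rw [abs_mul, sq]
    have g : ∀ c : ℤ, c.natAbs ≤ M → |(c:ℝ)| ≤ M := by
      intro c hc
      rw [← Int.cast_abs, Int.abs_eq_natAbs]; exact_mod_cast hc
    exact mul_le_mul (g c hc) (g d hd) (abs_nonneg _) (by positivity)
  have hinj : Set.InjOn (fun n : ℕ => (n : ZMod P)) (A : Set ℕ) := by
    intro x hx z hz h
    have hx' := (mem_Icc.1 (hA hx)).2
    have hz' := (mem_Icc.1 (hA hz)).2
    have h' := (ZMod.natCast_eq_natCast_iff' _ _ _).1 h
    rwa [Nat.mod_eq_of_lt (by omega), Nat.mod_eq_of_lt (by omega)] at h'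
  have hbigP : 2^(C*Λ^18) ≤ P := by
    have : (2:ℝ)^(C*Λ^18) ≤ P := by
      have hp : (Λ:ℝ)^18 ≤ ((2*K+3)*Real.log y)^18 := pow_le_pow_left₀ (Nat.cast_nonneg _) hΛu _
      rw [mul_pow] at hp
      have h9 : ((C*Λ^18:ℕ):ℝ) * Real.log 2 ≤ y := by
        have l2 : Real.log 2 ≤ 1 := by linarith only [Real.log_two_lt_d9]
        have a0 : (0:ℝ) ≤ ((C*Λ^18:ℕ):ℝ) := Nat.cast_nonneg _
        have a1 : ((C*Λ^18:ℕ):ℝ) ≤ y := by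
          push_cast
          refine le_trans ?_ e1
          rw [mul_assoc]
          exact mul_le_mul_of_nonneg_left hp (Nat.cast_nonneg _)
        nlinarith only [l2, a0, a1]
      rw [← Real.log_pow, hy] at h9
      have := (Real.log_le_log_iff (by positivity) hNpos).1 h9
      exact this.trans (by exact_mod_cast hNP.le)
    exact_mod_cast this
  have hdens : 2 * (1/2)^Λ * (P:ℝ) ≤ #(A.image (fun n : ℕ => (n : ZMod P))) := by
    rw [card_image_of_injOn hinj]
    refine le_trans ?_ hcard
    have hPu' : (P:ℝ) ≤ 2*(M*N) := by exact_mod_cast hPu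
    have hMle : 4*(M:ℝ) ≤ y := by nlinarith only [e3, hM1r]
    have h3 : 4*M*y^K ≤ 2^Λ := by
      refine le_trans ?_ h2Λ
      rw [pow_succ, mul_comm]
      exact mul_le_mul_of_nonneg_left hMle (by linarith only [hyK])
    rw [le_div_iff₀ (by linarith only [hyK])]
    have hyK0 : 0 < y^K := by linarith only [hyK]
    have e : (1/2:ℝ)^Λ * 2^Λ = 1 := by rw [← mul_pow]; norm_num
    have hh0 : (0:ℝ) < (1/2)^Λ := by positivity
    calc 2 * (1/2)^Λ * (P:ℝ) * y^K ≤ 2 * (1/2)^Λ * (2*(M*N)) * y^K := by gcongr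
      _ = (1/2)^Λ * (4*M*y^K) * N := by ring
      _ ≤ (1/2)^Λ * 2^Λ * N := by gcongr
      _ = N := by rw [e, one_mul]
  obtain ⟨x', hx, y', hy', z', hz, heq, hne⟩ := hC Λ hΛ6 P hbigP _ c1 c2 c3 hc (hcP c1 h1 (by omega)) (hcP c2 h2 (by omega))
    (hcP c3 h3 (by omega)) (hcM _ _ (by omega) (by omega)) (hcM _ _ (by omega) (by omega)) (hcM _ _ (by omega) (by omega)) hdens
  obtain ⟨x, hx1, rfl⟩ := mem_image.1 hx
  obtain ⟨w, hw, rfl⟩ := mem_image.1 hy'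
  obtain ⟨z, hz1, rfl⟩ := mem_image.1 hz
  refine ⟨x, hx1, w, hw, z, hz1, ?_, fun h => hne (by rw [h])⟩
  have hdv : (P:ℤ) ∣ c1 * (x:ℤ) + c2 * w + c3 * z := by
    rw [← ZMod.intCast_zmod_eq_zero_iff_dvd]
    push_cast; exact heq
  apply Int.eq_zero_of_abs_lt_dvd hdv
  have b1 : ∀ (c : ℤ) (x : ℕ), x ∈ A → |c * x| ≤ c.natAbs * N := by
    intro c x hx
    rw [abs_mul, Int.abs_eq_natAbs, Nat.abs_cast]
    have := (mem_Icc.1 (hA hx)).2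
    exact mul_le_mul_of_nonneg_left (by exact_mod_cast this) (Nat.cast_nonneg _)
  have t1 := abs_add_le (c1 * (x:ℤ) + c2 * w) (c3 * z)
  have t2 := abs_add_le (c1 * (x:ℤ)) (c2 * w)
  have hPl' : (M:ℤ)*N < P := by exact_mod_cast hPl
  have hMz : (M:ℤ) = c1.natAbs + c2.natAbs + c3.natAbs + 1 := by rw [hM]; push_cast; rfl
  have hNz : (0:ℤ) ≤ N := Nat.cast_nonneg _
  rw [hMz] at hPl'
  linarith only [t1, t2, b1 c1 x hx1, b1 c2 w hw, b1 c3 z hz1, hPl', hNz]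

noncomputable def bS (cap : ℕ → ℕ) (x : ℕ → ℝ) : List ℕ → ℕ → ℝ
  | [], _ => 1
  | p :: l, c => bS cap x l c - (if c + 1 ≤ cap p then x p * bS cap x l (c+1) else 0)

noncomputable def bV (x : ℕ → ℝ) (l : List ℕ) : ℝ := (l.map (fun p => 1 - x p)).prod

noncomputable def bR (cap : ℕ → ℕ) (k : ℝ) : List ℕ → ℕ → ℝ
  | [], _ => 1
  | p :: l, c => bR cap k l c + (if c + 1 ≤ cap p then k * bR cap k l (c+1) else 0)

lemma bV_cons (x : ℕ → ℝ) (p : ℕ) (l : List ℕ) : bV x (p :: l) = (1 - x p) * bV x l := by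
  simp [bV]

lemma bV_nonneg (x : ℕ → ℝ) (l : List ℕ) (h : ∀ p ∈ l, x p ≤ 1) : 0 ≤ bV x l := by
  unfold bV
  apply List.prod_nonneg
  intro a ha
  obtain ⟨p, hp, rfl⟩ := List.mem_map.1 ha
  linarith only [h p hp]

lemma bV_le_filter (x : ℕ → ℝ) (l : List ℕ) (h : ∀ p ∈ l, 0 ≤ x p ∧ x p ≤ 1) (q : ℕ → Prop) [DecidablePred q] :
    bV x l ≤ bV x (l.filter (fun p => decide (q p))) := by
  induction l with
  | nil => simp
  | cons p l ih =>
    have ih := ih (fun a ha => h a (List.mem_cons_of_mem _ ha))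
    obtain ⟨h0, h1⟩ := h p List.mem_cons_self
    have hv := bV_nonneg x l (fun a ha => (h a (List.mem_cons_of_mem _ ha)).2)
    by_cases hq : q p
    · rw [List.filter_cons_of_pos (by simpa using hq), bV_cons, bV_cons]
      exact mul_le_mul_of_nonneg_left ih (by linarith only [h1])
    · rw [List.filter_cons_of_neg (by simpa using hq), bV_cons]
      nlinarith only [ih, hv, h0]

lemma bS_bound (cap : ℕ → ℕ) (x : ℕ → ℝ) (l : List ℕ) : ∀ c, (∀ p ∈ l, 0 ≤ x p ∧ x p ≤ 1) →
    (∀ p ∈ l, Odd (cap p)) → l.Pairwise (fun p q => cap p ≤ cap q) → (∀ p ∈ l, c ≤ cap p) →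
    (Even c → bS cap x l c ≤ bV x l) ∧ (Odd c → bV x l ≤ bS cap x l c) := by
  induction l with
  | nil => intro c _ _ _ _; simp [bS, bV]
  | cons p l ih =>
    intro c hx ho hpw hc
    have hx' := fun a ha => hx a (List.mem_cons_of_mem p ha)
    have ho' := fun a ha => ho a (List.mem_cons_of_mem p ha)
    have hc' := fun a ha => hc a (List.mem_cons_of_mem p ha)
    rw [List.pairwise_cons] at hpw
    obtain ⟨h0, h1⟩ := hx p List.mem_cons_self
    have hop := ho p List.mem_cons_self
    have hcp := hc p List.mem_cons_self
    have i1 := ih c hx' ho' hpw.2 hc'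
    have hv := bV_nonneg x l (fun a ha => (hx' a ha).2)
    rw [bV_cons]
    simp only [bS]
    refine ⟨fun he => ?_, fun hodd => ?_⟩
    · have hlt : c + 1 ≤ cap p := by
        rcases hcp.lt_or_eq with h | h
        · exact h
        · rw [← h] at hop; exact absurd he (Nat.not_even_iff_odd.2 hop)
      rw [if_pos hlt]
      have i2 := (ih (c+1) hx' ho' hpw.2 (fun a ha => hlt.trans (hpw.1 a ha))).2 he.add_one
      have i3 := i1.1 he
      nlinarith only [i2, i3, h0]
    · have i3 := i1.2 hodd
      split_ifs with hlt
      · have i2 := (ih (c+1) hx' ho' hpw.2 (fun a ha => hlt.trans (hpw.1 a ha))).1 hodd.add_one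
        nlinarith only [i2, i3, h0]
      · nlinarith only [i3, h0, hv]

noncomputable def bf (j : ℕ) (L : ℝ) : ℝ := if j = 0 then 0 else L^j / j.factorial

lemma bf_nonneg (j : ℕ) {L : ℝ} (h : 0 ≤ L) : 0 ≤ bf j L := by
  unfold bf; split_ifs
  · exact le_rfl
  · positivity

lemma bf_mono (j : ℕ) {L L' : ℝ} (h : 0 ≤ L) (h' : L ≤ L') : bf j L ≤ bf j L' := by
  unfold bf; split_ifs
  · exact le_rfl
  · gcongr

lemma bf_zero (j : ℕ) : bf j 0 = 0 := by
  unfold bf; split_ifs with h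
  · rfl
  · simp [h]

lemma bf_one (L : ℝ) : bf 1 L = L := by simp [bf]

lemma bf_step (j : ℕ) {L x : ℝ} (h : 0 ≤ L) (hx : 0 ≤ x) : bf j L + x * bf (j-1) L ≤ bf j (L + x) := by
  rcases j with _ | _ | j
  · simp [bf]
  · simp [bf]; exact hx
  · simp only [bf, Nat.add_sub_cancel, if_neg (Nat.succ_ne_zero _)]
    have hbin : L^(j+1+1) + (j+1+1:ℕ) * L^(j+1) * x ≤ (L+x)^(j+1+1) := by
      have := pow_add_mul_le_add_pow_of_sq_nonneg (a := L) (b := x) (n := j+1+1) (by positivity) (by positivity) (by positivity) (by positivity)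
      simpa using this
    have hf : ((j+1+1).factorial : ℝ) = (j+1+1:ℕ) * (j+1).factorial := by
      rw [Nat.factorial_succ (j+1)]; push_cast; ring
    have hf0 : (0:ℝ) < (j+1).factorial := by exact_mod_cast Nat.factorial_pos _
    rw [hf]
    have hj0 : (0:ℝ) < (j+1+1:ℕ) := by positivity
    have e : L^(j+1+1) / ((j+1+1:ℕ) * ((j+1).factorial:ℝ)) + x * (L^(j+1)/(j+1).factorial) =
      (L^(j+1+1) + (j+1+1:ℕ) * L^(j+1) * x) / ((j+1+1:ℕ) * ((j+1).factorial:ℝ)) := by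
      field_simp
    rw [e]
    exact div_le_div_of_nonneg_right hbin (by positivity)

noncomputable def bL (blk : ℕ → ℕ) (x : ℕ → ℝ) (n : ℕ) (l : List ℕ) : ℝ :=
  ((l.filter (fun p => decide (blk p ≤ n))).map x).sum

noncomputable def bPhi (blk : ℕ → ℕ) (x : ℕ → ℝ) (r : ℕ) (l : List ℕ) (c : ℕ) : ℝ :=
  ∑ n ∈ Icc 1 r, bV x (l.filter (fun p => decide (n < blk p))) * bf (2*n - c) (bL blk x n l)

lemma bL_nonneg (blk : ℕ → ℕ) (x : ℕ → ℝ) (n : ℕ) (l : List ℕ) (h : ∀ p ∈ l, 0 ≤ x p) : 0 ≤ bL blk x n l := by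
  unfold bL
  apply List.sum_nonneg
  intro a ha
  obtain ⟨p, hp, rfl⟩ := List.mem_map.1 ha
  exact h p (List.mem_of_mem_filter hp)

lemma bPhi_step (blk : ℕ → ℕ) (x : ℕ → ℝ) (r : ℕ) (p : ℕ) (l : List ℕ) (c : ℕ)
    (hx : ∀ q ∈ p :: l, 0 ≤ x q ∧ x q ≤ 1) (hs : ∀ q ∈ l, blk p ≤ blk q) :
    bPhi blk x r l c + x p * bPhi blk x r l (c+1) ≤ bPhi blk x r (p::l) c ∧
    (1 ≤ blk p → blk p ≤ r → c + 1 = 2 * blk p → bPhi blk x r l c + x p * bV x l ≤ bPhi blk x r (p::l) c) := by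
  have h0 := (hx p List.mem_cons_self).1
  have hx' := fun a ha => hx a (List.mem_cons_of_mem p ha)
  have hlow : ∀ n, ¬ blk p ≤ n → bL blk x n l = 0 := by
    intro n hn
    unfold bL
    rw [List.filter_eq_nil_iff.2]
    · simp
    · intro q hq; have := hs q hq; simp; omega
  have hlow' : ∀ n, ¬ blk p ≤ n → bL blk x n (p::l) = 0 := by
    intro n hn
    rw [← hlow n hn]; unfold bL
    rw [List.filter_cons_of_neg (by simpa using hn)]
  have hhi : ∀ n, blk p ≤ n → bL blk x n (p::l) = bL blk x n l + x p := by
    intro n hn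
    unfold bL
    rw [List.filter_cons_of_pos (by simpa using hn), List.map_cons, List.sum_cons, add_comm]
  have hhiV : ∀ n, blk p ≤ n → (p::l).filter (fun p => decide (n < blk p)) = l.filter (fun p => decide (n < blk p)) := by
    intro n hn
    rw [List.filter_cons_of_neg (by simp; exact hn)]
  have hV0 : ∀ n, 0 ≤ bV x (l.filter (fun p => decide (n < blk p))) := fun n =>
    bV_nonneg _ _ (fun a ha => (hx' a (List.mem_of_mem_filter ha)).2)
  have hL0 : ∀ n, 0 ≤ bL blk x n l := fun n => bL_nonneg _ _ _ _ (fun a ha => (hx' a ha).1)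
  refine ⟨?_, fun hb1 hbr hc => ?_⟩
  · unfold bPhi
    rw [mul_sum, ← sum_add_distrib]
    apply sum_le_sum
    intro n _
    by_cases hn : blk p ≤ n
    · rw [hhi n hn, hhiV n hn]
      have := mul_le_mul_of_nonneg_left (bf_step (2*n-c) (hL0 n) h0) (hV0 n)
      rw [show 2*n - c - 1 = 2*n-(c+1) by omega] at this
      linarith only [this]
    · rw [hlow n hn, hlow' n hn, bf_zero, bf_zero]; simp
  · have hmem : blk p ∈ Icc 1 r := mem_Icc.2 ⟨hb1, hbr⟩
    unfold bPhi
    rw [← add_sum_erase _ _ hmem, ← add_sum_erase (Icc 1 r) (fun n => bV x ((p::l).filter (fun p => decide (n < blk p))) * bf (2*n - c) (bL blk x n (p::l))) hmem]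
    have i1 : ∑ n ∈ (Icc 1 r).erase (blk p), bV x (l.filter (fun p => decide (n < blk p))) * bf (2*n - c) (bL blk x n l) ≤
        ∑ n ∈ (Icc 1 r).erase (blk p), bV x ((p::l).filter (fun p => decide (n < blk p))) * bf (2*n - c) (bL blk x n (p::l)) := by
      apply sum_le_sum
      intro n _
      by_cases hn : blk p ≤ n
      · rw [hhi n hn, hhiV n hn]
        exact mul_le_mul_of_nonneg_left (bf_mono _ (hL0 n) (by linarith only [h0])) (hV0 n)
      · rw [hlow n hn, hlow' n hn, bf_zero]; simp
    have i2 := bV_le_filter x l hx' (fun q => blk p < blk q)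
    rw [hhi _ le_rfl, hhiV _ le_rfl, show 2 * blk p - c = 1 by omega, bf_one, bf_one]
    nlinarith only [i1, mul_le_mul_of_nonneg_left i2 h0]

lemma bS_lower (blk : ℕ → ℕ) (x : ℕ → ℝ) (r : ℕ) (l : List ℕ) : ∀ c, (∀ p ∈ l, 0 ≤ x p ∧ x p ≤ 1) →
    (∀ p ∈ l, 1 ≤ blk p ∧ blk p ≤ r) → l.Pairwise (fun p q => blk p ≤ blk q) → (∀ p ∈ l, c ≤ 2 * blk p - 1) →
    (Even c → bV x l - bS (fun p => 2 * blk p - 1) x l c ≤ bPhi blk x r l c) ∧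
    (Odd c → bS (fun p => 2 * blk p - 1) x l c - bV x l ≤ bPhi blk x r l c) := by
  induction l with
  | nil =>
    intro c _ _ _ _
    have : 0 ≤ bPhi blk x r [] c := sum_nonneg (fun n _ => mul_nonneg (by simp [bV]) (bf_nonneg _ (by simp [bL])))
    simp [bS, bV, this]
  | cons p l ih =>
    intro c hx hb hpw hc
    have hx' := fun a ha => hx a (List.mem_cons_of_mem p ha)
    have hb' := fun a ha => hb a (List.mem_cons_of_mem p ha)
    have hc' := fun a ha => hc a (List.mem_cons_of_mem p ha)
    rw [List.pairwise_cons] at hpw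
    obtain ⟨h0, h1⟩ := hx p List.mem_cons_self
    obtain ⟨hb1, hbr⟩ := hb p List.mem_cons_self
    have hcp := hc p List.mem_cons_self
    have i1 := ih c hx' hb' hpw.2 hc'
    have hstep := bPhi_step blk x r p l c hx hpw.1
    rw [bV_cons]
    simp only [bS]
    refine ⟨fun he => ?_, fun hodd => ?_⟩
    · have hlt : c + 1 ≤ 2 * blk p - 1 := by
        obtain ⟨t, rfl⟩ := he; omega
      rw [if_pos hlt]
      have i2 := (ih (c+1) hx' hb' hpw.2 (fun a ha => by have := hpw.1 a ha; omega)).2 he.add_one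
      have i3 := i1.1 he
      nlinarith only [mul_le_mul_of_nonneg_left i2 h0, i3, hstep.1]
    · have i3 := i1.2 hodd
      split_ifs with hlt
      · have i2 := (ih (c+1) hx' hb' hpw.2 (fun a ha => by have := hpw.1 a ha; omega)).1 hodd.add_one
        nlinarith only [mul_le_mul_of_nonneg_left i2 h0, i3, hstep.1]
      · have := hstep.2 hb1 hbr (by omega)
        linarith only [this, i3]

lemma bR_nonneg (cap : ℕ → ℕ) {k : ℝ} (hk : 0 ≤ k) (l : List ℕ) : ∀ c, 0 ≤ bR cap k l c := by
  induction l with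
  | nil => intro c; simp [bR]
  | cons p l ih =>
    intro c; simp only [bR]
    split_ifs
    · exact add_nonneg (ih c) (mul_nonneg hk (ih _))
    · simpa using ih c

lemma bR_bound (cap : ℕ → ℕ) {k : ℝ} (hk : 0 ≤ k) (M : ℕ) (l : List ℕ) (hM : ∀ p ∈ l, cap p ≤ M) : ∀ c,
    bR cap k l c ≤ ∏ j ∈ Ioc c M, (1 + k * (l.countP (fun p => decide (j ≤ cap p)) : ℝ)) := by
  induction l with
  | nil => intro c; simp [bR]
  | cons p l ih =>
    have ih := ih (fun a ha => hM a (List.mem_cons_of_mem _ ha))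
    intro c
    have hcnt : ∀ j, (l.countP (fun p => decide (j ≤ cap p)) : ℝ) ≤ ((p::l).countP (fun p => decide (j ≤ cap p)) : ℝ) := by
      intro j; rw [List.countP_cons]; push_cast; split_ifs <;> simp
    have hmono : ∀ c, ∏ j ∈ Ioc c M, (1 + k * (l.countP (fun p => decide (j ≤ cap p)) : ℝ)) ≤
        ∏ j ∈ Ioc c M, (1 + k * ((p::l).countP (fun p => decide (j ≤ cap p)) : ℝ)) := by
      intro c
      apply prod_le_prod
      · intro j _; positivity
      · intro j _
        have := mul_le_mul_of_nonneg_left (hcnt j) hk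
        linarith only [this]
    simp only [bR]
    split_ifs with h
    · have hcM : c < M := lt_of_lt_of_le h (hM p List.mem_cons_self)
      have e : ∀ f : ℕ → ℝ, ∏ j ∈ Ioc c M, f j = f (c+1) * ∏ j ∈ Ioc (c+1) M, f j := by
        intro f
        rw [← Finset.insert_Ioc_add_one_left_eq_Ioc hcM, prod_insert (by simp)]
      have i1 := ih c
      have i2 := (ih (c+1)).trans (hmono (c+1))
      rw [e] at i1 ⊢
      have hz : ((p::l).countP (fun p => decide (c+1 ≤ cap p)) : ℝ) = l.countP (fun p => decide (c+1 ≤ cap p)) + 1 := by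
        rw [List.countP_cons_of_pos (by simpa using h)]; push_cast; rfl
      rw [hz]
      have i3 := mul_le_mul_of_nonneg_left (hmono (c+1)) (show 0 ≤ 1 + k * (l.countP (fun p => decide (c+1 ≤ cap p)) : ℝ) by positivity)
      have i4 := mul_le_mul_of_nonneg_left i2 hk
      linarith only [i1, i3, i4]
    · simpa using (ih c).trans (hmono c)

lemma cnt_mod (N d a : ℕ) (hd : 0 < d) : |(#((Ioc 0 N).filter (fun m => m ≡ a [MOD d])) : ℝ) - N/d| ≤ 1 := by
  have h := Nat.Ioc_filter_modEq_card 0 N hd a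
  have hd' : (0:ℚ) < d := by exact_mod_cast hd
  have hle : ⌊((0:ℕ) - (a:ℚ))/(d:ℚ)⌋ ≤ ⌊((N:ℚ) - (a:ℚ))/(d:ℚ)⌋ := by
    apply Int.floor_le_floor
    apply div_le_div_of_nonneg_right _ hd'.le
    have : (0:ℚ) ≤ N := Nat.cast_nonneg _
    push_cast; linarith only [this]
  rw [max_eq_left (by linarith only [hle])] at h
  have a1 := Int.floor_le (((0:ℕ) - (a:ℚ))/(d:ℚ))
  have a2 := Int.lt_floor_add_one (((0:ℕ) - (a:ℚ))/(d:ℚ))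
  have b1 := Int.floor_le (((N:ℚ) - (a:ℚ))/(d:ℚ))
  have b2 := Int.lt_floor_add_one (((N:ℚ) - (a:ℚ))/(d:ℚ))
  have e : ((N:ℚ) - (a:ℚ))/(d:ℚ) - ((0:ℕ) - (a:ℚ))/(d:ℚ) = N/d := by push_cast; ring
  have hq : |(#((Ioc 0 N).filter (fun m => m ≡ a [MOD d])) : ℚ) - N/d| ≤ 1 := by
    have h' : (#((Ioc 0 N).filter (fun m => m ≡ a [MOD d])) : ℚ) =
      (⌊((N:ℚ) - (a:ℚ))/(d:ℚ)⌋ : ℚ) - (⌊((0:ℕ) - (a:ℚ))/(d:ℚ)⌋ : ℚ) := by exact_mod_cast h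
    rw [h', abs_le]
    constructor <;> linarith only [a1, a2, b1, b2, e]
  have hr := (Rat.cast_le (K := ℝ)).2 hq
  push_cast at hr
  exact hr

noncomputable def xi (Rt : ℕ → Finset ℕ) (m p : ℕ) : ℝ := if m % p ∈ Rt p then 1 else 0

lemma equi (cap : ℕ → ℕ) (Rt : ℕ → Finset ℕ) (k N : ℕ) (l : List ℕ) : ∀ (c d a : ℕ), 0 < d →
    (∀ p ∈ l, Nat.Coprime d p) → l.Pairwise Nat.Coprime →
    (∀ p ∈ l, 0 < p ∧ Rt p ⊆ range p ∧ #(Rt p) ≤ k) →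
    |∑ m ∈ (Ioc 0 N).filter (fun m => m ≡ a [MOD d]), bS cap (xi Rt m) l c
      - N/d * bS cap (fun p => (#(Rt p) : ℝ)/p) l c| ≤ bR cap k l c := by
  induction l with
  | nil =>
    intro c d a hd _ _ _
    simp only [bS, bR, sum_const, nsmul_eq_mul, mul_one]
    exact cnt_mod N d a hd
  | cons p l ih =>
    intro c d a hd hcop hpw hR
    rw [List.pairwise_cons] at hpw
    have hcop' := fun q hq => hcop q (List.mem_cons_of_mem p hq)
    have hR' := fun q hq => hR q (List.mem_cons_of_mem p hq)
    obtain ⟨hp0, hsub, hk⟩ := hR p List.mem_cons_self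
    have hdp := hcop p List.mem_cons_self
    have i1 := ih c d a hd hcop' hpw.2 hR'
    simp only [bS, bR]
    split_ifs with hcap
    · rw [sum_sub_distrib]
      have key : |∑ m ∈ (Ioc 0 N).filter (fun m => m ≡ a [MOD d]), xi Rt m p * bS cap (xi Rt m) l (c+1)
          - N/d * ((#(Rt p) : ℝ)/p * bS cap (fun p => (#(Rt p) : ℝ)/p) l (c+1))| ≤ k * bR cap k l (c+1) := by
        have e1 : ∑ m ∈ (Ioc 0 N).filter (fun m => m ≡ a [MOD d]), xi Rt m p * bS cap (xi Rt m) l (c+1) =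
            ∑ ρ ∈ Rt p, ∑ m ∈ (Ioc 0 N).filter (fun m => m ≡ (Nat.chineseRemainder hdp a ρ : ℕ) [MOD d*p]), bS cap (xi Rt m) l (c+1) := by
          have e2 : ∀ ρ ∈ Rt p, (Ioc 0 N).filter (fun m => m ≡ (Nat.chineseRemainder hdp a ρ : ℕ) [MOD d*p]) =
              ((Ioc 0 N).filter (fun m => m ≡ a [MOD d])).filter (fun m => m % p = ρ) := by
            intro ρ hρ
            rw [filter_filter]
            apply filter_congr
            intro m _
            have hcr := (Nat.chineseRemainder hdp a ρ).2
            rw [← Nat.modEq_and_modEq_iff_modEq_mul hdp]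
            have hρp := mem_range.1 (hsub hρ)
            constructor
            · rintro ⟨h1, h2⟩
              refine ⟨h1.trans hcr.1, ?_⟩
              have := h2.trans hcr.2
              rw [Nat.ModEq, Nat.mod_eq_of_lt hρp] at this
              exact this
            · rintro ⟨h1, h2⟩
              refine ⟨h1.trans hcr.1.symm, ?_⟩
              have : m ≡ ρ [MOD p] := by rw [Nat.ModEq, Nat.mod_eq_of_lt hρp]; exact h2
              exact this.trans hcr.2.symm
          have e4 : ∀ ρ ∈ Rt p, ∑ m ∈ (Ioc 0 N).filter (fun m => m ≡ (Nat.chineseRemainder hdp a ρ : ℕ) [MOD d*p]), bS cap (xi Rt m) l (c+1) =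
              ∑ m ∈ (Ioc 0 N).filter (fun m => m ≡ a [MOD d]), if m % p = ρ then bS cap (xi Rt m) l (c+1) else 0 := by
            intro ρ hρ
            rw [e2 ρ hρ, sum_filter]
          rw [sum_congr rfl e4, sum_comm]
          apply sum_congr rfl
          intro m _
          rw [sum_ite_eq]
          unfold xi
          split_ifs <;> simp
        rw [e1]
        have e3 : (N:ℝ)/d * ((#(Rt p) : ℝ)/p * bS cap (fun p => (#(Rt p) : ℝ)/p) l (c+1)) =
            ∑ ρ ∈ Rt p, (N:ℝ)/(d*p:ℕ) * bS cap (fun p => (#(Rt p) : ℝ)/p) l (c+1) := by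
          rw [sum_const, nsmul_eq_mul]; push_cast
          rw [div_mul_eq_div_div]; ring
        rw [e3, ← sum_sub_distrib]
        refine (abs_sum_le_sum_abs _ _).trans ?_
        calc _ ≤ ∑ ρ ∈ Rt p, bR cap k l (c+1) := by
              apply sum_le_sum
              intro ρ hρ
              apply ih (c+1) (d*p) _ (Nat.mul_pos hd hp0) _ hpw.2 hR'
              intro q hq
              exact Nat.Coprime.mul_left (hcop' q hq) (hpw.1 q hq)
          _ = #(Rt p) * bR cap k l (c+1) := by rw [sum_const, nsmul_eq_mul]
          _ ≤ k * bR cap k l (c+1) := by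
              apply mul_le_mul_of_nonneg_right _ (bR_nonneg _ (Nat.cast_nonneg _) _ _)
              exact_mod_cast hk
      rw [abs_le] at i1 key ⊢
      constructor <;> linarith only [i1.1, i1.2, key.1, key.2]
    · simpa using i1

/-- abstract Brun lower bound -/
lemma brun_abs (blk : ℕ → ℕ) (Rt : ℕ → Finset ℕ) (k N r M W a : ℕ) (l : List ℕ) (hW : 0 < W)
    (hcop : ∀ p ∈ l, Nat.Coprime W p) (hpw : l.Pairwise Nat.Coprime)
    (hR : ∀ p ∈ l, 0 < p ∧ Rt p ⊆ range p ∧ #(Rt p) ≤ k)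
    (hb : ∀ p ∈ l, 1 ≤ blk p ∧ blk p ≤ r) (hs : l.Pairwise (fun p q => blk p ≤ blk q)) :
    (N:ℝ)/W * (bV (fun p => (#(Rt p) : ℝ)/p) l - bPhi blk (fun p => (#(Rt p) : ℝ)/p) r l 0) -
      ∏ j ∈ Ioc 0 (2*r-1), (1 + k * (l.countP (fun p => decide (j ≤ 2*blk p - 1)) : ℝ)) ≤
    #((Ioc 0 N).filter (fun m => m ≡ a [MOD W] ∧ ∀ p ∈ l, m % p ∉ Rt p)) := by
  have h1 := equi (fun p => 2*blk p - 1) Rt k N l 0 W a hW hcop hpw hR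
  have h2 := bR_bound (fun p => 2*blk p - 1) (Nat.cast_nonneg (α := ℝ) k) (2*r-1) l
    (fun p hp => by have := (hb p hp).2; omega) 0
  have hg : ∀ p ∈ l, 0 ≤ (#(Rt p) : ℝ)/p ∧ (#(Rt p) : ℝ)/p ≤ 1 := by
    intro p hp
    obtain ⟨h0, h1, _⟩ := hR p hp
    refine ⟨by positivity, ?_⟩
    have : (0:ℝ) < p := by exact_mod_cast h0
    rw [div_le_one this]
    have := card_le_card h1
    rw [card_range] at this
    exact_mod_cast this
  have h3 := (bS_lower blk (fun p => (#(Rt p) : ℝ)/p) r l 0 hg hb hs (fun p _ => Nat.zero_le _)).1 (by simp)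
  have h4 : ∑ m ∈ (Ioc 0 N).filter (fun m => m ≡ a [MOD W]), bS (fun p => 2*blk p - 1) (xi Rt m) l 0 ≤
      #((Ioc 0 N).filter (fun m => m ≡ a [MOD W] ∧ ∀ p ∈ l, m % p ∉ Rt p)) := by
    rw [← filter_filter, card_filter, Nat.cast_sum]
    apply sum_le_sum
    intro m _
    have h5 := (bS_bound (fun p => 2*blk p - 1) (xi Rt m) l 0
      (fun p _ => by unfold xi; split_ifs <;> norm_num)
      (fun p hp => ⟨blk p - 1, by have := (hb p hp).1; omega⟩)
      (hs.imp (fun h => by omega)) (fun p _ => Nat.zero_le _)).1 (by simp)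
    refine h5.trans ?_
    split_ifs with hm
    · unfold bV
      rw [Nat.cast_one]
      apply le_of_eq
      apply List.prod_eq_one
      intro y hy
      obtain ⟨p, hp, rfl⟩ := List.mem_map.1 hy
      simp [xi, hm p hp]
    · push Not at hm
      obtain ⟨p, hp, hpm⟩ := hm
      unfold bV
      rw [List.prod_eq_zero]
      · simp
      · exact List.mem_map.2 ⟨p, hp, by simp [xi, hpm]⟩
  have hNW : (0:ℝ) ≤ (N:ℝ)/W := by positivity
  have h6 := mul_le_mul_of_nonneg_left h3 hNW
  rw [abs_le] at h1
  linarith only [h1.1, h2, h4, h6]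

noncomputable def prA (n : ℕ) : ℝ := ∑ p ∈ (range (n+1)).filter Nat.Prime, Real.log p / p

lemma log_fac (n : ℕ) : Real.log (n.factorial) =
    ∑ p ∈ (range (n+1)).filter Nat.Prime, (padicValNat p n.factorial : ℝ) * Real.log p := by
  rw [Real.log_nat_eq_sum_factorization, Finsupp.sum]
  have hs : (n.factorial).factorization.support ⊆ (range (n+1)).filter Nat.Prime := by
    intro p hp
    rw [Nat.support_factorization, Nat.mem_primeFactors] at hp
    rw [mem_filter, mem_range]
    exact ⟨Nat.lt_succ_of_le ((hp.1.dvd_factorial).1 hp.2.1), hp.1⟩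
  rw [sum_subset hs]
  · apply sum_congr rfl
    intro p hp
    rw [Nat.factorization_def _ (mem_filter.1 hp).2]
  · intro p _ hp
    rw [Finsupp.notMem_support_iff.1 hp]; simp

lemma mertens1 : ∃ C : ℝ, 0 ≤ C ∧ ∀ n : ℕ, 1 ≤ n → Real.log n - C ≤ prA n ∧ prA n ≤ Real.log n + C := by
  have hsum : Summable (fun n : ℕ => 4 * (n:ℝ)^(-(3/2):ℝ)) :=
    (Real.summable_nat_rpow.2 (by norm_num)).mul_left 4
  set C0 := ∑' n : ℕ, 4 * (n:ℝ)^(-(3/2):ℝ) with hC0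
  have hC00 : 0 ≤ C0 := tsum_nonneg (fun n => by positivity)
  refine ⟨C0 + 2, by linarith, fun n hn => ?_⟩
  have hn0 : (0:ℝ) < n := by exact_mod_cast hn
  have hfac := log_fac n
  constructor
  · -- lower
    have h1 : Real.log n.factorial ≤ n * (prA n + C0) := by
      have hC : ∑ p ∈ (range (n+1)).filter Nat.Prime, 4 * (p:ℝ)^(-(3/2):ℝ) ≤ C0 :=
        hsum.sum_le_tsum _ (fun i _ => by positivity)
      refine le_trans ?_ (mul_le_mul_of_nonneg_left (add_le_add_right hC (prA n)) hn0.le)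
      rw [hfac, prA, ← sum_add_distrib, mul_sum]
      apply sum_le_sum
      intro p hp
      have hpp := (mem_filter.1 hp).2
      haveI : Fact p.Prime := ⟨hpp⟩
      have h2 : (2:ℝ) ≤ p := by exact_mod_cast hpp.two_le
      have hv : ((p:ℝ) - 1) * padicValNat p n.factorial ≤ n := by
        have := sub_one_mul_padicValNat_factorial (p := p) n
        have h3 : (p-1) * padicValNat p n.factorial ≤ n := by rw [this]; exact Nat.sub_le _ _
        have h4 : (((p-1 : ℕ):ℝ)) * padicValNat p n.factorial ≤ n := by exact_mod_cast h3
        rwa [Nat.cast_sub hpp.one_le, Nat.cast_one] at h4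
      have hl0 : 0 ≤ Real.log p := Real.log_nonneg (by linarith only [h2])
      have hlog : Real.log p ≤ 2 * (p:ℝ)^(1/2:ℝ) := by
        have := Real.log_le_rpow_div (x := (p:ℝ)) (ε := 1/2) (by positivity) (by norm_num)
        linarith only [this]
      have e1 : (padicValNat p n.factorial : ℝ) ≤ n / (p-1) := by
        rw [le_div_iff₀ (by linarith only [h2])]; linarith only [hv]
      have e2 : (1:ℝ)/(p-1) ≤ 1/p + 2/p^2 := by
        rw [div_add_div _ _ (by positivity) (by positivity), div_le_div_iff₀ (by linarith only [h2]) (by positivity)]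
        nlinarith only [h2, mul_nonneg (by linarith only [h2] : (0:ℝ) ≤ p) (by linarith only [h2] : (0:ℝ) ≤ p - 2)]
      have e3 : (p:ℝ)^(-(3/2):ℝ) = (p:ℝ)^(1/2:ℝ) / p^2 := by
        rw [← Real.rpow_natCast (p:ℝ) 2, ← Real.rpow_sub (by linarith only [h2])]; norm_num
      calc (padicValNat p n.factorial : ℝ) * Real.log p ≤ n / (p-1) * Real.log p := by gcongr
        _ = n * (1/(p-1)) * Real.log p := by ring
        _ ≤ n * (1/p + 2/p^2) * Real.log p := by gcongr
        _ = n * (Real.log p / p + 2/p^2 * Real.log p) := by ring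
        _ ≤ n * (Real.log p / p + 2/p^2 * (2 * (p:ℝ)^(1/2:ℝ))) := by gcongr
        _ = _ := by rw [e3]; ring
    have h2 : n * Real.log n - n ≤ Real.log n.factorial := by
      have h5 : (n:ℝ)^n / n.factorial ≤ Real.exp n := Real.pow_div_factorial_le_exp _ hn0.le _
      have hf0 : (0:ℝ) < n.factorial := by exact_mod_cast Nat.factorial_pos _
      have h6 := Real.log_le_log (by positivity) h5
      rw [Real.log_exp, Real.log_div (by positivity) hf0.ne', Real.log_pow] at h6
      linarith only [h6]
    have h3 : (n:ℝ) * (Real.log n - 1) ≤ n * (prA n + C0) := by linarith only [h1, h2]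
    have := le_of_mul_le_mul_left h3 hn0
    linarith only [this]
  · have h1 : n * prA n - Real.log 4 * n ≤ Real.log n.factorial := by
      have ht := Chebyshev.theta_le_log4_mul_x hn0.le
      rw [Chebyshev.theta_eq_sum_Icc, Nat.floor_natCast] at ht
      have hI : (Icc 0 n).filter Nat.Prime = (range (n+1)).filter Nat.Prime := by
        congr 1; ext; simp [Nat.lt_succ_iff]
      rw [hI] at ht
      have : n * prA n - ∑ p ∈ (range (n+1)).filter Nat.Prime, Real.log p ≤ Real.log n.factorial := by
        rw [hfac, prA, mul_sum, ← sum_sub_distrib]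
        apply sum_le_sum
        intro p hp
        have hpp := (mem_filter.1 hp).2
        haveI : Fact p.Prime := ⟨hpp⟩
        have hp0 : (0:ℝ) < p := by exact_mod_cast hpp.pos
        have hl0 : 0 ≤ Real.log p := Real.log_nonneg (by exact_mod_cast hpp.one_le)
        have hv : n / p ≤ padicValNat p n.factorial := by
          rw [padicValNat_factorial (b := Nat.log p n + 2) (by omega)]
          have := single_le_sum (f := fun i => n / p^i) (s := Ico 1 (Nat.log p n + 2)) (fun _ _ => Nat.zero_le _) (mem_Ico.2 ⟨le_rfl, by omega⟩)
          simpa using this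
        have hv' : (n:ℝ)/p - 1 ≤ padicValNat p n.factorial := by
          have h7 : (n:ℝ)/p < (n/p : ℕ) + 1 := by
            rw [← Nat.floor_div_eq_div (K := ℝ)]; exact Nat.lt_floor_add_one _
          have h8 : ((n/p:ℕ):ℝ) ≤ padicValNat p n.factorial := by exact_mod_cast hv
          linarith only [h7, h8]
        calc (n:ℝ) * (Real.log p / p) - Real.log p = ((n:ℝ)/p - 1) * Real.log p := by ring
          _ ≤ _ := mul_le_mul_of_nonneg_right hv' hl0
      linarith only [this, ht]
    have h2 : Real.log n.factorial ≤ n * Real.log n := by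
      rw [← Real.log_pow]
      apply Real.log_le_log (by exact_mod_cast Nat.factorial_pos _)
      exact_mod_cast Nat.factorial_le_pow n
    have h4 : Real.log 4 ≤ 2 := by
      rw [show (4:ℝ) = 2^2 by norm_num, Real.log_pow]
      have := Real.log_two_lt_d9
      push_cast; linarith only [this]
    have h3 : (n:ℝ) * prA n ≤ n * (Real.log n + Real.log 4) := by linarith only [h1, h2]
    have := le_of_mul_le_mul_left h3 hn0
    linarith only [this, h4, hC00]

noncomputable def prT (b a : ℝ) : Finset ℕ := (range (⌊Real.exp b⌋₊+1)).filter (fun p => p.Prime ∧ a < Real.log p)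

lemma mem_prT {b a : ℝ} {p : ℕ} : p ∈ prT b a ↔ p.Prime ∧ a < Real.log p ∧ Real.log p ≤ b := by
  unfold prT
  rw [mem_filter, mem_range, Nat.lt_succ_iff, Nat.le_floor_iff (Real.exp_pos _).le]
  constructor
  · rintro ⟨h1, h2, h3⟩
    exact ⟨h2, h3, (Real.log_le_iff_le_exp (by exact_mod_cast h2.pos)).2 h1⟩
  · rintro ⟨h1, h2, h3⟩
    exact ⟨(Real.log_le_iff_le_exp (by exact_mod_cast h1.pos)).1 h3, h1, h2⟩

lemma mertens_block : ∃ C : ℝ, 0 ≤ C ∧ ∀ a b : ℝ, 0 < a → a ≤ b → ∑ p ∈ prT b a, 1/(p:ℝ) ≤ (b - a + C)/a := by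
  obtain ⟨C, hC0, hC⟩ := mertens1
  refine ⟨2*C + 1, by linarith, fun a b ha hab => ?_⟩
  have hea : 1 ≤ Real.exp a := Real.one_le_exp ha.le
  have heb : 1 ≤ Real.exp b := Real.one_le_exp (by linarith)
  have hfa : 1 ≤ ⌊Real.exp a⌋₊ := Nat.le_floor (by simpa using hea)
  have hfb : 1 ≤ ⌊Real.exp b⌋₊ := Nat.le_floor (by simpa using heb)
  have h1 := (hC _ hfa).1
  have h2 := (hC _ hfb).2
  have l1 : Real.log ⌊Real.exp b⌋₊ ≤ b := by
    rw [Real.log_le_iff_le_exp (by exact_mod_cast hfb)]; exact Nat.floor_le (by positivity)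
  have l2 : a - 1 ≤ Real.log ⌊Real.exp a⌋₊ := by
    rw [Real.le_log_iff_exp_le (by exact_mod_cast hfa), Real.exp_sub]
    have h3 := Nat.lt_floor_add_one (Real.exp a)
    have h4 : (1:ℝ) ≤ ⌊Real.exp a⌋₊ := by exact_mod_cast hfa
    have h5 : 2 ≤ Real.exp 1 := by linarith only [Real.exp_one_gt_d9]
    rw [div_le_iff₀ (by positivity)]
    nlinarith only [h3, h4, h5]
  have hsplit : prA ⌊Real.exp b⌋₊ = prA ⌊Real.exp a⌋₊ + ∑ p ∈ prT b a, Real.log p / p := by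
    unfold prA
    rw [← sum_union]
    · apply sum_congr _ (fun _ _ => rfl)
      ext p
      rw [mem_union, mem_prT, mem_filter, mem_filter, mem_range, mem_range, Nat.lt_succ_iff, Nat.lt_succ_iff,
        Nat.le_floor_iff (by positivity), Nat.le_floor_iff (by positivity)]
      constructor
      · rintro ⟨h, hp⟩
        have hp0 : (0:ℝ) < p := by exact_mod_cast hp.pos
        rw [← Real.log_le_iff_le_exp hp0] at h ⊢
        rcases le_or_gt (Real.log p) a with h' | h'
        · exact Or.inl ⟨h', hp⟩
        · exact Or.inr ⟨hp, h', h⟩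
      · rintro (⟨h, hp⟩ | ⟨hp, _, h⟩)
        · exact ⟨h.trans (Real.exp_le_exp.2 hab), hp⟩
        · exact ⟨(Real.log_le_iff_le_exp (by exact_mod_cast hp.pos)).1 h, hp⟩
    · rw [disjoint_left]
      intro p hp hp'
      have h3 := mem_prT.1 hp'
      rw [mem_filter, mem_range, Nat.lt_succ_iff, Nat.le_floor_iff (by positivity),
        ← Real.log_le_iff_le_exp (by exact_mod_cast h3.1.pos)] at hp
      linarith only [h3.2.1, hp.1]
  rw [le_div_iff₀ ha]
  have : (∑ p ∈ prT b a, 1/(p:ℝ)) * a ≤ ∑ p ∈ prT b a, Real.log p / p := by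
    rw [sum_mul]
    apply sum_le_sum
    intro p hp
    rw [one_div_mul_eq_div]
    exact div_le_div_of_nonneg_right (mem_prT.1 hp).2.1.le (Nat.cast_nonneg _)
  linarith only [this, hsplit, h1, h2, l1, l2]

lemma prime_sum (k : ℕ) (hk : 1 ≤ k) : ∃ ω : ℝ, 0 < ω ∧ ∀ (y : ℝ) (n : ℕ), ω ≤ y * Real.exp (-(n/(2*k))) →
    k * ∑ p ∈ prT y (y * Real.exp (-(n/(2*k)))), 1/(p:ℝ) ≤ 0.5005 * n := by
  obtain ⟨C, hC0, hC⟩ := mertens_block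
  have hk' : (1:ℝ) ≤ k := by exact_mod_cast hk
  refine ⟨10^7 * k * (C+1), by positivity, fun y n hy => ?_⟩
  set ω : ℝ := 10^7 * k * (C+1) with hω
  have hω0 : 0 < ω := by positivity
  set t : ℝ := 1/(2000*k) with ht
  have ht0 : 0 < t := by positivity
  have ht1 : t ≤ 1 := by rw [ht, div_le_one (by positivity)]; linarith only [hk']
  have hy0 : 0 < y := by
    have := hω0.trans_le hy
    exact (pos_iff_pos_of_mul_pos this).2 (Real.exp_pos _)
  have key : ∀ j : ℕ, j ≤ 1000*n → ∑ p ∈ prT y (y * Real.exp (-(j*t))), 1/(p:ℝ) ≤ j * ((Real.exp t - 1) + C/ω) := by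
    intro j
    induction j with
    | zero =>
      intro _
      have : prT y (y * Real.exp (-((0:ℕ)*t))) = ∅ := by
        apply eq_empty_of_forall_notMem
        intro p hp
        have := mem_prT.1 hp
        simp at this
        linarith only [this.2]
      rw [this]; simp
    | succ j ih =>
      intro hj
      have ih := ih (by omega)
      set a := y * Real.exp (-((j+1:ℕ)*t)) with ha
      have hab : y * Real.exp (-(j*t)) = a * Real.exp t := by
        rw [ha, mul_assoc, ← Real.exp_add]; congr 2; push_cast; ring
      have haω : ω ≤ a := by
        refine hy.trans ?_
        rw [ha]
        apply mul_le_mul_of_nonneg_left _ hy0.le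
        apply Real.exp_le_exp.2
        have : ((j+1:ℕ):ℝ) ≤ 1000*n := by exact_mod_cast hj
        have h2 := mul_le_mul_of_nonneg_right this ht0.le
        have h3 : 1000*n*t = n/(2*k) := by rw [ht]; field_simp; ring
        linarith only [h2, h3]
      have ha0 : 0 < a := hω0.trans_le haω
      have het : 1 ≤ Real.exp t := Real.one_le_exp ht0.le
      have hle : a ≤ a * Real.exp t := by nlinarith only [ha0, het]
      have hb := hC a (a * Real.exp t) ha0 hle
      rw [hab] at ih
      have hsub : prT y a ⊆ prT y (a * Real.exp t) ∪ prT (a * Real.exp t) a := by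
        intro p hp
        rw [mem_union, mem_prT, mem_prT]
        obtain ⟨h1, h2, h3⟩ := mem_prT.1 hp
        rcases le_or_gt (Real.log p) (a * Real.exp t) with h' | h'
        · exact Or.inr ⟨h1, h2, h'⟩
        · exact Or.inl ⟨h1, h', h3⟩
      have h5 : ∑ p ∈ prT y a, 1/(p:ℝ) ≤ ∑ p ∈ prT y (a * Real.exp t), 1/(p:ℝ) + ∑ p ∈ prT (a * Real.exp t) a, 1/(p:ℝ) := by
        refine (sum_le_sum_of_subset_of_nonneg hsub (fun _ _ _ => by positivity)).trans ?_
        rw [← sum_union_inter]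
        exact le_add_of_nonneg_right (sum_nonneg (fun _ _ => by positivity))
      have h6 : (a * Real.exp t - a + C)/a ≤ (Real.exp t - 1) + C/ω := by
        have : (a * Real.exp t - a + C)/a = (Real.exp t - 1) + C/a := by field_simp
        rw [this]
        have := div_le_div_of_nonneg_left hC0 hω0 haω
        linarith only [this]
      push_cast
      linarith only [h5, h6, hb, ih]
  have h := key (1000*n) le_rfl
  have e : ((1000*n:ℕ):ℝ)*t = n/(2*k) := by rw [ht]; push_cast; field_simp; ring
  rw [e] at h
  have h1 : Real.exp t - 1 ≤ t + t^2 := by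
    have := Real.abs_exp_sub_one_sub_id_le (x := t) (by rw [abs_of_pos ht0]; exact ht1)
    have := (abs_le.1 this).2
    linarith only [this]
  have h2 : C/ω ≤ 1/(10^7*k) := by
    rw [hω, div_le_div_iff₀ (by positivity) (by positivity)]
    nlinarith only [hk', hC0]
  have h3 : k * (1000 * (t + t^2 + 1/(10^7*k))) ≤ 0.5005 := by
    have : k * (1000 * (t + t^2 + 1/(10^7*k))) = 0.5 + 1/(4000*k) + 0.0001 := by rw [ht]; field_simp; ring
    rw [this]
    have : 1/(4000*(k:ℝ)) ≤ 1/4000 := by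
      apply div_le_div_of_nonneg_left (by norm_num) (by norm_num); linarith only [hk']
    linarith only [this]
  have hn0 : (0:ℝ) ≤ n := Nat.cast_nonneg _
  calc k * ∑ p ∈ prT y (y * Real.exp (-(n/(2*k)))), 1/(p:ℝ) ≤ k * (((1000*n:ℕ):ℝ) * ((Real.exp t - 1) + C/ω)) := by gcongr
    _ ≤ k * (((1000*n:ℕ):ℝ) * (t + t^2 + 1/(10^7*k))) := by gcongr
    _ = (k * (1000 * (t + t^2 + 1/(10^7*k)))) * n := by push_cast; ring
    _ ≤ 0.5005 * n := by gcongr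

noncomputable def bs (n : ℕ) : ℝ := Real.exp (0.501 * n) * ((0.501*n)^(2*n) / (2*n).factorial)

lemma bs_nonneg (n : ℕ) : 0 ≤ bs n := by unfold bs; positivity

lemma exp501 : Real.exp 0.501 ≤ 1.651 := by
  have h := Real.exp_bound' (x := 0.501) (by norm_num) (by norm_num) (n := 5) (by norm_num)
  refine h.trans ?_
  norm_num [Finset.sum_range_succ, Nat.factorial]

lemma bs_le (n : ℕ) : bs n ≤ 1.651^n * ((0.501*n)^(2*n) / (2*n).factorial) := by
  unfold bs
  apply mul_le_mul_of_nonneg_right _ (by positivity)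
  rw [mul_comm, Real.exp_nat_mul]
  exact pow_le_pow_left₀ (Real.exp_pos _).le exp501 n

lemma bs_step (n : ℕ) (hn : 4 ≤ n) : bs (n+1) ≤ 0.86 * bs n := by
  have hn' : (4:ℝ) ≤ n := by exact_mod_cast hn
  have hn0 : (0:ℝ) < n := by linarith
  have h1 : ((n:ℝ)+1)^(2*n) ≤ 7.4 * n^(2*n) := by
    have h2 : 1 + 1/(n:ℝ) ≤ Real.exp (1/n) := by linarith [Real.add_one_le_exp (1/(n:ℝ))]
    have h3 := pow_le_pow_left₀ (by positivity) h2 (2*n)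
    rw [← Real.exp_nat_mul] at h3
    have e : ((2*n:ℕ):ℝ) * (1/n) = 1 + 1 := by push_cast; field_simp; norm_num
    rw [e, Real.exp_add] at h3
    have h4 := Real.exp_one_lt_d9
    have h5 := Real.exp_pos 1
    have h6 : ((n:ℝ)+1)^(2*n) = (1+1/(n:ℝ))^(2*n) * n^(2*n) := by
      rw [← mul_pow]; congr 1; field_simp
    rw [h6]
    apply mul_le_mul_of_nonneg_right _ (by positivity)
    nlinarith only [h3, h4, h5]
  have hE := exp501
  unfold bs
  have e1 : Real.exp (0.501 * ((n+1:ℕ):ℝ)) = Real.exp (0.501*n) * Real.exp 0.501 := by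
    rw [← Real.exp_add]; push_cast; ring_nf
  have e2 : ((2*(n+1)).factorial : ℝ) = (2*n+2)*(2*n+1) * (2*n).factorial := by
    rw [show 2*(n+1) = 2*n+1+1 by ring, Nat.factorial_succ, Nat.factorial_succ]; push_cast; ring
  have hf : (0:ℝ) < (2*n).factorial := by exact_mod_cast Nat.factorial_pos _
  rw [e1, e2]
  have e3 : (0.501*((n+1:ℕ):ℝ))^(2*(n+1)) = 0.501^(2*n) * (n+1)^(2*n) * (0.501^2*(n+1)^2) := by
    push_cast; rw [show 2*(n+1) = 2*n+2 by ring, pow_add, mul_pow, mul_pow]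
  rw [e3, mul_pow]
  have e4 : Real.exp (0.501*n) * Real.exp 0.501 * (0.501^(2*n) * (n+1)^(2*n) * (0.501^2*(n+1)^2) / ((2*n+2)*(2*n+1) * (2*n).factorial))
    = (Real.exp (0.501*n) * (0.501^(2*n)/ (2*n).factorial)) * ((Real.exp 0.501 * (0.501^2/2) * ((n+1)/(2*n+1))) * ((n:ℝ)+1)^(2*n)) := by
    field_simp
  have e5 : 0.86 * (Real.exp (0.501*n) * (0.501^(2*n) * (n:ℝ)^(2*n) / (2*n).factorial)) =
    (Real.exp (0.501*n) * (0.501^(2*n)/ (2*n).factorial)) * (0.86 * n^(2*n)) := by ring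
  rw [e4, e5]
  apply mul_le_mul_of_nonneg_left _ (by positivity)
  have h7 : ((n:ℝ)+1)/(2*n+1) ≤ 5/9 := by
    rw [div_le_div_iff₀ (by positivity) (by norm_num)]; linarith
  have h8 : Real.exp 0.501 * (0.501^2/2) * (((n:ℝ)+1)/(2*n+1)) ≤ 1.651*(0.501^2/2)*(5/9) := by gcongr
  calc _ ≤ (1.651*(0.501^2/2)*(5/9)) * (7.4 * (n:ℝ)^(2*n)) := by gcongr
    _ ≤ _ := by
      rw [← mul_assoc]
      apply mul_le_mul_of_nonneg_right _ (by positivity)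
      norm_num

lemma bs_sum (r : ℕ) : ∑ n ∈ Icc 1 r, bs n ≤ 0.75 := by
  have h4 : ∑ n ∈ Icc 1 4, bs n + 6.2 * bs 4 ≤ 0.75 := by
    have h1 := bs_le 1
    have h2 := bs_le 2
    have h3 := bs_le 3
    have h4 := bs_le 4
    norm_num [Nat.factorial] at h1 h2 h3 h4
    have : ∑ n ∈ Icc 1 4, bs n = bs 1 + bs 2 + bs 3 + bs 4 := by
      simp [Finset.sum_Icc_succ_top]
    rw [this]
    linarith only [h1, h2, h3, h4]
  have key : ∀ r, 4 ≤ r → ∑ n ∈ Icc 1 r, bs n + 6.2 * bs r ≤ 0.75 := by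
    intro r hr
    induction r, hr using Nat.le_induction with
    | base => exact h4
    | succ m hm ih =>
      rw [Finset.sum_Icc_succ_top (by omega)]
      have := bs_step m hm
      linarith only [this, ih, bs_nonneg m]
  have hr : ∑ n ∈ Icc 1 r, bs n ≤ ∑ n ∈ Icc 1 (max r 4), bs n :=
    sum_le_sum_of_subset_of_nonneg (Icc_subset_Icc_right (le_max_left _ _)) (fun i _ _ => bs_nonneg i)
  have := key (max r 4) (le_max_right _ _)
  linarith only [hr, this, bs_nonneg (max r 4)]

lemma bV_split (x : ℕ → ℝ) (blk : ℕ → ℕ) (n : ℕ) (l : List ℕ) :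
    bV x l = bV x (l.filter (fun p => decide (blk p ≤ n))) * bV x (l.filter (fun p => decide (n < blk p))) := by
  induction l with
  | nil => simp [bV]
  | cons p l ih =>
    rw [bV_cons, ih]
    by_cases h : blk p ≤ n
    · rw [List.filter_cons_of_pos (by simpa using h), List.filter_cons_of_neg (by simpa using h), bV_cons]; ring
    · rw [List.filter_cons_of_neg (by simpa using h), List.filter_cons_of_pos (by simpa using h), bV_cons]; ring

lemma bV_exp (x : ℕ → ℝ) (l : List ℕ) (h : ∀ p ∈ l, 0 ≤ x p ∧ x p ≤ 1/2001) :
    Real.exp (-(1.0005 * (l.map x).sum)) ≤ bV x l := by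
  induction l with
  | nil => simp [bV]
  | cons p l ih =>
    have ih := ih (fun a ha => h a (List.mem_cons_of_mem _ ha))
    obtain ⟨h0, h1⟩ := h p List.mem_cons_self
    rw [bV_cons, List.map_cons, List.sum_cons, mul_add, neg_add, Real.exp_add]
    apply mul_le_mul _ ih (Real.exp_pos _).le (by linarith only [h1])
    rw [Real.exp_neg, inv_le_comm₀ (Real.exp_pos _) (by linarith only [h1])]
    have := Real.add_one_le_exp (1.0005 * x p)
    refine le_trans ?_ this
    rw [inv_le_iff_one_le_mul₀ (by linarith only [h1])]
    nlinarith only [h0, h1]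

lemma phi_bound (blk : ℕ → ℕ) (x : ℕ → ℝ) (r : ℕ) (l : List ℕ) (h : ∀ p ∈ l, 0 ≤ x p ∧ x p ≤ 1/2001)
    (hs : ∀ n, n ≤ r → bL blk x n l ≤ 0.5005 * n) (hb : ∀ p ∈ l, blk p ≤ r) :
    bPhi blk x r l 0 ≤ 0.75 * bV x l ∧ Real.exp (-r) ≤ bV x l := by
  have hv0 : 0 ≤ bV x l := bV_nonneg x l (fun p hp => by linarith only [(h p hp).2])
  constructor
  · have key : ∀ n ∈ Icc 1 r, bV x (l.filter (fun p => decide (n < blk p))) * bf (2*n - 0) (bL blk x n l) ≤ bs n * bV x l := by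
      intro n hn
      rw [mem_Icc] at hn
      have h1 := bV_exp x (l.filter (fun p => decide (blk p ≤ n))) (fun p hp => h p (List.mem_of_mem_filter hp))
      have h2 := hs n hn.2
      have hL0 : 0 ≤ bL blk x n l := bL_nonneg _ _ _ _ (fun p hp => (h p hp).1)
      have h3 : Real.exp (-(0.501*n)) ≤ bV x (l.filter (fun p => decide (blk p ≤ n))) := by
        refine le_trans (Real.exp_le_exp.2 ?_) h1
        unfold bL at h2
        have : (0:ℝ) ≤ n := Nat.cast_nonneg n
        linarith only [h2, this]
      have h4 : bV x (l.filter (fun p => decide (n < blk p))) ≤ Real.exp (0.501*n) * bV x l := by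
        rw [bV_split x blk n l, ← mul_assoc]
        apply le_mul_of_one_le_left
        · exact bV_nonneg _ _ (fun p hp => by linarith only [(h p (List.mem_of_mem_filter hp)).2])
        · rw [Real.exp_neg, inv_le_iff_one_le_mul₀ (Real.exp_pos _)] at h3
          linarith only [h3]
      have h5 : bf (2*n-0) (bL blk x n l) ≤ (0.501*n)^(2*n) / (2*n).factorial := by
        have : (0:ℝ) ≤ n := Nat.cast_nonneg n
        refine (bf_mono _ hL0 (h2.trans (show (0.5005:ℝ)*n ≤ 0.501*n by linarith only [this]))).trans ?_
        unfold bf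
        rw [if_neg (by omega)]; simp
      calc _ ≤ (Real.exp (0.501*n) * bV x l) * ((0.501*n)^(2*n) / (2*n).factorial) :=
            mul_le_mul h4 h5 (bf_nonneg _ hL0) (by positivity)
        _ = _ := by unfold bs; ring
    refine (sum_le_sum key).trans ?_
    rw [← sum_mul]
    exact mul_le_mul_of_nonneg_right (bs_sum r) hv0
  · refine le_trans (Real.exp_le_exp.2 ?_) (bV_exp x l h)
    have h2 := hs r le_rfl
    unfold bL at h2
    rw [List.filter_eq_self.2 (fun p hp => by simpa using hb p hp)] at h2
    have : (0:ℝ) ≤ r := Nat.cast_nonneg r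
    linarith only [h2, this]

lemma geo_half (q : ℝ) (hq0 : 0 ≤ q) (hq : q < 1) (r : ℕ) : ∑ j ∈ Ioc 0 (2*r-1), q^(j/2) ≤ 2/(1-q) - 1 := by
  have h1q : 0 < 1 - q := by linarith
  have key : ∀ r, ∑ j ∈ range (2*r), q^(j/2) = 2 * ((1 - q^r)/(1-q)) := by
    intro r
    induction r with
    | zero => simp
    | succ n ih =>
      rw [show 2*(n+1) = 2*n+1+1 by ring, sum_range_succ, sum_range_succ, ih,
        show (2*n+1)/2 = n by omega, show 2*n/2 = n by omega]
      field_simp; ring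
  rcases Nat.eq_zero_or_pos r with rfl | hr
  · simp
    rw [le_div_iff₀ h1q]; linarith
  · have h1 : ∑ j ∈ range (2*r), q^(j/2) = ∑ j ∈ Ioc 0 (2*r-1), q^(j/2) + 1 := by
      have : range (2*r) = insert 0 (Ioc 0 (2*r-1)) := by
        ext j; simp only [mem_range, mem_insert, mem_Ioc]; omega
      rw [this, sum_insert (by simp)]; simp; ring
    rw [key] at h1
    have h2 : (1 - q^r)/(1-q) ≤ 1/(1-q) := by
      apply div_le_div_of_nonneg_right _ h1q.le
      linarith only [pow_nonneg hq0 r]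
    have h3 : 2/(1-q) = 2*(1/(1-q)) := by ring
    linarith only [h1, h2, h3]

lemma geo_k (k : ℕ) (hk : 1 ≤ k) : 2/(1-Real.exp (-(1/(2*k:ℝ)))) - 1 ≤ 4*k+1/3 := by
  have hk' : (1:ℝ) ≤ k := by exact_mod_cast hk
  set t := 1/(2*k:ℝ) with ht
  have htk : t * (2*k) = 1 := by rw [ht]; field_simp
  have ht0 : 0 < t := by positivity
  have h1 : Real.exp (-t) ≤ 1/(1+t+t^2/2) := by
    rw [Real.exp_neg, ← one_div]
    exact one_div_le_one_div_of_le (by positivity) (Real.quadratic_le_exp_of_nonneg ht0.le)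
  have h2 : t - t^2/2 ≤ 1 - 1/(1+t+t^2/2) := by
    rw [le_sub_iff_add_le, ← le_sub_iff_add_le', div_le_iff₀ (by positivity)]
    nlinarith only [pow_pos ht0 3, pow_pos ht0 4]
  have ht2 : t ≤ 1/2 := by nlinarith only [htk, hk', ht0]
  have h3 : 0 < t - t^2/2 := by nlinarith only [ht0, ht2]
  have h4 : t - t^2/2 ≤ 1 - Real.exp (-t) := by linarith only [h1, h2]
  have h5 : 2/(1-Real.exp (-t)) ≤ 2/(t-t^2/2) := div_le_div_of_nonneg_left (by norm_num) h3 h4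
  have h6 : 2/(t-t^2/2) ≤ 4*k+4/3 := by
    rw [div_le_iff₀ h3]
    have e : (4*k+4/3)*(t-t^2/2) = 2*(t*(2*k)) - t*(t*(2*k)) + 4/3*t-2/3*t^2 := by ring
    rw [e, htk]
    nlinarith only [ht0, ht2]
  linarith only [h5, h6]

lemma rem_bound (k r : ℕ) (hk : 1 ≤ k) (y : ℝ) (hy : 1 ≤ y) (blk : ℕ → ℕ) (l : List ℕ) (hl : l.Nodup)
    (hp : ∀ p ∈ l, 0 < p) (hb : ∀ p ∈ l, ∀ n : ℕ, n + 1 ≤ blk p → Real.log p ≤ y * Real.exp (-(1/(2*k:ℝ)))^n)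
    (hr : (r:ℝ) ≤ 2*k*Real.log y) :
    ∏ j ∈ Ioc 0 (2*r-1), (1 + k * (l.countP (fun p => decide (j ≤ 2*blk p - 1)) : ℝ)) ≤
      y^(8*k^2) * Real.exp (y*(4*k+1/3)) := by
  have hk' : (1:ℝ) ≤ k := by exact_mod_cast hk
  set q := Real.exp (-(1/(2*k:ℝ))) with hq
  have hq0 : 0 < q := Real.exp_pos _
  have hq1 : q < 1 := by rw [hq, Real.exp_lt_one_iff]; have : 0 < 1/(2*k:ℝ) := by positivity
                         linarith
  have h1 : ∀ j ∈ Ioc 0 (2*r-1), (1 + k * (l.countP (fun p => decide (j ≤ 2*blk p - 1)) : ℝ)) ≤ (2*k) * Real.exp (y*q^(j/2)) := by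
    intro j hj
    rw [mem_Ioc] at hj
    have hX : (0:ℝ) ≤ y*q^(j/2) := by positivity
    have hc : (l.countP (fun p => decide (j ≤ 2*blk p - 1)) : ℝ) ≤ Real.exp (y*q^(j/2)) := by
      rw [List.countP_eq_length_filter]
      rw [← List.toFinset_card_of_nodup (hl.filter _)]
      have hsub : (l.filter (fun p => decide (j ≤ 2*blk p - 1))).toFinset ⊆ Ioc 0 ⌊Real.exp (y*q^(j/2))⌋₊ := by
        intro p hpm
        rw [List.mem_toFinset, List.mem_filter] at hpm
        obtain ⟨hpl, hj2⟩ := hpm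
        have hj2 : j ≤ 2*blk p - 1 := by simpa using hj2
        rw [mem_Ioc]
        refine ⟨hp p hpl, Nat.le_floor ?_⟩
        rw [← Real.log_le_iff_le_exp (by exact_mod_cast hp p hpl)]
        exact hb p hpl (j/2) (by omega)
      have := card_le_card hsub
      rw [Nat.card_Ioc, Nat.sub_zero] at this
      exact (Nat.cast_le.2 this).trans (Nat.floor_le (Real.exp_pos _).le)
    have h1e : 1 ≤ Real.exp (y*q^(j/2)) := Real.one_le_exp hX
    have := mul_le_mul_of_nonneg_left hc (by linarith only [hk'] : (0:ℝ) ≤ k)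
    nlinarith only [this, h1e, hk']
  refine (prod_le_prod (fun j _ => by positivity) h1).trans ?_
  rw [prod_mul_distrib, ← Real.exp_sum, ← mul_sum, prod_const, Nat.card_Ioc, Nat.sub_zero]
  have h2 := (geo_half q hq0.le hq1 r).trans (geo_k k hk)
  apply mul_le_mul _ _ (Real.exp_pos _).le (by positivity)
  · have h3 : (2*k:ℝ) ≤ Real.exp (2*k) := by linarith only [Real.add_one_le_exp (2*k:ℝ)]
    have e : y^(8*k^2) = Real.exp ((8*k^2)*Real.log y) := by
      conv_lhs => rw [← Real.exp_log (lt_of_lt_of_le one_pos hy)]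
      rw [← Real.exp_nat_mul]; push_cast; rfl
    calc (2*k:ℝ)^(2*r-1) ≤ (2*k)^(2*r) := pow_le_pow_right₀ (by linarith only [hk']) (Nat.sub_le _ _)
      _ ≤ (Real.exp (2*k))^(2*r) := pow_le_pow_left₀ (by positivity) h3 _
      _ = Real.exp (2*r*(2*k)) := by rw [← Real.exp_nat_mul]; push_cast; rfl
      _ ≤ _ := by
        rw [e]
        apply Real.exp_le_exp.2
        have := mul_le_mul_of_nonneg_left hr (show (0:ℝ) ≤ 4*k by positivity)
        nlinarith only [this]
  · apply Real.exp_le_exp.2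
    exact mul_le_mul_of_nonneg_left h2 (by linarith only [hy])

lemma sieve_fix (k : ℕ) (hk : 1 ≤ k) (Rt : ℕ → Finset ℕ) (P0 : ℕ)
    (hRt : ∀ p : ℕ, p.Prime → P0 < p → Rt p ⊆ range p ∧ #(Rt p) ≤ k) :
    ∃ D : ℝ, 0 ≤ D ∧ ∀ (W : ℕ), 0 < W → (∀ p : ℕ, p.Prime → D < Real.log p → Nat.Coprime W p) →
      ∀ (N a : ℕ) (y : ℝ), D ≤ y → (N:ℝ)/W * (1/(4*y^(2*k))) - y^(8*k^2) * Real.exp (y*(4*k+1/3)) ≤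
        #((Ioc 0 N).filter (fun m => m ≡ a [MOD W] ∧ ∀ p ∈ prT y D, m % p ∉ Rt p)) := by
  obtain ⟨w0, hw0, hps⟩ := prime_sum k hk
  have hk' : (1:ℝ) ≤ k := by exact_mod_cast hk
  set w : ℝ := w0 + 1 + 2001*k + P0 with hw
  have hP0 : (0:ℝ) ≤ P0 := Nat.cast_nonneg _
  have hww : w0 ≤ w := by rw [hw]; linarith only [hk', hP0]
  have hw1 : 1 ≤ w := by rw [hw]; linarith only [hk', hP0, hw0]
  have hwp : (P0:ℝ) + 2001*k < w := by rw [hw]; linarith only [hk', hP0, hw0]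
  clear_value w
  refine ⟨2*w, by linarith only [hw1], fun W hW hcop N a y hy => ?_⟩
  have hy0 : 0 < y := by linarith only [hw1, hy]
  have hbig : ∀ p : ℕ, p.Prime → 2*w < Real.log p → (P0:ℝ) + 2001*k < p := by
    intro p hp h
    have : Real.log p ≤ p := Real.log_le_self (by positivity)
    linarith only [this, h, hwp, hw1]
  set blk : ℕ → ℕ := fun p => ⌊2*k*Real.log (y/Real.log p)⌋₊ + 1 with hblk
  set r : ℕ := ⌊2*k*Real.log (y/w)⌋₊ with hr
  set l : List ℕ := (prT y (2*w)).sort (· ≥ ·) with hl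
  have hlm : ∀ p ∈ l, p.Prime ∧ 2*w < Real.log p ∧ Real.log p ≤ y := by
    intro p hp
    rw [hl, mem_sort, mem_prT] at hp
    exact hp
  have hnd : l.Nodup := sort_nodup _ _
  have hr0 : 0 ≤ 2*k*Real.log (y/w) := by
    apply mul_nonneg (by positivity)
    apply Real.log_nonneg
    rw [le_div_iff₀ (by linarith only [hw1])]; linarith only [hy, hw1]
  have hrle : (r:ℝ) ≤ 2*k*Real.log (y/w) := Nat.floor_le hr0
  have hry : (r:ℝ) ≤ 2*k*Real.log y := by
    refine hrle.trans (mul_le_mul_of_nonneg_left ?_ (by positivity))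
    exact Real.log_le_log (by positivity) (div_le_self hy0.le hw1)
  have hbr : ∀ p ∈ l, blk p ≤ r := by
    intro p hp
    obtain ⟨h1, h2, h3⟩ := hlm p hp
    have hlp : 0 < Real.log p := by linarith only [h2, hw1]
    rw [hblk, hr]
    have hu : 0 ≤ 2*k*Real.log (y/Real.log p) := by
      apply mul_nonneg (by positivity)
      apply Real.log_nonneg
      rw [le_div_iff₀ hlp]; linarith only [h3]
    show ⌊2*k*Real.log (y/Real.log p)⌋₊ + 1 ≤ _
    rw [← Nat.floor_add_one hu]
    apply Nat.floor_le_floor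
    rw [Real.log_div hy0.ne' hlp.ne', Real.log_div hy0.ne' (by linarith only [hw1])]
    have h4 : Real.log (2*w) ≤ Real.log (Real.log p) := Real.log_le_log (by linarith only [hw1]) h2.le
    rw [Real.log_mul (by norm_num) (by linarith only [hw1])] at h4
    have := Real.log_two_gt_d9
    nlinarith only [h4, this, hk']
  have hanti : ∀ p ∈ l, ∀ q ∈ l, p ≥ q → blk p ≤ blk q := by
    intro p hp q hq hpq
    have h1 := hlm p hp
    have h2 := hlm q hq
    have hlq : 0 < Real.log q := by linarith only [h2.2.1, hw1]
    have hlp : 0 < Real.log p := by linarith only [h1.2.1, hw1]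
    have hq0 : (0:ℝ) < q := by exact_mod_cast h2.1.pos
    show ⌊_⌋₊ + 1 ≤ ⌊_⌋₊ + 1
    gcongr
  have hpos : ∀ p ∈ l, 0 < p := fun p hp => (hlm p hp).1.pos
  have hs : l.Pairwise (fun p q => blk p ≤ blk q) :=
    (pairwise_sort (prT y (2*w)) (· ≥ ·)).imp_of_mem (fun hp hq h => hanti _ hp _ hq h)
  have hRl : ∀ p ∈ l, Rt p ⊆ range p ∧ #(Rt p) ≤ k := by
    intro p hp
    obtain ⟨h1, h2, h3⟩ := hlm p hp
    have := hbig p h1 h2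
    exact hRt p h1 (by have h : (P0:ℝ) < p := by linarith only [this, hk']
                       exact_mod_cast h)
  have main := brun_abs blk Rt k N r 0 W a l hW (fun p hp => hcop p (hlm p hp).1 (hlm p hp).2.1)
    (hnd.pairwise_of_forall_ne (fun p hp q hq h => (Nat.coprime_primes (hlm p hp).1 (hlm q hq).1).2 h))
    (fun p hp => ⟨hpos p hp, hRl p hp⟩) (fun p hp => ⟨Nat.le_add_left _ _, hbr p hp⟩) hs
  set g : ℕ → ℝ := fun p => (#(Rt p) : ℝ)/p with hg
  have hgk : ∀ p ∈ l, g p ≤ k * (1/(p:ℝ)) := by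
    intro p hp
    have : (#(Rt p):ℝ) ≤ k := by exact_mod_cast (hRl p hp).2
    show (#(Rt p) : ℝ)/p ≤ _
    rw [mul_one_div]
    gcongr
  have hgl : ∀ p ∈ l, 0 ≤ g p ∧ g p ≤ 1/2001 := by
    intro p hp
    refine ⟨by positivity, (hgk p hp).trans ?_⟩
    have h0 : (0:ℝ) < p := by exact_mod_cast hpos p hp
    have := hbig p (hlm p hp).1 (hlm p hp).2.1
    rw [mul_one_div, div_le_div_iff₀ h0 (by norm_num)]
    linarith only [this, hP0]
  have hbL : ∀ n, n ≤ r → bL blk g n l ≤ 0.5005 * n := by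
    intro n hn
    have hnr : (n:ℝ) ≤ 2*k*Real.log (y/w) := (Nat.cast_le.2 hn).trans hrle
    have hyn : w ≤ y * Real.exp (-(n/(2*k))) := by
      have h1 : (n:ℝ)/(2*k) ≤ Real.log (y/w) := by
        rw [div_le_iff₀ (by positivity)]; linarith only [hnr]
      rw [Real.le_log_iff_exp_le (by positivity), le_div_iff₀ (by linarith only [hw1])] at h1
      rw [Real.exp_neg, ← div_eq_mul_inv, le_div_iff₀ (Real.exp_pos _)]
      linarith only [h1]
    refine le_trans ?_ (hps y n (hww.trans hyn))
    unfold bL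
    rw [← List.sum_toFinset g (hnd.filter _), mul_sum]
    refine (sum_le_sum (fun p hp => hgk p ?_)).trans (sum_le_sum_of_subset_of_nonneg ?_ (fun _ _ _ => by positivity))
    · rw [List.mem_toFinset] at hp
      exact List.mem_of_mem_filter hp
    · intro p hp
      rw [List.mem_toFinset, List.mem_filter] at hp
      obtain ⟨hpl, hb⟩ := hp
      have hb : ⌊2*k*Real.log (y/Real.log p)⌋₊ + 1 ≤ n := by simpa [hblk] using hb
      obtain ⟨h1, h2, h3⟩ := hlm p hpl
      have hlp : 0 < Real.log p := by linarith only [h2, hw1]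
      refine mem_prT.2 ⟨h1, ?_, h3⟩
      have h4 := Nat.lt_floor_add_one (2*k*Real.log (y/Real.log p))
      have h5 : (⌊2*k*Real.log (y/Real.log p)⌋₊:ℝ) + 1 ≤ n := by exact_mod_cast hb
      have h6 : Real.log (y/Real.log p) < n/(2*k) := by
        rw [lt_div_iff₀ (by positivity)]; linarith only [h4, h5]
      rw [Real.log_lt_iff_lt_exp (by positivity), div_lt_iff₀ hlp] at h6
      rw [Real.exp_neg, ← div_eq_mul_inv, div_lt_iff₀ (Real.exp_pos _)]
      linarith only [h6]
  obtain ⟨hphi, hV⟩ := phi_bound blk g r l hgl hbL hbr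
  have hrem := rem_bound k r hk y (by linarith only [hy, hw1]) blk l hnd hpos (by
    intro p hp n hn
    obtain ⟨h1, h2, h3⟩ := hlm p hp
    have hlp : 0 < Real.log p := by linarith only [h2, hw1]
    have hn : n ≤ ⌊2*k*Real.log (y/Real.log p)⌋₊ := by simpa [hblk] using hn
    have hu : 0 ≤ 2*k*Real.log (y/Real.log p) := by
      apply mul_nonneg (by positivity)
      apply Real.log_nonneg
      rw [le_div_iff₀ hlp]; linarith only [h3]
    rw [Nat.le_floor_iff hu] at hn
    have h4 : n*(1/(2*k:ℝ)) ≤ Real.log (y/Real.log p) := by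
      rw [mul_one_div, div_le_iff₀ (by positivity)]; linarith only [hn]
    rw [Real.le_log_iff_exp_le (by positivity), le_div_iff₀ hlp] at h4
    rw [← Real.exp_nat_mul, mul_neg, Real.exp_neg, ← div_eq_mul_inv, le_div_iff₀ (Real.exp_pos _)]
    linarith only [h4]) hry
  have hVy : 1/y^(2*k) ≤ bV g l := by
    refine le_trans ?_ hV
    have e : y^(2*k) = Real.exp (2*k*Real.log y) := by
      conv_lhs => rw [← Real.exp_log hy0]
      rw [← Real.exp_nat_mul]; push_cast; rfl
    rw [e, one_div, ← Real.exp_neg]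
    exact Real.exp_le_exp.2 (by linarith only [hry])
  have hset : ((Ioc 0 N).filter (fun m => m ≡ a [MOD W] ∧ ∀ p ∈ prT y (2*w), m % p ∉ Rt p)) =
      ((Ioc 0 N).filter (fun m => m ≡ a [MOD W] ∧ ∀ p ∈ l, m % p ∉ Rt p)) := by
    apply filter_congr
    intro m _
    simp only [hl, mem_sort]
  rw [hset]
  refine le_trans ?_ main
  have hNW : (0:ℝ) ≤ N/W := by positivity
  have e : 1/(4*y^(2*k)) = 1/4*(1/y^(2*k)) := by rw [one_div_mul_one_div]
  have h7 : 1/(4*y^(2*k)) ≤ bV g l - bPhi blk g r l 0 := by rw [e]; linarith only [hVy, hphi]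
  have := mul_le_mul_of_nonneg_left h7 hNW
  linarith only [this, hrem]

lemma exp_beats (C : ℝ) (m : ℕ) : ∃ Y : ℝ, ∀ y, Y ≤ y → C * y^m ≤ Real.exp (2*y/3) := by
  have h := (Real.tendsto_exp_div_pow_atTop m).eventually_ge_atTop (|C| * (3/2)^m)
  obtain ⟨X, hX⟩ := Filter.eventually_atTop.1 (h.and (Filter.eventually_gt_atTop 0))
  refine ⟨3/2*X, fun y hy => ?_⟩
  obtain ⟨h1, h2⟩ := hX (2*y/3) (by linarith)
  rw [le_div_iff₀ (by positivity)] at h1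
  have hy0 : 0 ≤ y := by linarith
  refine le_trans ?_ h1
  rw [mul_assoc, ← mul_pow, show (3/2:ℝ)*(2*y/3) = y by ring]
  exact mul_le_mul_of_nonneg_right (le_abs_self C) (by positivity)

lemma sieve_lb (k : ℕ) (hk : 1 ≤ k) (Rt : ℕ → Finset ℕ) (P0 : ℕ)
    (hRt : ∀ p : ℕ, p.Prime → P0 < p → Rt p ⊆ range p ∧ #(Rt p) ≤ k) :
    ∃ D : ℝ, 0 ≤ D ∧ ∀ (W : ℕ), 0 < W → (∀ p : ℕ, p.Prime → D < Real.log p → Nat.Coprime W p) →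
      ∀ a : ℕ, ∃ N0 : ℕ, ∀ N : ℕ, N0 ≤ N → (N:ℝ)/(Real.log N)^(2*k+1) ≤
        #((Ioc 0 N).filter (fun m => m ≡ a [MOD W] ∧ ∀ p ∈ prT (Real.log N/(4*k+1)) D, m % p ∉ Rt p)) := by
  obtain ⟨D, hD0, hD⟩ := sieve_fix k hk Rt P0 hRt
  refine ⟨D, hD0, fun W hW hcop a => ?_⟩
  obtain ⟨Y, hY⟩ := exp_beats (8*W) (8*k^2+2*k)
  have ht : Filter.Tendsto (fun N : ℕ => Real.log N) Filter.atTop Filter.atTop :=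
    Real.tendsto_log_atTop.comp tendsto_natCast_atTop_atTop
  obtain ⟨N0, hN0⟩ := Filter.eventually_atTop.1
    (ht.eventually_ge_atTop ((4*k+1)*(max (max D Y) 1) + 8*W))
  refine ⟨N0+1, fun N hN => ?_⟩
  have hlog := hN0 N (by omega)
  set y := Real.log N/(4*k+1) with hy
  have hk0 : (0:ℝ) < 4*k+1 := by positivity
  have hyL : Real.log N = (4*k+1)*y := by rw [hy]; field_simp
  have hWr : (1:ℝ) ≤ W := by exact_mod_cast hW
  have hmax : max (max D Y) 1 ≤ y := by
    rw [hy, le_div_iff₀ hk0]; linarith only [hlog, hWr]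
  have hyD : D ≤ y := (le_max_left _ _).trans ((le_max_left _ _).trans hmax)
  have hyY : Y ≤ y := (le_max_right _ _).trans ((le_max_left _ _).trans hmax)
  have hy1 : 1 ≤ y := (le_max_right _ _).trans hmax
  have hL8 : 8*(W:ℝ) ≤ Real.log N := by
    have : 0 ≤ (4*k+1)*(max (max D Y) 1) := mul_nonneg hk0.le (zero_le_one.trans (le_max_right _ _))
    linarith only [this, hlog]
  have hyN : y ≤ Real.log N := by
    rw [hyL]; exact le_mul_of_one_le_left (by linarith only [hy1]) (by linarith only [Nat.cast_nonneg (α := ℝ) k])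
  have hN1 : (0:ℝ) < N := by exact_mod_cast (by omega : 0 < N)
  refine le_trans ?_ (hD W hW hcop N a y hyD)
  have hexp : Real.exp (y*(4*k+1/3)) * Real.exp (2*y/3) = N := by
    rw [← Real.exp_add, ← Real.exp_log hN1, hyL]; congr 1; ring
  have h1 := hY y hyY
  have hyp : 0 < y^(2*k) := by positivity
  have h2 : y^(8*k^2) * Real.exp (y*(4*k+1/3)) ≤ (N:ℝ)/(8*W*y^(2*k)) := by
    rw [le_div_iff₀ (by positivity), ← hexp]
    have := mul_le_mul_of_nonneg_left h1 (Real.exp_pos (y*(4*k+1/3))).le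
    refine le_trans (le_of_eq ?_) this
    rw [pow_add]; ring
  have h3 : (N:ℝ)/W*(1/(4*y^(2*k))) = 2 * ((N:ℝ)/(8*W*y^(2*k))) := by field_simp; norm_num
  rw [h3]
  have h4 : (N:ℝ)/(Real.log N)^(2*k+1) ≤ (N:ℝ)/(8*W*y^(2*k)) := by
    apply div_le_div_of_nonneg_left hN1.le (by positivity)
    rw [pow_succ, mul_comm]
    exact mul_le_mul (pow_le_pow_left₀ (by linarith only [hy1]) hyN _) hL8 (by positivity) (by positivity) |>.trans' (by rw [mul_comm])
  linarith only [h2, h4]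
lemma F_modEq (k : ℕ) (a b : Fin k → ℤ) (F : ℤ → ℤ) (hF : ∀ n : ℤ, F n = ∏ i, (a i * n + b i))
    (p m n : ℤ) (h : m ≡ n [ZMOD p]) : p ∣ F m ↔ p ∣ F n := by
  have : F m ≡ F n [ZMOD p] := by
    rw [hF, hF]
    induction (univ : Finset (Fin k)) using Finset.induction_on with
    | empty => simp
    | insert i s hi ih =>
      rw [prod_insert hi, prod_insert hi]
      exact ((h.mul_left _).add_right _).mul ih
  rw [← Int.modEq_zero_iff_dvd, ← Int.modEq_zero_iff_dvd]
  exact ⟨fun h => this.symm.trans h, fun h => this.trans h⟩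

lemma S_lb (k : ℕ) (hk : 1 ≤ k) (a b : Fin k → ℤ) (ha : ∀ i, a i ≠ 0)
    (F : ℤ → ℤ) (hF : ∀ n : ℤ, F n = ∏ i, (a i * n + b i))
    (hadm : ∀ p : ℕ, p.Prime → ∃ n : ℤ, ¬ ((p : ℤ) ∣ F n)) :
    ∃ N0 : ℕ, ∀ N : ℕ, N0 ≤ N → (N:ℝ)/(Real.log N)^(2*k+1) ≤
      #(SFset F N ((N : ℝ) ^ ((1 : ℝ) / (4 * k + 1)))) := by
  obtain ⟨D, hD0, hD⟩ := sieve_lb k hk (fun p => (range p).filter (fun ρ : ℕ => (p:ℤ) ∣ F ρ)) (∏ i, (a i).natAbs) (by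
    intro p hp hlt
    refine ⟨filter_subset _ _, ?_⟩
    have hpz : Prime (p:ℤ) := Nat.prime_iff_prime_int.1 hp
    have hna : ∀ i, ¬ (p:ℤ) ∣ a i := by
      intro i h
      rw [Int.natCast_dvd] at h
      have h2 : (a i).natAbs ∣ ∏ i, (a i).natAbs := dvd_prod_of_mem _ (mem_univ i)
      have := Nat.le_of_dvd (prod_pos (fun i _ => Int.natAbs_pos.2 (ha i))) (h.trans h2)
      omega
    have hsub : (range p).filter (fun ρ : ℕ => (p:ℤ) ∣ F ρ) ⊆
        univ.biUnion (fun i => (range p).filter (fun ρ : ℕ => (p:ℤ) ∣ a i * ρ + b i)) := by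
      intro ρ hρ
      rw [mem_filter, hF] at hρ
      obtain ⟨i, _, hi⟩ := (hpz.dvd_finset_prod_iff _).1 hρ.2
      rw [mem_biUnion]
      exact ⟨i, mem_univ _, mem_filter.2 ⟨hρ.1, hi⟩⟩
    refine (card_le_card hsub).trans ?_
    refine (card_biUnion_le_card_mul _ _ 1 ?_).trans (by simp)
    intro i _
    rw [card_le_one]
    intro x hx z hz
    rw [mem_filter, mem_range] at hx hz
    have h1 : (p:ℤ) ∣ a i * (x - z) := by
      have := dvd_sub hx.2 hz.2
      rwa [show a i * (x:ℤ) + b i - (a i * z + b i) = a i * (x - z) by ring] at this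
    have h2 := (hpz.dvd_or_dvd h1).resolve_left (hna i)
    have h3 : z ≡ x [MOD p] := (Nat.modEq_iff_dvd).2 h2
    exact (Nat.ModEq.eq_of_lt_of_lt h3 hz.1 hx.1).symm)
  have hn : ∀ p : ℕ, ∃ n : ℕ, p.Prime → ¬ ((p:ℤ) ∣ F n) := by
    intro p
    by_cases hp : p.Prime
    · obtain ⟨n, hn⟩ := hadm p hp
      have hp0 : (p:ℤ) ≠ 0 := by exact_mod_cast hp.ne_zero
      refine ⟨(n % p).toNat, fun _ h => hn ?_⟩
      rw [Int.toNat_of_nonneg (Int.emod_nonneg _ hp0)] at h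
      exact (F_modEq k a b F hF p _ _ (Int.mod_modEq n p)).1 h
    · exact ⟨0, fun h => absurd h hp⟩
  choose f hf using hn
  set s := prT D (-1) with hs
  have hsp : ∀ p ∈ s, p.Prime := fun p hp => (mem_prT.1 hp).1
  obtain ⟨a0, ha0⟩ := Nat.chineseRemainderOfFinset f id s (fun p hp => (hsp p hp).ne_zero)
    (fun p hp q hq h => (Nat.coprime_primes (hsp p hp) (hsp q hq)).2 h)
  obtain ⟨N0, hN0⟩ := hD (∏ p ∈ s, p) (prod_pos (fun p hp => (hsp p hp).pos)) (by
    intro p hp hlt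
    apply Nat.Coprime.prod_left
    intro q hq
    refine (Nat.coprime_primes (hsp q hq) hp).2 ?_
    rintro rfl
    have := (mem_prT.1 hq).2.2
    linarith) a0
  refine ⟨N0+1, fun N hN => (hN0 N (by omega)).trans ?_⟩
  have hNr : (0:ℝ) < N := by exact_mod_cast (by omega : 0 < N)
  rw [Nat.cast_le]
  apply card_le_card
  intro m hm
  rw [mem_filter, mem_Ioc] at hm
  obtain ⟨⟨hm0, hmN⟩, hma, hml⟩ := hm
  unfold SFset
  rw [mem_filter, mem_Icc]
  refine ⟨⟨hm0, hmN⟩, ?_⟩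
  rw [← Int.isCoprime_iff_gcd_eq_one]
  unfold primor
  push_cast
  apply IsCoprime.prod_right
  intro p hp
  rw [mem_filter, mem_range, Nat.lt_succ_iff, Nat.le_floor_iff (by positivity)] at hp
  obtain ⟨hpz, hp⟩ := hp
  have hlp : Real.log p ≤ Real.log N/(4*k+1) := by
    have := Real.log_le_log (by exact_mod_cast hp.pos) hpz
    rw [Real.log_rpow hNr] at this
    refine this.trans (le_of_eq (by ring))
  have hlp0 : 0 ≤ Real.log p := Real.log_natCast_nonneg p
  rw [isCoprime_comm, (Nat.prime_iff_prime_int.1 hp).coprime_iff_not_dvd]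
  rcases lt_or_ge D (Real.log p) with h | h
  · have h1 := hml p (mem_prT.2 ⟨hp, h, hlp⟩)
    intro h2
    apply h1
    rw [mem_filter, mem_range]
    refine ⟨Nat.mod_lt _ hp.pos, ?_⟩
    refine (F_modEq k a b F hF p _ _ ?_).1 h2
    push_cast
    exact (Int.mod_modEq m p).symm
  · have hps : p ∈ s := mem_prT.2 ⟨hp, by linarith, h⟩
    intro h2
    apply hf p hp
    refine (F_modEq k a b F hF p _ _ ?_).1 h2
    rw [Int.natCast_modEq_iff]
    exact (hma.of_dvd (dvd_prod_of_mem _ hps)).trans (ha0 p hps)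

theorem stmt0
    (k : ℕ) (hk : 1 ≤ k) (a b : Fin k → ℤ) (ha : ∀ i, a i ≠ 0)
    (F : ℤ → ℤ) (hF : ∀ n : ℤ, F n = ∏ i, (a i * n + b i))
    (hdisc : (∏ i, a i) *
      ∏ i, ∏ j ∈ Finset.univ.filter (fun j => j ≠ i), (a i * b j - b i * a j) ≠ 0)
    (hadm : ∀ p : ℕ, p.Prime → ∃ n : ℤ, ¬ ((p : ℤ) ∣ F n))
    (cc : Fin 3 → ℤ) (hcc : ∀ i, cc i ≠ 0) (hti : ∑ i, cc i = 0)
    (ε : ℝ) (hε : 0 < ε) :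
    ∃ (c : ℝ) (N₀ : ℕ), 0 < c ∧
      ∀ N : ℕ, N₀ ≤ N →
        ∀ A : Finset ℕ, A ⊆ SFset F N ((N : ℝ) ^ ((1 : ℝ) / (4 * k + 1))) →
          c * (Real.log (Real.log N)) ^ (-(1 - ε)) *
              ((SFset F N ((N : ℝ) ^ ((1 : ℝ) / (4 * k + 1)))).card : ℝ)
            ≤ (A.card : ℝ) →
          ∃ x : Fin 3 → ℕ, (∀ i, x i ∈ A) ∧
            (∑ i, cc i * (x i : ℤ)) = 0 ∧ ∃ i j, x i ≠ x j := by
  rw [Fin.sum_univ_three] at hti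
  obtain ⟨N1, h1⟩ := S_lb k hk a b ha F hF hadm
  obtain ⟨N2, h2⟩ := km_int (cc 0) (cc 1) (cc 2) hti (hcc 0) (hcc 1) (hcc 2) (2*k+2)
  have ht : Filter.Tendsto (fun N : ℕ => Real.log N) Filter.atTop Filter.atTop :=
    Real.tendsto_log_atTop.comp tendsto_natCast_atTop_atTop
  obtain ⟨N3, h3⟩ := Filter.eventually_atTop.1 ((Real.tendsto_log_atTop.comp ht).eventually_ge_atTop 1)
  obtain ⟨N4, h4⟩ := Filter.eventually_atTop.1 (ht.eventually_ge_atTop 1)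
  refine ⟨1, N1+N2+N3+N4, one_pos, fun N hN A hA hc => ?_⟩
  have h1 := h1 N (by omega)
  have h3 : 1 ≤ Real.log (Real.log N) := h3 N (by omega)
  have h4 : 1 ≤ Real.log N := h4 N (by omega)
  set S := SFset F N ((N : ℝ) ^ ((1 : ℝ) / (4 * k + 1))) with hS
  set L := Real.log N with hL
  have h5 : L⁻¹ ≤ (Real.log L) ^ (-(1 - ε)) := by
    have h6 : (Real.log L)^(-1:ℝ) ≤ (Real.log L) ^ (-(1 - ε)) :=
      Real.rpow_le_rpow_of_exponent_le h3 (by linarith)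
    rw [Real.rpow_neg_one] at h6
    refine le_trans ?_ h6
    exact inv_anti₀ (by linarith) (Real.log_le_self (by linarith))
  have h7 : (N:ℝ)/L^(2*k+2) ≤ #A := by
    refine le_trans ?_ hc
    rw [one_mul]
    have : (N:ℝ)/L^(2*k+2) = L⁻¹ * (N/L^(2*k+1)) := by
      rw [pow_succ]; field_simp
    rw [this]
    exact mul_le_mul h5 h1 (by positivity) (Real.rpow_nonneg (by linarith) _)
  obtain ⟨x, hx, y, hy, z, hz, he, hne⟩ := h2 N (by omega) A (hA.trans (filter_subset _ _)) h7
  refine ⟨![x, y, z], ?_, ?_, 0, 2, by simpa using hne⟩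
  · intro i; fin_cases i <;> simpa
  · rw [Fin.sum_univ_three]; simpa using he
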